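/- Let g(B_1) denote the number of generators of the automorphism group of the left tree B_1 of a uniformly random tanglegram of size n (the number of internal vertices whose two branches are isomorphic). Then g(B_1) is asymptotically normally distributed: there exist constants γ > 0 and σ > 0 such that for every real x, lim_{n→∞} P(g(B_1) ≤ γn + xσ√n) = (1/√(2π)) ∫_{−∞}^x e^{−t²/2} dt. -/

import Mathlib

open scoped Classical

inductive PTree : Type
  | leaf : PTree
  | node : PTree → PTree → PTree
deriving DecidableEq

namespace PTree

def size : PTree → ℕ
  | leaf => 1
  | node l r => size l + size r

def cherries : PTree → ℕ
  | leaf => 0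
  | node leaf leaf => 1
  | node l r => cherries l + cherries r

def height : PTree → ℕ
  | leaf => 0
  | node l r => max (height l) (height r) + 1

def encode : PTree → ℕ
  | leaf => 0
  | node l r => Nat.pair (encode l) (encode r) + 1

def normalize : PTree → PTree
  | leaf => leaf
  | node l r =>
      let l' := normalize l
      let r' := normalize r
      if encode l' ≤ encode r' then node l' r' else node r' l'

def isoFuns : PTree → PTree → List (ℕ → ℕ)
  | leaf, leaf => [fun i => i]
  | node l r, node l' r' =>
      ((isoFuns l l').flatMap fun g => (isoFuns r r').map fun h =>
        fun i => if i < l.size then g i else h (i - l.size) + l'.size)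
      ++
      ((isoFuns l r').flatMap fun g => (isoFuns r l').map fun h =>
        fun i => if i < l.size then g i + l'.size else h (i - l.size))
  | _, _ => []

def planeTrees : ℕ → Finset PTree
  | 0 => ∅
  | 1 => {leaf}
  | n + 2 =>
      (Finset.range (n + 1)).attach.biUnion fun k =>
        ((planeTrees (k.1 + 1)) ×ˢ (planeTrees (n + 1 - k.1))).image
          fun p => node p.1 p.2
  termination_by n => n
  decreasing_by
  · have := Finset.mem_range.mp k.2; omega
  · omega

def binTrees (n : ℕ) : Finset PTree := (planeTrees n).image normalize

/-- Triples (T, v, S): left plane tree, right plane tree, and a matching `v`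
(a permutation of `0, …, n-1`, encoded as the list of its values) matching
leaf `i` of `T` with leaf `v i` of `S`. -/
def Triples (n : ℕ) : Finset (PTree × PTree × List ℕ) :=
  (planeTrees n) ×ˢ ((planeTrees n) ×ˢ (List.range n).permutations.toFinset)

/-- Two triples represent the same tanglegram iff there are isomorphisms of the left
trees and of the right trees compatible with the matchings. -/
def equivTriple (n : ℕ) (t t' : PTree × PTree × List ℕ) : Bool :=
  (isoFuns t.1 t'.1).any fun φ => (isoFuns t.2.1 t'.2.1).any fun ψ =>
    (List.range n).all fun i => t'.2.2.getD (φ i) 0 == ψ (t.2.2.getD i 0)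

/-- The tanglegrams of size `n`: equivalence classes of triples. -/
def tangleClasses (n : ℕ) : Finset (Finset (PTree × PTree × List ℕ)) :=
  (Triples n).image fun t => (Triples n).filter (fun t' => equivTriple n t t' = true)

/-- The number of tanglegrams of size `n`. -/
def numTanglegrams (n : ℕ) : ℕ := (tangleClasses n).card

/-- The probability that a uniformly random tanglegram of size `n` satisfies the
(isomorphism-invariant) property `P` of triples. -/
noncomputable def tangleProb (n : ℕ) (P : PTree × PTree × List ℕ → Prop) : ℝ :=
  ((tangleClasses n).filter fun c => ∃ t ∈ c, P t).card / numTanglegrams n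

/-- The expectation of the statistic `f` of a uniformly random tanglegram of size `n`. -/
noncomputable def tangleExp (n : ℕ) (f : PTree × PTree × List ℕ → ℕ) : ℝ :=
  ∑' k : ℕ, (k : ℝ) * tangleProb n (fun t => f t = k)

end PTree

namespace PTree

/-- The distribution on pairs of binary trees (canonical representatives) induced by
the two halves of a uniformly random tanglegram of size `n`:
probability that the pair of isomorphism classes of the two trees lies in `S`. -/
noncomputable def nuT (n : ℕ) (S : Finset (PTree × PTree)) : ℝ :=
  tangleProb n fun t => (normalize t.1, normalize t.2.1) ∈ S

/-- The distribution on pairs of binary trees induced by two independent uniformly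
random plane binary trees with `n` leaves. -/
noncomputable def nuP (n : ℕ) (S : Finset (PTree × PTree)) : ℝ :=
  (((planeTrees n) ×ˢ (planeTrees n)).filter
      fun p => (normalize p.1, normalize p.2) ∈ S).card / ((planeTrees n).card ^ 2 : ℝ)

/-- The total variation distance between `nuT` and `nuP`. -/
noncomputable def tvDist (n : ℕ) : ℝ :=
  ((binTrees n ×ˢ binTrees n).powerset).sup' (Finset.powerset_nonempty _)
    fun S => |nuT n S - nuP n S|

/-- The number of occurrences of (trees isomorphic to) `B` as a fringe subtree of `T`. -/
def occ (B : PTree) : PTree → ℕ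
  | leaf => if normalize leaf = normalize B then 1 else 0
  | node l r => (if normalize (node l r) = normalize B then 1 else 0) + occ B l + occ B r

/-- The number of generators of the automorphism group of `T`: the number of internal
vertices whose two branches are isomorphic. -/
def gens : PTree → ℕ
  | leaf => 0
  | node l r => (if normalize l = normalize r then 1 else 0) + gens l + gens r

/-- `T` has a root branch isomorphic to `B`. -/
def hasBranch (B : PTree) : PTree → Prop
  | leaf => False
  | node l r => normalize l = normalize B ∨ normalize r = normalize B

/-- The cherries of a plane binary tree whose leaves are numbered from `k` on
(left to right), as pairs of leaf positions. -/
def cherryList : PTree → ℕ → List (ℕ × ℕ)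
  | leaf, _ => []
  | node leaf leaf, k => [(k, k + 1)]
  | node l r, k => cherryList l k ++ cherryList r (k + l.size)

/-- The number of matched cherries: cherries of `T` whose two leaves are matched by `L`
to the two leaves of a cherry of `S`. -/
def matchedCherries (T S : PTree) (L : List ℕ) : ℕ :=
  (cherryList T 0).countP fun p =>
    (cherryList S 0).any fun q =>
      (L.getD p.1 0 == q.1 && L.getD p.2 0 == q.2) ||
      (L.getD p.1 0 == q.2 && L.getD p.2 0 == q.1)

/-- The number of automorphisms of the tanglegram represented by the triple `(T, L, S)`:
pairs of automorphisms of the two trees compatible with the matching `L`. -/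
def tangleAutCount (T S : PTree) (L : List ℕ) : ℕ :=
  ((isoFuns T T).map fun a =>
    (isoFuns S S).countP fun b =>
      (List.range T.size).all fun i => L.getD (a i) 0 == b (L.getD i 0)).sum

/-- The number of automorphisms of `T` whose cycle type is `μ(s) = 2^s 1^(n-2s)`,
i.e. involutions of the leaves moving exactly `2 s` leaves. -/
def autMuCount (T : PTree) (s : ℕ) : ℕ :=
  (isoFuns T T).countP fun f =>
    ((List.range T.size).all fun i => f (f i) == i) &&
    ((List.range T.size).countP fun i => !(f i == i)) == 2 * s

end PTree

namespace PTree
open Finset PowerSeries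

lemma size_pos : ∀ T : PTree, 0 < size T
  | leaf => Nat.one_pos
  | node l r => Nat.add_pos_left (size_pos l) _

lemma size_eq_one_iff {T : PTree} : size T = 1 ↔ T = leaf := by
  cases T with
  | leaf => simp [size]
  | node l r =>
    have := size_pos l
    have := size_pos r
    simp [size]
    omega

lemma mem_planeTrees {n : ℕ} {T : PTree} : T ∈ planeTrees n ↔ size T = n := by
  induction n using Nat.strong_induction_on generalizing T with
  | _ n ih =>
    match n, ih with
    | 0, _ => simp [planeTrees, (size_pos T).ne']
    | 1, _ => simp [planeTrees, size_eq_one_iff]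
    | n + 2, ih =>
      rw [planeTrees]
      simp only [mem_biUnion, mem_attach, true_and, mem_image, mem_product, Subtype.exists,
        mem_range, Prod.exists]
      constructor
      · rintro ⟨k, hk, l, r, ⟨hl, hr⟩, rfl⟩
        rw [ih _ (by omega)] at hl hr
        simp only [size]
        omega
      · intro h
        cases T with
        | leaf => simp [size] at h
        | node l r =>
          have := size_pos l
          have := size_pos r
          simp only [size] at h
          refine ⟨size l - 1, by omega, l, r, ⟨?_, ?_⟩, rfl⟩
          · rw [ih _ (by omega)]; omega
          · rw [ih _ (by omega)]; omega

lemma sum_planeTrees {R : Type*} [AddCommMonoid R] (f : PTree → R) (n : ℕ) :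
    ∑ T ∈ planeTrees n, f T = (if n = 1 then f leaf else 0) +
      ∑ p ∈ antidiagonal n, ∑ l ∈ planeTrees p.1, ∑ r ∈ planeTrees p.2, f (node l r) := by
  have hdec : planeTrees n = (if n = 1 then {leaf} else ∅) ∪
      (antidiagonal n).biUnion fun p =>
        (planeTrees p.1 ×ˢ planeTrees p.2).image fun q => node q.1 q.2 := by
    ext T
    cases T with
    | leaf =>
      by_cases h : n = 1
      · simp [h, mem_planeTrees, size]
      · simp [h, mem_planeTrees, size, Ne.symm h]
    | node l r =>
      by_cases h : n = 1
      · have := size_pos l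
        have := size_pos r
        simp [h, mem_planeTrees, size]
      · simp [h, mem_planeTrees, size]
  rw [hdec, sum_union, sum_biUnion]
  · congr 1
    · split_ifs <;> simp
    · refine sum_congr rfl fun p _ => ?_
      rw [sum_image, sum_product]
      rintro ⟨a, b⟩ - ⟨c, d⟩ - h
      simpa using h
  · rintro ⟨a, b⟩ - ⟨c, d⟩ - h
    simp only [Function.onFun]
    rw [Finset.disjoint_left]
    intro T h1 h2
    simp only [mem_image, mem_product, mem_planeTrees, Prod.exists] at h1 h2
    obtain ⟨l, r, ⟨rfl, rfl⟩, rfl⟩ := h1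
    obtain ⟨l', r', ⟨rfl, rfl⟩, h3⟩ := h2
    simp only [node.injEq] at h3
    exact h (by rw [h3.1, h3.2])
  · rw [Finset.disjoint_left]
    intro T h1 h2
    split_ifs at h1 with h
    · simp only [mem_singleton] at h1
      subst h1
      simp at h2
    · simp at h1

/-- The generating function of plane trees by number of leaves, weighted by `f`. -/
noncomputable def gf {R : Type*} [CommRing R] (f : PTree → R) : PowerSeries R :=
  PowerSeries.mk fun n => ∑ T ∈ planeTrees n, f T

lemma coeff_gf {R : Type*} [CommRing R] (f : PTree → R) (n : ℕ) :
    coeff n (gf f) = ∑ T ∈ planeTrees n, f T := coeff_mk _ _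

lemma gf_eq {R : Type*} [CommRing R] (f : PTree → R) (d : PTree → PTree → R)
    (h1 : f leaf = 1) (h : ∀ l r, f (node l r) = f l * f r + d l r) :
    gf f = X + gf f ^ 2 + PowerSeries.mk fun n => ∑ p ∈ antidiagonal n,
      ∑ l ∈ planeTrees p.1, ∑ r ∈ planeTrees p.2, d l r := by
  ext n
  rw [coeff_gf, sum_planeTrees, map_add, map_add, coeff_mk, sq, coeff_mul, coeff_X, h1, add_assoc,
    ← sum_add_distrib]
  congr 1
  refine sum_congr rfl fun p _ => ?_
  rw [coeff_gf, coeff_gf, sum_mul_sum, ← sum_add_distrib]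
  refine sum_congr rfl fun l _ => ?_
  rw [← sum_add_distrib]
  exact sum_congr rfl fun r _ => h l r

lemma card_planeTrees_succ (n : ℕ) : (planeTrees (n + 1)).card = catalan n := by
  induction n using Nat.strong_induction_on with
  | _ n ih =>
    rcases n with _ | n
    · simp [planeTrees]
    · have h := sum_planeTrees (fun _ => (1 : ℕ)) (n + 1 + 1)
      simp only [sum_const, smul_eq_mul, mul_one, Nat.add_eq_right, Nat.succ_ne_zero, if_false,
        zero_add] at h
      rw [h, catalan_succ']
      rw [Nat.antidiagonal_succ, sum_cons, sum_map]
      simp only [planeTrees, card_empty, zero_mul, zero_add]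
      rw [Nat.antidiagonal_succ', sum_cons, sum_map]
      simp only [Function.Embedding.prodMap, Function.Embedding.coeFn_mk, Prod.map]
      simp [planeTrees]
      refine sum_congr rfl fun p hp => ?_
      rw [HasAntidiagonal.mem_antidiagonal] at hp
      rw [ih _ (by omega), ih _ (by omega)]

/-- The number of isomorphisms between two plane trees. -/
def cnt : PTree → PTree → ℕ
  | leaf, leaf => 1
  | node l r, node l' r' => cnt l l' * cnt r r' + cnt l r' * cnt r l'
  | _, _ => 0

lemma encode_injective : Function.Injective encode := by
  intro T
  induction T with
  | leaf => intro S h; cases S <;> simp_all [encode]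
  | node l r ihl ihr =>
    intro S h
    cases S with
    | leaf => simp [encode] at h
    | node l' r' =>
      simp only [encode, Nat.add_right_cancel_iff, Nat.pair_eq_pair] at h
      rw [ihl h.1, ihr h.2]

lemma normalize_node_eq_iff {l r l' r' : PTree} :
    normalize (node l r) = normalize (node l' r') ↔
      (normalize l = normalize l' ∧ normalize r = normalize r') ∨
      (normalize l = normalize r' ∧ normalize r = normalize l') := by
  simp only [normalize]
  generalize normalize l = a, normalize r = b, normalize l' = c, normalize r' = d
  have hanti : ∀ {x y : PTree}, encode x ≤ encode y → encode y ≤ encode x → x = y :=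
    fun h1 h2 => encode_injective (le_antisymm h1 h2)
  split_ifs with h1 h2 h2 <;> simp only [node.injEq]
  · refine ⟨Or.inl, ?_⟩
    rintro (h | ⟨rfl, rfl⟩)
    · exact h
    · have := hanti h1 h2; simp_all
  · refine ⟨Or.inr, ?_⟩
    rintro (⟨rfl, rfl⟩ | h)
    · exact absurd h1 h2
    · exact h
  · constructor
    · rintro ⟨rfl, rfl⟩; exact Or.inr ⟨rfl, rfl⟩
    · rintro (⟨rfl, rfl⟩ | ⟨rfl, rfl⟩)
      · exact absurd h2 h1
      · exact ⟨rfl, rfl⟩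
  · constructor
    · rintro ⟨rfl, rfl⟩; exact Or.inl ⟨rfl, rfl⟩
    · rintro (⟨rfl, rfl⟩ | ⟨rfl, rfl⟩)
      · exact ⟨rfl, rfl⟩
      · have h3 : encode b ≤ encode a := by omega
        have h4 : encode a ≤ encode b := by omega
        rw [hanti h3 h4]
        exact ⟨rfl, rfl⟩

lemma normalize_node_ne_leaf (l r : PTree) : normalize (node l r) ≠ leaf := by
  simp only [normalize]
  split_ifs <;> simp

lemma cnt_eq (T S : PTree) :
    cnt T S = if normalize T = normalize S then 2 ^ gens T else 0 := by
  induction T generalizing S with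
  | leaf =>
    cases S with
    | leaf => simp [cnt, gens]
    | node l r =>
      have := normalize_node_ne_leaf l r
      rw [if_neg (by rw [normalize]; exact this.symm)]
      simp [cnt]
  | node l r ihl ihr =>
    cases S with
    | leaf =>
      rw [if_neg (by rw [show normalize leaf = leaf from rfl]; exact normalize_node_ne_leaf l r)]
      simp [cnt]
    | node l' r' =>
      simp only [cnt, ihl, ihr, normalize_node_eq_iff, gens]
      generalize normalize l = a, normalize r = b, normalize l' = c, normalize r' = d
      by_cases hab : a = b
      · subst hab
        by_cases h1 : a = c
        · subst h1
          by_cases h2 : a = d <;> simp [h2, pow_add] <;> ring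
        · by_cases h2 : a = d
          · subst h2
            simp [h1]
          · simp [h1, h2]
      · by_cases h1 : a = c <;> by_cases h2 : b = d <;> by_cases h3 : a = d <;>
          by_cases h4 : b = c <;> simp_all [pow_add]

lemma size_eq_of_cnt_ne_zero {T S : PTree} (h : cnt T S ≠ 0) : size T = size S := by
  induction T generalizing S with
  | leaf => cases S <;> simp_all [cnt, size]
  | node l r ihl ihr =>
    cases S with
    | leaf => simp [cnt] at h
    | node l' r' =>
      simp only [size]
      by_cases h1 : cnt l l' * cnt r r' = 0
      · have h2 : cnt l r' * cnt r l' ≠ 0 := by simpa [cnt, h1] using h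
        rw [ihl (left_ne_zero_of_mul h2), ihr (right_ne_zero_of_mul h2), add_comm]
      · rw [ihl (left_ne_zero_of_mul h1), ihr (right_ne_zero_of_mul h1)]

lemma gens_eq_of_normalize_eq {T S : PTree} (h : normalize T = normalize S) :
    gens T = gens S := by
  induction T generalizing S with
  | leaf =>
    cases S with
    | leaf => rfl
    | node l r => exact absurd h.symm (normalize_node_ne_leaf l r)
  | node l r ihl ihr =>
    cases S with
    | leaf => exact absurd h (normalize_node_ne_leaf l r)
    | node l' r' =>
      rw [normalize_node_eq_iff] at h
      rcases h with ⟨h1, h2⟩ | ⟨h1, h2⟩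
      · simp only [gens, ihl h1, ihr h2, h1, h2]
      · simp only [gens, ihl h1, ihr h2, h1, h2, eq_comm (a := normalize l')]
        ring

lemma size_eq_of_normalize_eq {T S : PTree} (h : normalize T = normalize S) : size T = size S :=
  size_eq_of_cnt_ne_zero (by rw [cnt_eq, if_pos h]; positivity)

lemma sum_cnt (T : PTree) (n : ℕ) :
    ∑ S ∈ planeTrees n, cnt T S = if n = size T then 2 ^ (size T - 1) else 0 := by
  split_ifs with h
  · subst h
    induction T with
    | leaf => simp [size, planeTrees, cnt]
    | node l r ihl ihr =>
      have hl := size_pos l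
      have hr := size_pos r
      have h0 : ∀ (T : PTree) (n : ℕ), n ≠ size T → ∑ S ∈ planeTrees n, cnt T S = 0 := by
        intro T n hn
        refine sum_eq_zero fun S hS => ?_
        by_contra hc
        exact hn ((mem_planeTrees.1 hS).symm.trans (size_eq_of_cnt_ne_zero hc).symm)
      rw [sum_planeTrees, show cnt (node l r) leaf = 0 from rfl, ite_self, zero_add]
      simp only [size, cnt, sum_add_distrib]
      have e1 : ∑ p ∈ antidiagonal (size l + size r), ∑ l' ∈ planeTrees p.1,
          ∑ r' ∈ planeTrees p.2, cnt l l' * cnt r r' = 2 ^ (size l - 1) * 2 ^ (size r - 1) := by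
        rw [sum_eq_single (size l, size r)]
        · rw [← sum_mul_sum, ihl, ihr]
        · rintro ⟨a, b⟩ hab hne
          rw [← sum_mul_sum]
          rw [HasAntidiagonal.mem_antidiagonal] at hab
          rw [h0 l a, zero_mul]
          rintro rfl
          exact hne (by simp at hab; simp [hab])
        · simp
      have e2 : ∑ p ∈ antidiagonal (size l + size r), ∑ l' ∈ planeTrees p.1,
          ∑ r' ∈ planeTrees p.2, cnt l r' * cnt r l' = 2 ^ (size l - 1) * 2 ^ (size r - 1) := by
        rw [sum_eq_single (size r, size l)]
        · rw [sum_comm, ← sum_mul_sum, ihl, ihr]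
        · rintro ⟨a, b⟩ hab hne
          rw [sum_comm, ← sum_mul_sum]
          rw [HasAntidiagonal.mem_antidiagonal] at hab
          rw [h0 l b, zero_mul]
          rintro rfl
          simp only at hab
          exact hne (by rw [show a = size r by omega])
        · simp [add_comm]
      rw [e1, e2]
      rw [← two_mul, ← pow_add, ← pow_succ']
      congr 1
      omega
  · refine sum_eq_zero fun S hS => ?_
    by_contra hc
    exact h ((mem_planeTrees.1 hS).symm.trans (size_eq_of_cnt_ne_zero hc).symm)

lemma gens_lt_size (T : PTree) : gens T < size T := by
  induction T with
  | leaf => simp [gens, size]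
  | node l r ihl ihr =>
    simp only [gens, size]
    split_ifs <;> omega

lemma card_filter_normalize_mul (l : PTree) (n : ℕ) :
    ((planeTrees n).filter fun r => normalize l = normalize r).card * 2 ^ gens l =
      if n = size l then 2 ^ (size l - 1) else 0 := by
  rw [← sum_cnt, card_eq_sum_ones, sum_mul, sum_filter]
  exact sum_congr rfl fun S _ => by rw [cnt_eq, one_mul]


end PTree

namespace PTree
open Finset PowerSeries

lemma succ_mul_card_planeTrees (n : ℕ) :
    (n + 2) * (planeTrees (n + 2)).card = (4 * n + 2) * (planeTrees (n + 1)).card := by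
  rw [card_planeTrees_succ, card_planeTrees_succ]
  have h1 := succ_mul_catalan_eq_centralBinom (n + 1)
  have h2 := succ_mul_catalan_eq_centralBinom n
  have h3 := Nat.succ_mul_centralBinom_succ n
  rw [← h1, ← h2] at h3
  have : (n + 1) * ((n + 2) * catalan (n + 1)) = (n + 1) * ((4 * n + 2) * catalan n) := by
    rw [show n + 2 = n + 1 + 1 from rfl, h3]; ring
  exact Nat.eq_of_mul_eq_mul_left n.succ_pos this

lemma card_planeTrees_pos {n : ℕ} (hn : 1 ≤ n) : 0 < (planeTrees n).card := by
  obtain ⟨m, rfl⟩ := Nat.exists_eq_add_of_le' hn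
  induction m with
  | zero => simp [planeTrees]
  | succ m ih =>
    have h1 := succ_mul_card_planeTrees m
    have h2 := ih (by omega)
    by_contra h
    rw [show (planeTrees (m + 2)).card = 0 from Nat.eq_zero_of_not_pos h] at h1
    have : 0 < (4 * m + 2) * (planeTrees (m + 1)).card := by positivity
    rw [mul_zero] at h1
    omega

lemma card_planeTrees_le (n : ℕ) : (planeTrees (n + 1)).card ≤ 4 ^ n := by
  induction n with
  | zero => simp [planeTrees]
  | succ n ih =>
    have h := succ_mul_card_planeTrees n
    have : (n + 2) * (planeTrees (n + 2)).card ≤ (n + 2) * (4 * (planeTrees (n + 1)).card) := by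
      rw [h]; nlinarith [(planeTrees (n + 1)).card.zero_le]
    have := Nat.le_of_mul_le_mul_left this (by omega)
    rw [pow_succ]
    change (planeTrees (n + 2)).card ≤ _
    omega

/-- The normalized coefficients of the square root singularity. -/
noncomputable def catW (n : ℕ) : ℝ := (planeTrees n).card / 4 ^ n

lemma catW_pos {n : ℕ} (hn : 1 ≤ n) : 0 < catW n := by
  have := card_planeTrees_pos hn
  unfold catW
  positivity

lemma sq_mul_catW_mono {m n : ℕ} (hm : 1 ≤ m) (h : m ≤ n) :
    (m : ℝ) ^ 2 * catW m ≤ n ^ 2 * catW n := by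
  induction n, h using Nat.le_induction with
  | base => exact le_rfl
  | succ n hmn ih =>
    refine ih.trans ?_
    obtain ⟨k, rfl⟩ := Nat.exists_eq_add_of_le' (hm.trans hmn)
    have h1 : ((k : ℝ) + 2) * (planeTrees (k + 2)).card = (4 * k + 2) * (planeTrees (k + 1)).card := by
      exact_mod_cast succ_mul_card_planeTrees k
    unfold catW
    have h0 : (0 : ℝ) ≤ (planeTrees (k + 1)).card := by positivity
    rw [show k + 1 + 1 = k + 2 from rfl, mul_div_assoc', mul_div_assoc', pow_succ (4 : ℝ) (k + 1),
      div_le_div_iff₀ (by positivity) (by positivity)]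
    have h2 : ((k : ℝ) + 1) ^ 2 * (planeTrees (k + 1)).card * 4 ≤
        (k + 2) ^ 2 * (planeTrees (k + 2)).card := by
      rw [sq ((k : ℝ) + 2), mul_assoc ((k : ℝ) + 2), h1]
      nlinarith [mul_nonneg h0 (Nat.cast_nonneg (α := ℝ) k)]
    push_cast
    calc _ = (((k : ℝ) + 1) ^ 2 * (planeTrees (k + 1)).card * 4) * 4 ^ (k + 1) := by ring
      _ ≤ ((k + 2) ^ 2 * (planeTrees (k + 2)).card) * 4 ^ (k + 1) := by gcongr
      _ = _ := by ring

/-- The power series `√(1 - X)`, written through the numbers of plane trees. -/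
noncomputable def sqrtSeries : PowerSeries ℂ :=
  PowerSeries.mk fun n => if n = 0 then 1 else -2 * (catW n : ℂ)

lemma sqrtSeries_eq : sqrtSeries = 1 - 2 * rescale (1 / 4 : ℂ) (gf fun _ => 1) := by
  ext n
  rw [sqrtSeries, coeff_mk, map_sub, coeff_one, show (2 : PowerSeries ℂ) = C (2 : ℂ) from (map_ofNat C 2).symm,
    coeff_C_mul, coeff_rescale, coeff_gf]
  split_ifs with h
  · subst h; simp [planeTrees]
  · simp [catW]; ring

lemma sqrtSeries_sq : sqrtSeries ^ 2 = 1 - X := by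
  have h := gf_eq (R := ℂ) (fun _ => 1) (fun _ _ => 0) rfl (by simp)
  have h2 := congrArg (rescale (1 / 4 : ℂ)) h
  simp only [sum_const_zero, map_add, map_pow] at h2
  rw [show (PowerSeries.mk fun _ : ℕ => (0 : ℂ)) = 0 by ext; simp, map_zero, add_zero, rescale_X] at h2
  rw [sqrtSeries_eq]
  set g := rescale (1 / 4 : ℂ) (gf fun _ => 1)
  have h3 : (1 - 2 * g) ^ 2 = 1 - 4 * (g - g ^ 2) := by ring
  rw [h3, sub_eq_of_eq_add h2]
  have : (4 : PowerSeries ℂ) * (C (1 / 4 : ℂ)) = 1 := by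
    rw [show (4 : PowerSeries ℂ) = C (4 : ℂ) from (map_ofNat C 4).symm, ← map_mul]; norm_num
  rw [← mul_assoc, this, one_mul]

lemma norm_coeff_sqrtSeries_le {j n : ℕ} (hj : j ≤ n) (hn : 1 ≤ n) :
    ‖coeff (n - j) sqrtSeries‖ ≤ 2 * (j + 1) ^ 2 * ‖coeff n sqrtSeries‖ := by
  have hn0 : n ≠ 0 := by omega
  have hw := catW_pos hn
  simp only [sqrtSeries, coeff_mk, hn0, if_false, norm_mul, norm_neg, Complex.norm_ofNat,
    Complex.norm_real, Real.norm_of_nonneg hw.le]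
  split_ifs with h
  · have : n = j := by omega
    subst this
    have h1 := sq_mul_catW_mono le_rfl hn
    have : catW 1 = 1 / 4 := by simp [catW, planeTrees]
    rw [this] at h1
    norm_num at h1 ⊢
    nlinarith [mul_nonneg (Nat.cast_nonneg (α := ℝ) n) hw.le]
  · have hw' := catW_pos (n := n - j) (by omega)
    rw [norm_mul, norm_neg, Complex.norm_ofNat, Complex.norm_real, Real.norm_of_nonneg hw'.le]
    have h1 := sq_mul_catW_mono (m := n - j) (n := n) (by omega) (by omega)
    set m := n - j with hm
    have h2 : (n : ℝ) ≤ m * (j + 1) := by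
      have : n ≤ m * (j + 1) := by
        have : n = m + j := by omega
        have : 1 ≤ m := by omega
        nlinarith
      exact_mod_cast this
    have hm0 : (0 : ℝ) < m := by exact_mod_cast Nat.pos_of_ne_zero h
    have h3 : (n : ℝ) ^ 2 ≤ m ^ 2 * (j + 1) ^ 2 := by
      rw [← mul_pow]; gcongr
    have h4 : (m : ℝ) ^ 2 * catW m ≤ m ^ 2 * ((j + 1) ^ 2 * catW n) := by
      rw [← mul_assoc]
      exact h1.trans (by gcongr)
    have h5 := le_of_mul_le_mul_left h4 (by positivity)
    have h6 : 0 ≤ ((j : ℝ) + 1) ^ 2 * catW n := by positivity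
    linarith

/-- A square root of a series close to `1` is close to `1` in a weighted `ℓ¹` norm. -/
lemma sum_norm_coeff_sqrt_le {E Q : PowerSeries ℂ} (hE : E ^ 2 = Q) (hE0 : coeff 0 E = 1) {η : ℝ}
    (hη : η ≤ 1)
    (hQ : ∀ N, ∑ j ∈ Finset.Icc 1 N, ‖coeff j Q‖ * ((j : ℝ) + 1) ^ 2 ≤ η) (N : ℕ) :
    ∑ j ∈ Finset.Icc 1 N, ‖coeff j E‖ * ((j : ℝ) + 1) ^ 2 ≤ η := by
  have hη0 : 0 ≤ η := by simpa using hQ 0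
  induction N with
  | zero => simpa using hη0
  | succ N ih =>
    set e : ℕ → ℝ := fun j => ‖coeff j E‖ * ((j : ℝ) + 1) ^ 2 with he
    have he0 : ∀ j, 0 ≤ e j := fun j => by positivity
    have key : ∀ n ∈ Finset.Icc 1 (N + 1), 2 * e n ≤ ‖coeff n Q‖ * ((n : ℝ) + 1) ^ 2 +
        ∑ p ∈ (antidiagonal n).filter (fun p => p.1 ≠ 0 ∧ p.2 ≠ 0), e p.1 * e p.2 := by
      intro n hn
      have hn1 : n ≠ 0 := by rw [Finset.mem_Icc] at hn; omega
      have h1 : coeff n Q = 2 * coeff n E +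
          ∑ p ∈ (antidiagonal n).filter (fun p => p.1 ≠ 0 ∧ p.2 ≠ 0),
            coeff p.1 E * coeff p.2 E := by
        rw [← hE, sq, coeff_mul, ← sum_filter_add_sum_filter_not (antidiagonal n)
          (fun p => p.1 ≠ 0 ∧ p.2 ≠ 0), add_comm]
        congr 1
        have : (antidiagonal n).filter (fun p => ¬ (p.1 ≠ 0 ∧ p.2 ≠ 0)) = {(0, n), (n, 0)} := by
          ext ⟨a, b⟩
          simp only [mem_filter, HasAntidiagonal.mem_antidiagonal, Finset.mem_insert, Finset.mem_singleton,
            Prod.mk.injEq]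
          omega
        rw [this, sum_pair (by simp [Ne.symm hn1]), hE0]
        ring
      have h2 : 2 * ‖coeff n E‖ ≤ ‖coeff n Q‖ +
          ∑ p ∈ (antidiagonal n).filter (fun p => p.1 ≠ 0 ∧ p.2 ≠ 0),
            ‖coeff p.1 E‖ * ‖coeff p.2 E‖ := by
        have : 2 * coeff n E = coeff n Q -
          ∑ p ∈ (antidiagonal n).filter (fun p => p.1 ≠ 0 ∧ p.2 ≠ 0),
            coeff p.1 E * coeff p.2 E := by rw [h1]; ring
        calc 2 * ‖coeff n E‖ = ‖2 * coeff n E‖ := by simp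
          _ ≤ _ := by
            rw [this]
            refine (norm_sub_le _ _).trans ?_
            gcongr
            exact (norm_sum_le _ _).trans (sum_le_sum fun p _ => (norm_mul _ _).le)
      calc 2 * e n = (2 * ‖coeff n E‖) * ((n : ℝ) + 1) ^ 2 := by simp only [he]; ring
        _ ≤ _ := mul_le_mul_of_nonneg_right h2 (by positivity)
        _ ≤ _ := by
          rw [add_mul, sum_mul]
          refine add_le_add le_rfl (sum_le_sum fun p hp => ?_)
          have hp1 : p.1 + p.2 = n := by simpa using (mem_filter.1 hp).1
          have : ((n : ℝ) + 1) ≤ ((p.1 : ℝ) + 1) * (p.2 + 1) := by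
            rw [← hp1]; push_cast; nlinarith [mul_nonneg (Nat.cast_nonneg (α := ℝ) p.1)
              (Nat.cast_nonneg (α := ℝ) p.2)]
          calc _ ≤ ‖coeff p.1 E‖ * ‖coeff p.2 E‖ * (((p.1 : ℝ) + 1) * (p.2 + 1)) ^ 2 := by gcongr
            _ = _ := by simp only [he]; ring
    have hconv : ∑ n ∈ Finset.Icc 1 (N + 1),
        ∑ p ∈ (antidiagonal n).filter (fun p => p.1 ≠ 0 ∧ p.2 ≠ 0), e p.1 * e p.2 ≤
        (∑ j ∈ Finset.Icc 1 N, e j) * ∑ j ∈ Finset.Icc 1 N, e j := by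
      rw [sum_mul_sum, ← sum_product', sum_sigma']
      rw [← sum_image (f := fun p : ℕ × ℕ => e p.1 * e p.2) (g := fun x : (_ : ℕ) × ℕ × ℕ => x.2)]
      · refine sum_le_sum_of_subset_of_nonneg ?_ fun _ _ _ => mul_nonneg (he0 _) (he0 _)
        intro p hp
        simp only [mem_image, mem_sigma, mem_filter, HasAntidiagonal.mem_antidiagonal,
          Finset.mem_Icc] at hp
        obtain ⟨x, hx, rfl⟩ := hp
        simp only [mem_product, Finset.mem_Icc]
        omega
      · rintro ⟨a, p⟩ hx ⟨b, q⟩ hy hxy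
        simp only [coe_sigma, Set.mem_sigma_iff, mem_coe, mem_filter,
          HasAntidiagonal.mem_antidiagonal] at hx hy hxy
        subst hxy
        obtain rfl : a = b := by omega
        rfl
    have := sum_le_sum key
    rw [← mul_sum, sum_add_distrib] at this
    have h3 := hQ (N + 1)
    have h4 : (∑ j ∈ Finset.Icc 1 N, e j) * ∑ j ∈ Finset.Icc 1 N, e j ≤ η * 1 :=
      mul_le_mul ih (ih.trans hη) (sum_nonneg fun j _ => he0 j) hη0
    linarith

end PTree

namespace PTree
open Finset PowerSeries

lemma norm_pow_sub_pow_le {x y : ℂ} {r : ℝ} (hx : ‖x‖ ≤ r) (hy : ‖y‖ ≤ r) (j : ℕ) :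
    ‖x ^ (j + 1) - y ^ (j + 1)‖ ≤ (j + 1) * r ^ j * ‖x - y‖ := by
  have hr : 0 ≤ r := (norm_nonneg x).trans hx
  induction j with
  | zero => simp
  | succ j ih =>
    have : x ^ (j + 1 + 1) - y ^ (j + 1 + 1) =
        x * (x ^ (j + 1) - y ^ (j + 1)) + (x - y) * y ^ (j + 1) := by ring
    rw [this]
    calc _ ≤ ‖x‖ * ‖x ^ (j + 1) - y ^ (j + 1)‖ + ‖x - y‖ * ‖y‖ ^ (j + 1) := by
          refine (norm_add_le _ _).trans (by rw [norm_mul, norm_mul, norm_pow])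
      _ ≤ r * ((j + 1) * r ^ j * ‖x - y‖) + ‖x - y‖ * r ^ (j + 1) := by gcongr
      _ = _ := by push_cast; ring

lemma hasSum_of_eq {f g : ℕ → ℝ} {a : ℝ} (h : HasSum f a) (hfg : ∀ j, g j = f j) : HasSum g a := by
  rwa [funext hfg]

lemma exists_root {φ : ℕ → ℂ} {ε : ℝ} (hε : ε ≤ 1 / 600) (hφ : ∀ j, ‖φ j‖ ≤ ε * 3 ^ j) :
    ∃ ρ : ℂ, ‖ρ - 1 / 4‖ ≤ 10 * ε ∧ HasSum (fun j => φ j * ρ ^ j) (1 / 4 - ρ) := by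
  have hε0 : 0 ≤ ε := by simpa using (norm_nonneg _).trans (hφ 0)
  have hg : HasSum (fun j : ℕ => ε * (9 / 10 : ℝ) ^ j) (10 * ε) := by
    have := (hasSum_geometric_of_lt_one (r := (9 / 10 : ℝ)) (by norm_num) (by norm_num)).mul_left ε
    norm_num at this ⊢
    rwa [mul_comm] at this
  have hterm : ∀ x : ℂ, ‖x‖ ≤ 3 / 10 → ∀ j, ‖φ j * x ^ j‖ ≤ ε * (9 / 10 : ℝ) ^ j := by
    intro x hx j
    rw [norm_mul, norm_pow]
    calc _ ≤ ε * 3 ^ j * (3 / 10) ^ j := by gcongr; exact hφ j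
      _ = _ := by rw [mul_assoc, ← mul_pow]; norm_num
  have hsum : ∀ x : ℂ, ‖x‖ ≤ 3 / 10 → Summable fun j => φ j * x ^ j := fun x hx =>
    Summable.of_norm_bounded hg.summable (hterm x hx)
  have hnorm : ∀ x : ℂ, ‖x‖ ≤ 3 / 10 → ‖∑' j, φ j * x ^ j‖ ≤ 10 * ε := fun x hx =>
    tsum_of_norm_bounded hg (hterm x hx)
  let s : Set ℂ := Metric.closedBall (1 / 4 : ℂ) (1 / 20)
  have hs : ∀ x ∈ s, ‖x‖ ≤ 3 / 10 := by
    intro x hx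
    rw [Metric.mem_closedBall, dist_eq_norm] at hx
    calc ‖x‖ = ‖(x - 1 / 4) + 1 / 4‖ := by ring_nf
      _ ≤ ‖x - 1 / 4‖ + ‖(1 / 4 : ℂ)‖ := norm_add_le _ _
      _ ≤ 1 / 20 + 1 / 4 := by gcongr; norm_num
      _ = _ := by norm_num
  let f : ℂ → ℂ := fun x => 1 / 4 - ∑' j, φ j * x ^ j
  have hmaps : Set.MapsTo f s s := by
    intro x hx
    rw [Metric.mem_closedBall, dist_eq_norm]
    simp only [f]
    rw [sub_sub_cancel_left, norm_neg]
    have := hnorm x (hs x hx)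
    linarith
  have hg2 : HasSum (fun j : ℕ => (3 * ε) * (((j : ℝ) + 1) * (9 / 10 : ℝ) ^ j)) (300 * ε) := by
    have h1 := (hasSum_coe_mul_geometric_of_norm_lt_one (r := (9 / 10 : ℝ)) (by norm_num))
    have h2 := (hasSum_geometric_of_lt_one (r := (9 / 10 : ℝ)) (by norm_num) (by norm_num))
    have := (h1.add h2).mul_left (3 * ε)
    rw [show 3 * ε * (9 / 10 / (1 - 9 / 10) ^ 2 + (1 - 9 / 10)⁻¹) = 300 * ε by norm_num; ring] at this
    exact hasSum_of_eq this fun j => by ring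
  have hlip : LipschitzOnWith (1 / 2) f s := by
    refine LipschitzOnWith.of_dist_le_mul fun x hx y hy => ?_
    rw [dist_eq_norm, dist_eq_norm]
    have h1 : f x - f y = -∑' j, (φ (j + 1) * (x ^ (j + 1) - y ^ (j + 1))) := by
      simp only [f]
      rw [sub_sub_sub_cancel_left, ← (hsum y (hs y hy)).tsum_sub (hsum x (hs x hx)),
        ((hsum y (hs y hy)).sub (hsum x (hs x hx))).tsum_eq_zero_add, ← tsum_neg]
      simp only [pow_zero, sub_self, zero_add]
      congr 1; ext j; ring
    rw [h1, norm_neg]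
    have h2 := tsum_of_norm_bounded (f := fun j => (φ (j + 1) * (x ^ (j + 1) - y ^ (j + 1))))
      (hg2.mul_right ‖x - y‖) (fun j => by
        rw [norm_mul]
        calc _ ≤ (ε * 3 ^ (j + 1)) * (((j : ℝ) + 1) * (3 / 10) ^ j * ‖x - y‖) := by
              gcongr
              · exact hφ _
              · exact norm_pow_sub_pow_le (hs x hx) (hs y hy) j
          _ = (3 * ε) * ((j + 1) * (3 * (3 / 10)) ^ j) * ‖x - y‖ := by rw [mul_pow]; ring
          _ = _ := by norm_num)
    refine h2.trans ?_
    gcongr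
    rw [NNReal.coe_div]
    norm_num
    linarith
  have hcontr : ContractingWith (1 / 2) (hmaps.restrict f s s) :=
    ⟨by rw [div_lt_one] <;> norm_num, fun x y => hlip x.2 y.2⟩
  obtain ⟨ρ, hρs, hρ, -⟩ := hcontr.exists_fixedPoint' (s := s) Metric.isClosed_closedBall.isComplete
    hmaps (x := 1 / 4) (by simp [s]) (edist_ne_top _ _)
  have h1 : ∑' j, φ j * ρ ^ j = 1 / 4 - ρ := by
    have : 1 / 4 - ∑' j, φ j * ρ ^ j = ρ := hρ
    linear_combination -this
  refine ⟨ρ, ?_, h1 ▸ (hsum ρ (hs ρ hρs)).hasSum⟩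
  have := hnorm ρ (hs ρ hρs)
  rwa [h1, norm_sub_rev] at this

/-- Transfer theorem for `G = X + G ^ 2 + Φ` with a small perturbation `Φ`. -/
lemma exists_coeff_bound : ∃ K : ℝ, 1 ≤ K ∧ ∀ (φ : ℕ → ℂ) (ε : ℝ) (ρ : ℂ) (G : PowerSeries ℂ),
    ε ≤ 1 / 600 → (∀ j, ‖φ j‖ ≤ ε * 3 ^ j) → φ 0 = 0 → ‖ρ - 1 / 4‖ ≤ 10 * ε →
    HasSum (fun j => φ j * ρ ^ j) (1 / 4 - ρ) → coeff 0 G = 0 →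
    G = X + G ^ 2 + PowerSeries.mk φ → K * ε ≤ 1 → ∀ n, 1 ≤ n →
    ‖coeff n G * (4 * ρ) ^ n / (planeTrees n).card - 1‖ ≤ K * ε := by
  have hS : Summable fun n : ℕ => (9 / 10 : ℝ) ^ n * ((n : ℝ) + 1) ^ 2 := by
    have h2 := summable_pow_mul_geometric_of_norm_lt_one (r := (9 / 10 : ℝ)) 2 (by norm_num)
    have h1 := summable_pow_mul_geometric_of_norm_lt_one (r := (9 / 10 : ℝ)) 1 (by norm_num)
    have h0 := summable_pow_mul_geometric_of_norm_lt_one (r := (9 / 10 : ℝ)) 0 (by norm_num)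
    refine ((h2.add (h1.mul_left 2)).add h0).congr fun n => ?_
    ring
  set S := ∑' n : ℕ, (9 / 10 : ℝ) ^ n * ((n : ℝ) + 1) ^ 2 with hSdef
  have hS1 : 1 ≤ S := by
    have := hS.le_tsum 0 (fun _ _ => by positivity)
    simpa using this
  refine ⟨2 * (36 * S), by linarith, ?_⟩
  intro φ ε ρ G hε hφ hφ0 hρ hroot hG0 hG hKε n hn
  have hε0 : 0 ≤ ε := by simpa using (norm_nonneg _).trans (hφ 0)
  have hρn : ‖ρ‖ ≤ 3 / 10 := by
    calc ‖ρ‖ = ‖(ρ - 1 / 4) + 1 / 4‖ := by ring_nf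
      _ ≤ ‖ρ - 1 / 4‖ + ‖(1 / 4 : ℂ)‖ := norm_add_le _ _
      _ ≤ 10 * ε + 1 / 4 := by gcongr; norm_num
      _ ≤ _ := by linarith
  set Y : PowerSeries ℂ := 1 - 2 * rescale ρ G with hY
  have c2 : (2 : PowerSeries ℂ) = C (2 : ℂ) := (map_ofNat C 2).symm
  have c4 : (4 : PowerSeries ℂ) = C (4 : ℂ) := (map_ofNat C 4).symm
  have hYsq : Y ^ 2 = 1 - 4 * rescale ρ (X + PowerSeries.mk φ) := by
    have : rescale ρ (X + PowerSeries.mk φ) = rescale ρ G - rescale ρ G ^ 2 := by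
      rw [← map_pow, ← map_sub]; congr 1
      linear_combination -hG
    rw [this, hY]; ring
  have hR0 : constantCoeff sqrtSeries ≠ 0 := by
    rw [← coeff_zero_eq_constantCoeff_apply, sqrtSeries, coeff_mk]; simp
  have hR : sqrtSeries * sqrtSeries⁻¹ = 1 := PowerSeries.mul_inv_cancel _ hR0
  set E := Y * sqrtSeries⁻¹ with hE
  have hYE : Y = E * sqrtSeries := by
    rw [hE, mul_assoc, mul_comm _ sqrtSeries, hR, mul_one]
  have hp : (1 - X) * E ^ 2 = 1 - 4 * rescale ρ (X + PowerSeries.mk φ) := by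
    rw [← hYsq, ← sqrtSeries_sq, hYE]; ring
  have hY0 : coeff 0 Y = 1 := by
    rw [hY, map_sub, c2, coeff_C_mul, coeff_rescale, hG0]; simp
  have hE0 : coeff 0 E = 1 := by
    have h := congrArg (coeff 0) hYE
    rw [hY0, coeff_zero_eq_constantCoeff_apply, map_mul] at h
    simp only [← coeff_zero_eq_constantCoeff_apply] at h
    have : coeff 0 sqrtSeries = 1 := by rw [sqrtSeries, coeff_mk]; simp
    rw [this, mul_one] at h
    exact h.symm
  have hQ0 : coeff 0 (E ^ 2) = 1 := by
    rw [coeff_zero_eq_constantCoeff_apply, map_pow, ← coeff_zero_eq_constantCoeff_apply, hE0, one_pow]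
  have hQ : ∀ m, coeff (m + 1) (E ^ 2) =
      4 * ((1 / 4 - ρ) - ∑ i ∈ Finset.range (m + 2), φ i * ρ ^ i) := by
    have hrec : ∀ m, coeff (m + 1) (E ^ 2) = coeff m (E ^ 2) -
        4 * (ρ ^ (m + 1) * ((if m = 0 then 1 else 0) + φ (m + 1))) := by
      intro m
      have h := congrArg (coeff (m + 1)) hp
      rw [sub_mul, one_mul, map_sub, coeff_succ_X_mul, map_sub, c4, coeff_C_mul, coeff_rescale,
        map_add, coeff_mk, coeff_X, coeff_one] at h
      simp only [Nat.add_eq_zero_iff, one_ne_zero, and_false, if_false, Nat.add_eq_right] at h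
      linear_combination h
    intro m
    induction m with
    | zero => rw [hrec, hQ0]; simp [Finset.sum_range_succ, hφ0]; ring
    | succ m ih =>
      rw [hrec, ih, Finset.sum_range_succ _ (m + 2)]; simp; ring
  have hQn : ∀ m, ‖coeff (m + 1) (E ^ 2)‖ ≤ 36 * ε * (9 / 10) ^ (m + 1) := by
    intro m
    have h1 := (hasSum_nat_add_iff' (m + 2)).2 hroot
    have hg : HasSum (fun j : ℕ => ε * (9 / 10 : ℝ) ^ (j + (m + 2)))
        (9 * ε * (9 / 10) ^ (m + 1)) := by
      have := (hasSum_geometric_of_lt_one (r := (9 / 10 : ℝ)) (by norm_num) (by norm_num)).mul_left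
        (ε * (9 / 10 : ℝ) ^ (m + 2))
      rw [show ε * (9 / 10) ^ (m + 2) * (1 - 9 / 10)⁻¹ = 9 * ε * (9 / 10) ^ (m + 1) by
        rw [pow_succ _ (m + 1)]; norm_num; ring] at this
      exact hasSum_of_eq this fun j => by rw [pow_add _ j]; ring
    have h2 : ‖(1 / 4 - ρ) - ∑ i ∈ Finset.range (m + 2), φ i * ρ ^ i‖ ≤
        9 * ε * (9 / 10) ^ (m + 1) := by
      rw [← h1.tsum_eq]
      refine tsum_of_norm_bounded hg fun j => ?_
      rw [norm_mul, norm_pow]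
      calc _ ≤ ε * 3 ^ (j + (m + 2)) * (3 / 10) ^ (j + (m + 2)) := by gcongr; exact hφ _
        _ = _ := by rw [mul_assoc, ← mul_pow]; norm_num
    rw [hQ, norm_mul, Complex.norm_ofNat]
    linarith
  set η := 36 * S * ε with hη
  have hQs : ∀ N, ∑ j ∈ Finset.Icc 1 N, ‖coeff j (E ^ 2)‖ * ((j : ℝ) + 1) ^ 2 ≤ η := by
    intro N
    calc _ ≤ ∑ j ∈ Finset.Icc 1 N, 36 * ε * ((9 / 10 : ℝ) ^ j * ((j : ℝ) + 1) ^ 2) := by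
          refine sum_le_sum fun j hj => ?_
          obtain ⟨m, rfl⟩ := Nat.exists_eq_add_of_le' (Finset.mem_Icc.1 hj).1
          rw [← mul_assoc]
          exact mul_le_mul_of_nonneg_right (hQn m) (by positivity)
      _ = 36 * ε * ∑ j ∈ Finset.Icc 1 N, ((9 / 10 : ℝ) ^ j * ((j : ℝ) + 1) ^ 2) := by
          rw [mul_sum]
      _ ≤ 36 * ε * S := by
          gcongr
          exact hS.sum_le_tsum _ fun _ _ => by positivity
      _ = η := by rw [hη]; ring
  have hEs := sum_norm_coeff_sqrt_le rfl hE0 (by linarith) hQs n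
  have hn0 : n ≠ 0 := by omega
  have hYn : coeff n Y = -2 * (ρ ^ n * coeff n G) := by
    rw [hY, map_sub, c2, coeff_C_mul, coeff_rescale, coeff_one, if_neg hn0]; ring
  have hRn : coeff n sqrtSeries = -2 * (catW n : ℂ) := by
    rw [sqrtSeries, coeff_mk, if_neg hn0]
  have hsub : coeff n Y - coeff n sqrtSeries =
      ∑ j ∈ Finset.Icc 1 n, coeff j E * coeff (n - j) sqrtSeries := by
    rw [hYE, coeff_mul, Finset.Nat.sum_antidiagonal_eq_sum_range_succ_mk,
      Finset.sum_range_succ', hE0]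
    rw [Nat.sub_zero, one_mul, add_sub_cancel_right]
    rw [← Finset.Ico_add_one_right_eq_Icc, Finset.sum_Ico_eq_sum_range]
    simp [add_comm]
  have hdiff : ‖coeff n Y - coeff n sqrtSeries‖ ≤ 2 * η * ‖coeff n sqrtSeries‖ := by
    rw [hsub]
    calc _ ≤ ∑ j ∈ Finset.Icc 1 n, (‖coeff j E‖ * ((j : ℝ) + 1) ^ 2) *
          (2 * ‖coeff n sqrtSeries‖) := by
          refine (norm_sum_le _ _).trans (sum_le_sum fun j hj => ?_)
          rw [norm_mul]
          have := norm_coeff_sqrtSeries_le (Finset.mem_Icc.1 hj).2 hn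
          calc _ ≤ ‖coeff j E‖ * (2 * (j + 1) ^ 2 * ‖coeff n sqrtSeries‖) := by gcongr
            _ = _ := by ring
      _ ≤ η * (2 * ‖coeff n sqrtSeries‖) := by
          rw [← sum_mul]; gcongr
      _ = _ := by ring
  have hcard : ((planeTrees n).card : ℂ) ≠ 0 := by
    exact_mod_cast (card_planeTrees_pos hn).ne'
  have hRn0 : coeff n sqrtSeries ≠ 0 := by
    rw [hRn]
    have := (catW_pos hn).ne'
    simpa using this
  have hfin : coeff n G * (4 * ρ) ^ n / (planeTrees n).card - 1 =
      (coeff n Y - coeff n sqrtSeries) / coeff n sqrtSeries := by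
    rw [sub_div, div_self hRn0, hYn, hRn, catW]
    push_cast
    field_simp
    rw [mul_pow]; ring
  rw [hfin, norm_div, div_le_iff₀ (norm_pos_iff.2 hRn0)]
  refine hdiff.trans (le_of_eq ?_)
  rw [hη]; ring

end PTree

namespace PTree
open Finset PowerSeries Filter Topology

lemma exists_norm_coeff_le : ∃ ε₀ : ℝ, 0 < ε₀ ∧ ∀ (φ : ℕ → ℂ) (ε : ℝ) (G : PowerSeries ℂ),
    ε ≤ ε₀ → (∀ j, ‖φ j‖ ≤ ε * 3 ^ j) → φ 0 = 0 → coeff 0 G = 0 →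
    G = X + G ^ 2 + PowerSeries.mk φ → ∀ n, 1 ≤ n →
    ‖coeff n G‖ ≤ 2 * (planeTrees n).card * Real.exp (80 * ε * n) := by
  obtain ⟨K, hK, h⟩ := exists_coeff_bound
  have hK0 : 0 < K := by linarith
  refine ⟨min (1 / 600) (1 / K), by positivity, ?_⟩
  intro φ ε G hε hφ hφ0 hG0 hG n hn
  have hε1 : ε ≤ 1 / 600 := hε.trans (min_le_left _ _)
  have hε2 : K * ε ≤ 1 := by
    have := hε.trans (min_le_right _ _)
    rwa [le_div_iff₀ hK0, mul_comm] at this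
  have hε0 : 0 ≤ ε := by simpa using (norm_nonneg _).trans (hφ 0)
  obtain ⟨ρ, hρ, hroot⟩ := exists_root hε1 hφ
  have h1 := h φ ε ρ G hε1 hφ hφ0 hρ hroot hG0 hG hε2 n hn
  have h2 : ‖coeff n G * (4 * ρ) ^ n / (planeTrees n).card‖ ≤ 2 := by
    calc _ = ‖(coeff n G * (4 * ρ) ^ n / (planeTrees n).card - 1) + 1‖ := by rw [sub_add_cancel]
      _ ≤ K * ε + 1 := (norm_add_le _ _).trans (by rw [norm_one]; gcongr)
      _ ≤ 2 := by linarith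
  have hc : (0 : ℝ) < (planeTrees n).card := by exact_mod_cast card_planeTrees_pos hn
  rw [norm_div, norm_mul, norm_pow, Complex.norm_natCast, div_le_iff₀ hc] at h2
  have h3 : Real.exp (-(80 * ε)) ≤ ‖4 * ρ‖ := by
    have h4 : 1 - 40 * ε ≤ ‖4 * ρ‖ := by
      have : ‖(1 : ℂ)‖ ≤ ‖4 * ρ‖ + ‖4 * (ρ - 1 / 4)‖ := by
        calc ‖(1 : ℂ)‖ = ‖4 * ρ - 4 * (ρ - 1 / 4)‖ := by ring_nf
          _ ≤ _ := norm_sub_le _ _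
      rw [norm_one, norm_mul 4 (ρ - 1 / 4), Complex.norm_ofNat] at this
      linarith
    have h5 : Real.exp (-(80 * ε)) * (1 + 80 * ε) ≤ 1 := by
      calc _ ≤ Real.exp (-(80 * ε)) * Real.exp (80 * ε) := by
            gcongr; linarith [Real.add_one_le_exp (80 * ε)]
        _ = 1 := by rw [← Real.exp_add]; simp
    have h6 : Real.exp (-(80 * ε)) ≤ 1 - 40 * ε := by
      rw [← le_div_iff₀ (by positivity)] at h5
      refine h5.trans ?_
      rw [div_le_iff₀ (by positivity)]
      nlinarith
    exact h6.trans h4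
  have h7 : ‖coeff n G‖ * Real.exp (-(80 * ε)) ^ n ≤ 2 * (planeTrees n).card :=
    (by gcongr : _ ≤ _).trans h2
  rw [← Real.exp_nat_mul] at h7
  calc ‖coeff n G‖ = ‖coeff n G‖ * Real.exp (n * -(80 * ε)) * Real.exp (80 * ε * n) := by
        rw [mul_assoc, ← Real.exp_add]
        rw [show (n : ℝ) * -(80 * ε) + 80 * ε * n = 0 by ring]; simp
    _ ≤ _ := by gcongr

lemma tendsto_coeff_div_card {φ : ℕ → ℕ → ℂ} {G : ℕ → PowerSeries ℂ} {c : ℝ} {a : ℂ}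
    (hφ : ∀ᶠ n : ℕ in atTop, ∀ j, ‖φ n j‖ ≤ c / n * 3 ^ j)
    (hφ0 : ∀ᶠ n in atTop, φ n 0 = 0) (hG0 : ∀ᶠ n in atTop, coeff 0 (G n) = 0)
    (hG : ∀ᶠ n in atTop, G n = X + G n ^ 2 + PowerSeries.mk (φ n))
    (hlim : ∀ j, Tendsto (fun n : ℕ => (n : ℂ) * φ n j) atTop (𝓝 (if j = 2 then a else 0))) :
    Tendsto (fun n => coeff n (G n) / ((planeTrees n).card : ℂ)) atTop (𝓝 (Complex.exp (a / 4))) := by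
  obtain ⟨K, hK, h⟩ := exists_coeff_bound
  have hc0 : Tendsto (fun n : ℕ => c / (n : ℝ)) atTop (𝓝 0) := tendsto_const_div_atTop_nhds_zero_nat c
  have hev : ∀ᶠ n : ℕ in atTop, ∃ ρ : ℂ, ‖ρ - 1 / 4‖ ≤ 10 * (c / n) ∧
      HasSum (fun j => φ n j * ρ ^ j) (1 / 4 - ρ) ∧
      ‖coeff n (G n) * (4 * ρ) ^ n / (planeTrees n).card - 1‖ ≤ K * (c / n) := by
    have hs1 : ∀ᶠ n : ℕ in atTop, c / (n : ℝ) ≤ 1 / 600 :=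
      hc0.eventually (Iic_mem_nhds (by norm_num))
    have hs2 : ∀ᶠ n : ℕ in atTop, K * (c / (n : ℝ)) ≤ 1 := by
      have := hc0.const_mul K
      rw [mul_zero] at this
      exact this.eventually (Iic_mem_nhds (by norm_num))
    filter_upwards [hφ, hφ0, hG0, hG, hs1, hs2, eventually_ge_atTop 1] with n h1 h2 h3 h4 h5 h6 h7
    obtain ⟨ρ, hρ, hroot⟩ := exists_root h5 h1
    exact ⟨ρ, hρ, hroot, h _ _ ρ _ h5 h1 h2 hρ hroot h3 h4 h6 n h7⟩
  let ρ : ℕ → ℂ := fun n => if h : ∃ ρ : ℂ, ‖ρ - 1 / 4‖ ≤ 10 * (c / n) ∧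
      HasSum (fun j => φ n j * ρ ^ j) (1 / 4 - ρ) ∧
      ‖coeff n (G n) * (4 * ρ) ^ n / (planeTrees n).card - 1‖ ≤ K * (c / n) then h.choose else 0
  have hρ : ∀ᶠ n : ℕ in atTop, ‖ρ n - 1 / 4‖ ≤ 10 * (c / n) ∧
      HasSum (fun j => φ n j * ρ n ^ j) (1 / 4 - ρ n) ∧
      ‖coeff n (G n) * (4 * ρ n) ^ n / (planeTrees n).card - 1‖ ≤ K * (c / n) := by
    filter_upwards [hev] with n hn
    simp only [ρ, dif_pos hn]
    exact hn.choose_spec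
  have hρlim : Tendsto ρ atTop (𝓝 (1 / 4)) := by
    rw [tendsto_iff_norm_sub_tendsto_zero]
    refine squeeze_zero' (.of_forall fun _ => norm_nonneg _) (hρ.mono fun n hn => hn.1) ?_
    simpa using hc0.const_mul 10
  have hρ3 : ∀ᶠ n in atTop, ‖ρ n‖ ≤ 3 / 10 := by
    have := hρlim.norm
    refine this.eventually (Iic_mem_nhds ?_)
    norm_num
  have htan : Tendsto (fun n : ℕ => ∑' j, (n : ℂ) * φ n j * ρ n ^ j) atTop
      (𝓝 (∑' j, (if j = 2 then a else 0) * (1 / 4) ^ j)) := by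
    refine tendsto_tsum_of_dominated_convergence (bound := fun j => |c| * (9 / 10) ^ j) ?_ ?_ ?_
    · exact (summable_geometric_of_lt_one (by norm_num) (by norm_num)).mul_left _
    · intro j
      exact (hlim j).mul (hρlim.pow j)
    · filter_upwards [hφ, hρ3, eventually_ge_atTop 1] with n h1 h2 h3 j
      have hn : (0 : ℝ) < n := by exact_mod_cast h3
      rw [norm_mul, norm_mul, norm_pow, Complex.norm_natCast]
      calc _ ≤ n * (c / n * 3 ^ j) * (3 / 10) ^ j := by
            gcongr
            · exact mul_nonneg hn.le ((norm_nonneg _).trans (h1 j))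
            · exact h1 j
        _ = c * (3 * (3 / 10)) ^ j := by rw [mul_pow]; field_simp
        _ = c * (9 / 10) ^ j := by norm_num
        _ ≤ _ := by gcongr; exact le_abs_self c
  have hts : ∑' j, (if j = 2 then a else 0) * (1 / 4 : ℂ) ^ j = a / 16 := by
    rw [tsum_eq_single 2]
    · simp; ring
    · intro b hb; simp [hb]
  rw [hts] at htan
  have hpow : Tendsto (fun n : ℕ => (4 * ρ n) ^ n) atTop (𝓝 (Complex.exp (-(a / 4)))) := by
    have h1 : Tendsto (fun n : ℕ => (n : ℂ) * (4 * ρ n - 1)) atTop (𝓝 (-(a / 4))) := by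
      have := (htan.const_mul (-4))
      rw [show -4 * (a / 16) = -(a / 4) by ring] at this
      refine this.congr' ?_
      filter_upwards [hρ] with n hn
      have h2 := (hn.2.1.mul_left (n : ℂ)).tsum_eq
      simp only [← mul_assoc] at h2
      rw [h2]; ring
    have := Complex.tendsto_one_add_pow_exp_of_tendsto h1
    refine this.congr fun n => ?_
    ring_nf
  have hone : Tendsto (fun n => coeff n (G n) * (4 * ρ n) ^ n / (planeTrees n).card) atTop (𝓝 1) := by
    rw [tendsto_iff_norm_sub_tendsto_zero]
    refine squeeze_zero' (.of_forall fun _ => norm_nonneg _) (hρ.mono fun n hn => hn.2.2) ?_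
    simpa using hc0.const_mul K
  have := hone.div hpow (Complex.exp_ne_zero _)
  rw [one_div, ← Complex.exp_neg, neg_neg] at this
  refine this.congr' ?_
  filter_upwards [hρlim.eventually_ne (show (1 / 4 : ℂ) ≠ 0 by norm_num)] with n hn
  have : (4 * ρ n) ^ n ≠ 0 := pow_ne_zero _ (mul_ne_zero (by norm_num) hn)
  simp only [Pi.div_apply]
  field_simp

end PTree

namespace PTree
open Finset PowerSeries Filter Topology

/-- Coefficients of the perturbation produced by the symmetric internal vertices. -/
noncomputable def symCoeff (c : PTree → ℂ) (n : ℕ) : ℂ :=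
  if Even n then ∑ l ∈ planeTrees (n / 2), c l * (2 ^ (n / 2 - 1) / 2 ^ gens l) else 0

lemma gf_eq_symCoeff (f c : PTree → ℂ) (h1 : f leaf = 1)
    (h : ∀ l r, f (node l r) = f l * f r + if normalize l = normalize r then c l else 0) :
    gf f = X + gf f ^ 2 + PowerSeries.mk (symCoeff c) := by
  refine (gf_eq f _ h1 h).trans ?_
  congr 1
  congr 1
  funext n
  have hcount : ∀ (l : PTree) (m : ℕ),
      (((planeTrees m).filter fun r => normalize l = normalize r).card : ℂ) =
        if m = size l then 2 ^ (size l - 1) / 2 ^ gens l else 0 := by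
    intro l m
    have h := card_filter_normalize_mul l m
    have h2 : (2 : ℂ) ^ gens l ≠ 0 := pow_ne_zero _ two_ne_zero
    split_ifs at h ⊢ with hm
    · rw [eq_div_iff h2]; exact_mod_cast h
    · have : 0 < 2 ^ gens l := by positivity
      rw [Nat.mul_eq_zero] at h
      rcases h with h | h
      · exact_mod_cast h
      · omega
  have hinner : ∀ p ∈ antidiagonal n, (∑ l ∈ planeTrees p.1, ∑ r ∈ planeTrees p.2,
      if normalize l = normalize r then c l else 0) =
      if p.2 = p.1 then ∑ l ∈ planeTrees p.1, c l * (2 ^ (p.1 - 1) / 2 ^ gens l) else 0 := by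
    intro p _
    split_ifs with hp
    · refine sum_congr rfl fun l hl => ?_
      rw [← sum_filter, sum_const, nsmul_eq_mul, hcount, mem_planeTrees.1 hl, if_pos hp, mul_comm]
    · refine sum_eq_zero fun l hl => ?_
      rw [← sum_filter, sum_const, nsmul_eq_mul, hcount, mem_planeTrees.1 hl, if_neg hp, zero_mul]
  rw [sum_congr rfl hinner, symCoeff]
  split_ifs with hn
  · obtain ⟨m, rfl⟩ := hn
    rw [sum_eq_single (m, m)]
    · simp [show (m + m) / 2 = m by omega]
    · rintro ⟨a, b⟩ hp hne
      rw [HasAntidiagonal.mem_antidiagonal] at hp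
      rw [if_neg]
      intro hba
      simp only at hp hba
      exact hne (by rw [show a = m by omega, show b = m by omega])
    · simp
  · refine sum_eq_zero fun p hp => ?_
    rw [HasAntidiagonal.mem_antidiagonal] at hp
    rw [if_neg]
    intro he
    exact hn ⟨p.1, by omega⟩

lemma symCoeff_two_mul (c : PTree → ℂ) (m : ℕ) : symCoeff c (2 * m) =
    ∑ l ∈ planeTrees m, c l * (2 ^ (m - 1) / 2 ^ gens l) := by
  rw [symCoeff, if_pos (even_two_mul m), Nat.mul_div_cancel_left _ two_pos]

lemma symCoeff_zero (c : PTree → ℂ) : symCoeff c 0 = 0 := by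
  simp [symCoeff, planeTrees]

lemma card_planeTrees_le_pow (m : ℕ) : (planeTrees m).card ≤ 4 ^ (m - 1) := by
  rcases m with _ | m
  · simp [planeTrees]
  · exact card_planeTrees_le m

/-- `genCoeff u m = 2 ^ (m-1) ∑_{|l| = m} (u² / 2) ^ gens l`. -/
noncomputable def genCoeff (u : ℂ) (m : ℕ) : ℂ :=
  ∑ l ∈ planeTrees m, u ^ (2 * gens l) * (2 ^ (m - 1) / 2 ^ gens l)

lemma norm_genCoeff_term_le (m g : ℕ) : ‖(2 ^ (m - 1) / 2 ^ g : ℂ)‖ ≤ 2 ^ (m - 1) := by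
  rw [norm_div, norm_pow, norm_pow, Complex.norm_ofNat]
  exact div_le_self (by positivity) (one_le_pow₀ (by norm_num))

lemma card_mul_le (m : ℕ) : ((planeTrees m).card : ℝ) * 2 ^ (m - 1) ≤ 8 ^ m := by
  have h : ((planeTrees m).card : ℝ) ≤ 4 ^ (m - 1) := by exact_mod_cast card_planeTrees_le_pow m
  calc _ ≤ (4 : ℝ) ^ (m - 1) * 2 ^ (m - 1) := by gcongr
    _ = 8 ^ (m - 1) := by rw [← mul_pow]; norm_num
    _ ≤ 8 ^ m := pow_le_pow_right₀ (by norm_num) (by omega)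

lemma norm_genCoeff_le {u : ℂ} (hu : ‖u‖ ≤ 1) (m : ℕ) : ‖genCoeff u m‖ ≤ 8 ^ m := by
  calc _ ≤ ∑ l ∈ planeTrees m, (2 : ℝ) ^ (m - 1) := by
        refine (norm_sum_le _ _).trans (sum_le_sum fun l _ => ?_)
        rw [norm_mul, norm_pow]
        calc _ ≤ 1 * (2 : ℝ) ^ (m - 1) := by
              gcongr
              · exact pow_le_one₀ (norm_nonneg _) hu
              · exact norm_genCoeff_term_le _ _
          _ = _ := one_mul _
    _ ≤ _ := by
      rw [sum_const, nsmul_eq_mul]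
      exact card_mul_le m

lemma norm_genCoeff_sub_le {u : ℂ} (hu : ‖u‖ ≤ 1) (m : ℕ) :
    ‖genCoeff u m - genCoeff 1 m‖ ≤ 8 ^ m * (2 * m) * ‖u - 1‖ := by
  calc _ ≤ ∑ l ∈ planeTrees m, (2 : ℝ) ^ (m - 1) * ((2 * m) * ‖u - 1‖) := by
        rw [genCoeff, genCoeff, ← sum_sub_distrib]
        refine (norm_sum_le _ _).trans (sum_le_sum fun l hl => ?_)
        rw [← sub_mul, norm_mul, mul_comm]
        gcongr
        · exact norm_genCoeff_term_le _ _
        · have hg : gens l ≤ m := by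
            have := gens_lt_size l
            rw [mem_planeTrees.1 hl] at this
            omega
          rcases Nat.eq_zero_or_pos (gens l) with h0 | h0
          · rw [h0]; simp; positivity
          · obtain ⟨j, hj⟩ := Nat.exists_eq_add_of_le' (show 1 ≤ 2 * gens l by omega)
            rw [hj]
            refine (norm_pow_sub_pow_le hu (by simp) j).trans ?_
            rw [one_pow, mul_one]
            gcongr
            have : j + 1 ≤ 2 * m := by omega
            exact_mod_cast this
    _ = ((planeTrees m).card : ℝ) * 2 ^ (m - 1) * (2 * m) * ‖u - 1‖ := by
      rw [sum_const, nsmul_eq_mul]; ring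
    _ ≤ _ := by gcongr; exact card_mul_le m

lemma gf_gens_eq (u : ℂ) : gf (fun T => u ^ gens T) = X + gf (fun T => u ^ gens T) ^ 2 +
    PowerSeries.mk fun j => (u - 1) * if Even j then genCoeff u (j / 2) else 0 := by
  refine (gf_eq_symCoeff (fun T => u ^ gens T) (fun l => (u - 1) * u ^ (2 * gens l))
    (by simp [gens]) ?_).trans ?_
  rotate_left
  · congr 1
    congr 1
    funext j
    rw [symCoeff]
    split_ifs
    · rw [genCoeff, mul_sum]
      exact sum_congr rfl fun l _ => by ring
    · simp
  · intro l r
    simp only [gens]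
    split_ifs with h
    · rw [gens_eq_of_normalize_eq h]; ring
    · ring

end PTree

namespace PTree
open Finset PowerSeries Filter Topology

/-- Value of `genCoeff` at `1`. -/
noncomputable def genVal (m : ℕ) : ℝ := ∑ l ∈ planeTrees m, 2 ^ (m - 1) / 2 ^ gens l

/-- Derivative of `genCoeff` at `1`. -/
noncomputable def genDer (m : ℕ) : ℝ := ∑ l ∈ planeTrees m, (2 * (gens l : ℝ)) * (2 ^ (m - 1) / 2 ^ gens l)

lemma genCoeff_one (m : ℕ) : genCoeff 1 m = genVal m := by
  simp [genCoeff, genVal]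

lemma genVal_nonneg (m : ℕ) : 0 ≤ genVal m := sum_nonneg fun _ _ => by positivity

lemma genDer_nonneg (m : ℕ) : 0 ≤ genDer m := sum_nonneg fun _ _ => by positivity

lemma genVal_le (m : ℕ) : genVal m ≤ 8 ^ m := by
  have := norm_genCoeff_le (u := 1) (by simp) m
  rwa [genCoeff_one, Complex.norm_real, Real.norm_of_nonneg (genVal_nonneg m)] at this

lemma genDer_le (m : ℕ) : genDer m ≤ 2 * m * 8 ^ m := by
  calc genDer m ≤ ∑ l ∈ planeTrees m, (2 * (m : ℝ)) * 2 ^ (m - 1) := by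
        refine sum_le_sum fun l hl => ?_
        have : gens l ≤ m := by
          have := gens_lt_size l
          rw [mem_planeTrees.1 hl] at this
          omega
        gcongr
        exact div_le_self (by positivity) (one_le_pow₀ (by norm_num))
    _ = 2 * m * ((planeTrees m).card * 2 ^ (m - 1)) := by
        rw [sum_const, nsmul_eq_mul]; ring
    _ ≤ _ := by gcongr; exact card_mul_le m

lemma norm_exp_I (τ : ℝ) : ‖Complex.exp (Complex.I * τ)‖ = 1 := by
  rw [mul_comm, Complex.norm_exp_ofReal_mul_I]

lemma norm_exp_I_sub_one_le (τ : ℝ) : ‖Complex.exp (Complex.I * τ) - 1‖ ≤ |τ| :=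
  Real.norm_exp_I_mul_ofReal_sub_one_le

lemma hasDerivAt_exp_I : HasDerivAt (fun τ : ℝ => Complex.exp (Complex.I * τ)) Complex.I 0 := by
  have h : HasDerivAt (fun τ : ℝ => Complex.I * (τ : ℂ)) (Complex.I * 1) 0 :=
    (Complex.ofRealCLM.hasDerivAt (x := (0 : ℝ))).const_mul Complex.I
  simpa using h.cexp

lemma hasDerivAt_genCoeff (m : ℕ) :
    HasDerivAt (fun τ : ℝ => genCoeff (Complex.exp (Complex.I * τ)) m) (Complex.I * genDer m) 0 := by
  unfold genCoeff genDer
  have : HasDerivAt (fun τ : ℝ => ∑ l ∈ planeTrees m,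
      Complex.exp (Complex.I * τ) ^ (2 * gens l) * (2 ^ (m - 1) / 2 ^ gens l : ℂ))
      (∑ l ∈ planeTrees m, (((2 * gens l : ℕ) : ℂ) * Complex.exp (Complex.I * (0 : ℝ)) ^ (2 * gens l - 1)
        * Complex.I) * (2 ^ (m - 1) / 2 ^ gens l : ℂ)) 0 :=
    HasDerivAt.fun_sum fun l _ => (hasDerivAt_exp_I.pow _).mul_const _
  convert this using 1
  push_cast
  rw [mul_sum]
  refine sum_congr rfl fun l _ => ?_
  simp
  ring

lemma summable_aux (a : ℕ) : Summable fun m : ℕ => (m : ℝ) ^ a * (18 / 25 : ℝ) ^ m :=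
  summable_pow_mul_geometric_of_norm_lt_one a (by norm_num)

/-- A branch of the perturbed singularity. -/
lemma exists_rho : ∃ ρ : ℝ → ℂ, ρ 0 = 1 / 4 ∧ ∀ τ : ℝ, |τ| ≤ 1 / 600 → ‖ρ τ - 1 / 4‖ ≤ 10 * |τ| ∧
    HasSum (fun j => ((Complex.exp (Complex.I * τ) - 1) *
      if Even j then genCoeff (Complex.exp (Complex.I * τ)) (j / 2) else 0) * ρ τ ^ j)
      (1 / 4 - ρ τ) := by
  have h : ∀ τ : ℝ, ∃ ρ : ℂ, |τ| ≤ 1 / 600 → ‖ρ - 1 / 4‖ ≤ 10 * |τ| ∧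
    HasSum (fun j => ((Complex.exp (Complex.I * τ) - 1) *
      if Even j then genCoeff (Complex.exp (Complex.I * τ)) (j / 2) else 0) * ρ ^ j)
      (1 / 4 - ρ) := by
    intro τ
    by_cases hτ : |τ| ≤ 1 / 600
    · obtain ⟨ρ, h⟩ := exists_root (φ := fun j => (Complex.exp (Complex.I * τ) - 1) *
        if Even j then genCoeff (Complex.exp (Complex.I * τ)) (j / 2) else 0) hτ (by
          intro j
          rw [norm_mul]
          gcongr
          · exact norm_exp_I_sub_one_le τ
          · split_ifs with hj
            · refine (norm_genCoeff_le (norm_exp_I τ).le _).trans ?_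
              obtain ⟨i, rfl⟩ := hj
              rw [show (i + i) / 2 = i by omega, ← two_mul, pow_mul]
              gcongr; norm_num
            · simp)
      exact ⟨ρ, fun _ => h⟩
    · exact ⟨0, fun h => absurd h hτ⟩
  choose ρ hρ using h
  refine ⟨ρ, ?_, hρ⟩
  have := (hρ 0 (by norm_num)).1
  rw [abs_zero, mul_zero] at this
  exact sub_eq_zero.1 (norm_le_zero_iff.1 this)

lemma norm_le_of_near {ρ : ℂ} {τ : ℝ} (hτ : |τ| ≤ 1 / 600) (h : ‖ρ - 1 / 4‖ ≤ 10 * |τ|) :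
    ‖ρ‖ ≤ 3 / 10 := by
  calc ‖ρ‖ = ‖(ρ - 1 / 4) + 1 / 4‖ := by ring_nf
    _ ≤ ‖ρ - 1 / 4‖ + ‖(1 / 4 : ℂ)‖ := norm_add_le _ _
    _ ≤ 10 * |τ| + 1 / 4 := by gcongr; norm_num
    _ ≤ _ := by linarith

lemma rho_eq {ρ : ℂ} {τ : ℝ} (hτ : |τ| ≤ 1 / 600) (h : ‖ρ - 1 / 4‖ ≤ 10 * |τ|)
    (hs : HasSum (fun j => ((Complex.exp (Complex.I * τ) - 1) *
      if Even j then genCoeff (Complex.exp (Complex.I * τ)) (j / 2) else 0) * ρ ^ j)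
      (1 / 4 - ρ)) :
    Summable (fun m => genCoeff (Complex.exp (Complex.I * τ)) m * ρ ^ (2 * m)) ∧
    ρ = 1 / 4 - (Complex.exp (Complex.I * τ) - 1) *
      ∑' m, genCoeff (Complex.exp (Complex.I * τ)) m * ρ ^ (2 * m) := by
  have hsum : Summable (fun m => genCoeff (Complex.exp (Complex.I * τ)) m * ρ ^ (2 * m)) := by
    refine Summable.of_norm_bounded (summable_aux 0) fun m => ?_
    rw [norm_mul, norm_pow, pow_mul]
    have := norm_le_of_near hτ h
    calc _ ≤ (8 : ℝ) ^ m * ((3 / 10) ^ 2) ^ m := by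
          gcongr; exact norm_genCoeff_le (norm_exp_I τ).le _
      _ = _ := by rw [← mul_pow]; norm_num
  refine ⟨hsum, ?_⟩
  have h2 : HasSum (fun m => (Complex.exp (Complex.I * τ) - 1) *
      (genCoeff (Complex.exp (Complex.I * τ)) m * ρ ^ (2 * m))) (1 / 4 - ρ) := by
    have hinj : Function.Injective fun m : ℕ => 2 * m := fun a b hab => by simpa using hab
    rw [← hinj.hasSum_iff] at hs
    · have e : (fun m => (Complex.exp (Complex.I * τ) - 1) *
          (genCoeff (Complex.exp (Complex.I * τ)) m * ρ ^ (2 * m))) =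
          (fun j => ((Complex.exp (Complex.I * τ) - 1) *
            if Even j then genCoeff (Complex.exp (Complex.I * τ)) (j / 2) else 0) * ρ ^ j) ∘
            fun m : ℕ => 2 * m := by
        funext m
        simp [mul_assoc]
      rwa [e]
    · intro j hj
      rw [if_neg]
      · simp
      · rintro ⟨i, rfl⟩
        exact hj ⟨i, by simp only; omega⟩
  have := (hsum.hasSum.mul_left (Complex.exp (Complex.I * τ) - 1)).unique h2
  rw [this]; ring

end PTree

namespace PTree
open Finset PowerSeries Filter Topology

lemma tendsto_exp_second_order (a : ℝ) : Tendsto (fun τ : ℝ =>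
    (Complex.exp (Complex.I * (a * τ)) - 1 - Complex.I * (a * τ)) / (τ : ℂ) ^ 2) (𝓝[≠] 0)
    (𝓝 (-(a : ℂ) ^ 2 / 2)) := by
  have h := Complex.exp_sub_sum_range_succ_isLittleO_pow 2
  have hlim : Tendsto (fun τ : ℝ => Complex.I * (a * (τ : ℂ))) (𝓝[≠] 0) (𝓝 0) := by
    have : Continuous fun τ : ℝ => Complex.I * (a * (τ : ℂ)) := by fun_prop
    have h2 := this.tendsto 0
    simp only [Complex.ofReal_zero, mul_zero] at h2
    exact h2.mono_left nhdsWithin_le_nhds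
  have h1 := h.comp_tendsto hlim
  have h2 : (fun τ : ℝ => Complex.exp (Complex.I * (a * τ)) - 1 - Complex.I * (a * τ) +
      a ^ 2 * (τ : ℂ) ^ 2 / 2) =o[𝓝[≠] 0] fun τ : ℝ => (τ : ℂ) ^ 2 := by
    have h3 : (fun τ : ℝ => (Complex.I * (a * (τ : ℂ))) ^ 2) =O[𝓝[≠] 0] fun τ : ℝ => (τ : ℂ) ^ 2 := by
      have : (fun τ : ℝ => (Complex.I * (a * (τ : ℂ))) ^ 2) =
          fun τ : ℝ => (-(a : ℂ) ^ 2) * (τ : ℂ) ^ 2 := by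
        funext τ; rw [mul_pow, Complex.I_sq]; ring
      rw [this]
      exact (Asymptotics.isBigO_refl _ _).const_mul_left _
    refine (h1.trans_isBigO h3).congr_left fun τ => ?_
    simp [Finset.sum_range_succ, mul_pow]
    ring
  have h4 := h2.tendsto_div_nhds_zero.sub_const ((a : ℂ) ^ 2 / 2)
  rw [zero_sub, ← neg_div] at h4
  refine h4.congr' ?_
  filter_upwards [self_mem_nhdsWithin] with τ hτ
  have : (τ : ℂ) ≠ 0 := by simpa using hτ
  field_simp
  ring

lemma tendsto_exp_first_order (a : ℝ) : Tendsto (fun τ : ℝ =>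
    (Complex.exp (Complex.I * (a * τ)) - 1) / (τ : ℂ)) (𝓝[≠] 0) (𝓝 (Complex.I * a)) := by
  have h := tendsto_exp_second_order a
  have hτ : Tendsto (fun τ : ℝ => (τ : ℂ)) (𝓝[≠] 0) (𝓝 0) := by
    have := Complex.continuous_ofReal.tendsto 0
    rw [Complex.ofReal_zero] at this
    exact this.mono_left nhdsWithin_le_nhds
  have h2 := (h.mul hτ).add_const (Complex.I * a)
  rw [mul_zero, zero_add] at h2
  refine h2.congr' ?_
  filter_upwards [self_mem_nhdsWithin] with τ hτ
  have : (τ : ℂ) ≠ 0 := by simpa using hτ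
  field_simp
  ring

/-- `∑ genVal m / 16 ^ m`. -/
noncomputable def genSum : ℝ := ∑' m, genVal m * (1 / 16) ^ m

/-- `∑ genDer m / 16 ^ m`. -/
noncomputable def genDerSum : ℝ := ∑' m, genDer m * (1 / 16) ^ m

/-- `∑ 8 m * genVal m / 16 ^ m`. -/
noncomputable def genMeanSum : ℝ := ∑' m : ℕ, 8 * m * (genVal m * (1 / 16) ^ m)

lemma summable_half (a : ℕ) : Summable fun m : ℕ => (m : ℝ) ^ a * (1 / 2 : ℝ) ^ m :=
  summable_pow_mul_geometric_of_norm_lt_one a (by norm_num)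

lemma genVal_mul_le (m : ℕ) : genVal m * (1 / 16) ^ m ≤ (1 / 2) ^ m := by
  calc _ ≤ (8 : ℝ) ^ m * (1 / 16) ^ m := by gcongr; exact genVal_le m
    _ = _ := by rw [← mul_pow]; norm_num

lemma summable_genSum : Summable fun m => genVal m * (1 / 16) ^ m :=
  Summable.of_nonneg_of_le (fun m => mul_nonneg (genVal_nonneg m) (by positivity)) genVal_mul_le
    (by simpa only [pow_zero, one_mul] using summable_half 0)

lemma summable_genMeanSum : Summable fun m : ℕ => 8 * m * (genVal m * (1 / 16) ^ m) := by
  refine Summable.of_nonneg_of_le (fun m => mul_nonneg (by positivity)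
    (mul_nonneg (genVal_nonneg m) (by positivity))) (fun m => ?_)
    ((summable_half 1).mul_left 8)
  calc _ ≤ 8 * (m : ℝ) * (1 / 2) ^ m := by gcongr; exact genVal_mul_le m
    _ = _ := by ring

lemma summable_genDerSum : Summable fun m : ℕ => genDer m * (1 / 16) ^ m := by
  refine Summable.of_nonneg_of_le (fun m => mul_nonneg (genDer_nonneg m) (by positivity))
    (fun m => ?_) ((summable_half 1).mul_left 2)
  calc _ ≤ (2 * m * 8 ^ m : ℝ) * (1 / 16) ^ m := by gcongr; exact genDer_le m
    _ = 2 * (m * (8 * (1 / 16)) ^ m) := by rw [mul_pow]; ring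
    _ = _ := by norm_num

lemma genVal_one : genVal 1 = 1 := by simp [genVal, planeTrees, gens]

lemma planeTrees_two : planeTrees 2 = {node leaf leaf} := by
  ext T
  rw [mem_planeTrees, Finset.mem_singleton]
  constructor
  · intro h
    cases T with
    | leaf => simp [size] at h
    | node l r =>
      rw [size] at h
      have := size_pos l
      have := size_pos r
      rw [size_eq_one_iff.1 (show size l = 1 by omega), size_eq_one_iff.1 (show size r = 1 by omega)]
  · rintro rfl; rfl

lemma genVal_two : genVal 2 = 1 := by
  rw [genVal, planeTrees_two]
  simp [gens]

lemma genVal_zero : genVal 0 = 0 := by simp [genVal, planeTrees]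

lemma genDer_two : genDer 2 = 2 := by
  rw [genDer, planeTrees_two]
  simp [gens]

lemma gens_pos_of_size : ∀ T : PTree, 2 ≤ size T → 1 ≤ gens T
  | leaf, h => by simp [size] at h
  | node leaf leaf, _ => by simp [gens]
  | node (node a b) r, _ => by
    have := gens_pos_of_size (node a b) (by
      rw [size]; have := size_pos a; have := size_pos b; omega)
    rw [gens]; omega
  | node leaf (node a b), _ => by
    have := gens_pos_of_size (node a b) (by
      rw [size]; have := size_pos a; have := size_pos b; omega)
    rw [gens]; omega

lemma card_planeTrees_three_add (m : ℕ) : 8 * (planeTrees (m + 3)).card ≤ 4 ^ (m + 2) := by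
  induction m with
  | zero =>
    have h1 := succ_mul_card_planeTrees 0
    have h2 := succ_mul_card_planeTrees 1
    have h3 : (planeTrees 1).card = 1 := by simp [planeTrees]
    norm_num at h1 h2 ⊢
    omega
  | succ n ih =>
    have h := succ_mul_card_planeTrees (n + 2)
    have : (n + 4) * (planeTrees (n + 4)).card ≤ (n + 4) * (4 * (planeTrees (n + 3)).card) := by
      rw [show (n + 4) * (planeTrees (n + 4)).card = _ from h]
      change _ * (planeTrees (n + 3)).card ≤ _
      nlinarith [(planeTrees (n + 3)).card.zero_le]
    have := Nat.le_of_mul_le_mul_left this (by omega)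
    rw [show n + 1 + 2 = n + 2 + 1 by ring, pow_succ]
    change 8 * (planeTrees (n + 4)).card ≤ _
    omega

lemma genVal_three_add_le (m : ℕ) : genVal (m + 3) * (1 / 16) ^ (m + 3) ≤ (1 / 2) ^ m / 1024 := by
  have hc : (8 : ℝ) * (planeTrees (m + 3)).card ≤ 4 ^ (m + 2) := by
    exact_mod_cast card_planeTrees_three_add m
  have : genVal (m + 3) ≤ 2 ^ (m + 1) * (4 ^ (m + 2) / 8) := by
    calc genVal (m + 3) ≤ ∑ l ∈ planeTrees (m + 3), (2 : ℝ) ^ (m + 1) := by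
          refine sum_le_sum fun l hl => ?_
          have : 1 ≤ gens l := gens_pos_of_size l (by rw [mem_planeTrees.1 hl]; omega)
          rw [show m + 3 - 1 = (m + 1) + 1 by omega, pow_succ _ (m + 1), div_le_iff₀ (by positivity)]
          gcongr
          calc (2 : ℝ) = 2 ^ 1 := by norm_num
            _ ≤ _ := by gcongr; norm_num
      _ = 2 ^ (m + 1) * ((planeTrees (m + 3)).card : ℝ) := by
          rw [sum_const, nsmul_eq_mul]; ring
      _ ≤ _ := by gcongr; linarith
  calc _ ≤ (2 ^ (m + 1) * (4 ^ (m + 2) / 8) : ℝ) * (1 / 16) ^ (m + 3) := by gcongr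
    _ = (2 * 4 * (1 / 16)) ^ m / 1024 := by rw [mul_pow, mul_pow]; ring
    _ = _ := by norm_num

lemma genMeanSum_le : genMeanSum ≤ 5 / 8 := by
  have h1 := summable_genMeanSum.sum_add_tsum_nat_add 3
  simp only [Finset.sum_range_succ, Finset.sum_range_zero, genVal_zero, genVal_one, genVal_two] at h1
  have hg : HasSum (fun m : ℕ => 8 / 1024 * ((m : ℝ) * (1 / 2) ^ m + 3 * (1 / 2) ^ m)) (1 / 16) := by
    have a1 := (hasSum_coe_mul_geometric_of_norm_lt_one (r := (1 / 2 : ℝ)) (by norm_num))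
    have a2 := (hasSum_geometric_of_lt_one (r := (1 / 2 : ℝ)) (by norm_num) (by norm_num))
    have := (a1.add (a2.mul_left 3)).mul_left (8 / 1024)
    norm_num at this ⊢
    exact this
  have h2 : ∑' m : ℕ, 8 * ((m + 3 : ℕ) : ℝ) * (genVal (m + 3) * (1 / 16) ^ (m + 3)) ≤ 1 / 16 := by
    refine (Summable.tsum_le_tsum (fun m => ?_)
      ((summable_nat_add_iff 3).2 summable_genMeanSum) hg.summable).trans hg.tsum_eq.le
    calc _ ≤ 8 * ((m + 3 : ℕ) : ℝ) * ((1 / 2) ^ m / 1024) := by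
          gcongr; exact genVal_three_add_le m
      _ = _ := by push_cast; ring
  rw [genMeanSum, ← h1]
  norm_num at h2 ⊢
  linarith

lemma genSum_ge : 1 / 16 + 1 / 256 ≤ genSum := by
  have := summable_genSum.sum_le_tsum (Finset.range 3)
    (fun m _ => mul_nonneg (genVal_nonneg m) (by positivity))
  simp only [Finset.sum_range_succ, Finset.sum_range_zero, genVal_zero, genVal_one, genVal_two] at this
  rw [genSum]
  norm_num at this ⊢
  linarith

lemma genDerSum_pos : 0 < genDerSum := by
  have := summable_genDerSum.le_tsum 2 (fun m _ => mul_nonneg (genDer_nonneg m) (by positivity))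
  rw [genDer_two] at this
  rw [genDerSum]
  norm_num at this
  linarith

end PTree

namespace PTree
open Finset PowerSeries Filter Topology

/-- Second order expansion of the perturbed singularity. -/
lemma tendsto_rho {ρ : ℝ → ℂ} (hρ0 : ρ 0 = 1 / 4)
    (hρ : ∀ τ : ℝ, |τ| ≤ 1 / 600 → ‖ρ τ - 1 / 4‖ ≤ 10 * |τ| ∧
      HasSum (fun j => ((Complex.exp (Complex.I * τ) - 1) *
        if Even j then genCoeff (Complex.exp (Complex.I * τ)) (j / 2) else 0) * ρ τ ^ j)
        (1 / 4 - ρ τ)) :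
    Tendsto (fun τ : ℝ => (4 * ρ τ * Complex.exp (Complex.I * ((4 * genSum : ℝ) * τ)) - 1) / (τ : ℂ) ^ 2)
      (𝓝[≠] 0) (𝓝 (((4 * genSum) ^ 2 / 2 + (4 * genSum) / 2 + 4 * genDerSum
        - (4 * genSum) * genMeanSum : ℝ) : ℂ)) := by
  set u : ℝ → ℂ := fun τ => Complex.exp (Complex.I * τ) with hu
  have hev : ∀ᶠ τ : ℝ in 𝓝 0, |τ| ≤ 1 / 600 := by
    have := (continuous_abs (G := ℝ)).tendsto 0
    rw [abs_zero] at this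
    exact this.eventually (Iic_mem_nhds (by norm_num))
  have hne : ∀ᶠ τ : ℝ in 𝓝[≠] 0, |τ| ≤ 1 / 600 := hev.filter_mono nhdsWithin_le_nhds
  have hτlim : Tendsto (fun τ : ℝ => |τ|) (𝓝 0) (𝓝 0) := by
    simpa using (continuous_abs (G := ℝ)).tendsto 0
  have hu0 : u 0 = 1 := by simp [hu]
  have hρlim : Tendsto ρ (𝓝 0) (𝓝 (1 / 4)) := by
    rw [tendsto_iff_norm_sub_tendsto_zero]
    refine squeeze_zero' (.of_forall fun _ => norm_nonneg _) (hev.mono fun τ h => (hρ τ h).1) ?_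
    simpa using hτlim.const_mul 10
  let k : ℕ → ℝ → ℂ := fun m τ => genCoeff (u τ) m * ρ τ ^ (2 * m)
  let K : ℝ → ℂ := fun τ => ∑' m, k m τ
  have hk0 : ∀ m, k m 0 = ((genVal m * (1 / 16) ^ m : ℝ) : ℂ) := by
    intro m
    simp only [k, hu0, hρ0, genCoeff_one, pow_mul]
    push_cast
    norm_num
  have hK0 : K 0 = genSum := by
    simp only [K, hk0, genSum, Complex.ofReal_tsum]
  have hkev : ∀ m, Tendsto (k m) (𝓝 0) (𝓝 (k m 0)) := by
    intro m
    have h1 := (hasDerivAt_genCoeff m).continuousAt.tendsto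
    have h2 := h1.mul (hρlim.pow (2 * m))
    simp only [k, hρ0]
    exact h2
  have hKlim : Tendsto K (𝓝 0) (𝓝 (K 0)) := by
    refine tendsto_tsum_of_dominated_convergence (summable_aux 0) hkev ?_
    filter_upwards [hev] with τ hτ m
    simp only [k]
    rw [norm_mul, norm_pow, pow_mul]
    have := norm_le_of_near hτ (hρ τ hτ).1
    calc _ ≤ (8 : ℝ) ^ m * ((3 / 10) ^ 2) ^ m := by
          gcongr; exact norm_genCoeff_le (norm_exp_I τ).le _
      _ = _ := by rw [← mul_pow]; norm_num
  have hρeq : ∀ τ : ℝ, |τ| ≤ 1 / 600 → ρ τ = 1 / 4 - (u τ - 1) * K τ := fun τ hτ =>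
    (rho_eq hτ (hρ τ hτ).1 (hρ τ hτ).2).2
  have hu1 : Tendsto (fun τ : ℝ => (u τ - 1) / (τ : ℂ)) (𝓝[≠] 0) (𝓝 Complex.I) := by
    have := tendsto_exp_first_order 1
    simpa [hu] using this
  have hu2 : Tendsto (fun τ : ℝ => (u τ - 1 - Complex.I * τ) / (τ : ℂ) ^ 2) (𝓝[≠] 0)
      (𝓝 (-1 / 2)) := by
    have := tendsto_exp_second_order 1
    simpa [hu] using this
  have hρder : HasDerivAt ρ (-(Complex.I * genSum)) 0 := by
    rw [hasDerivAt_iff_tendsto_slope]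
    have h1 := (hu1.mul (hKlim.mono_left nhdsWithin_le_nhds)).neg
    rw [hK0] at h1
    refine h1.congr' ?_
    filter_upwards [hne, self_mem_nhdsWithin] with τ hτ hτ0
    rw [slope_def_module, hρeq τ hτ, hρ0, sub_zero, Complex.real_smul]
    push_cast
    ring
  let k' : ℕ → ℂ := fun m => Complex.I * (((genDer m * (1 / 16) ^ m : ℝ) : ℂ) -
    genSum * ((8 * m * (genVal m * (1 / 16) ^ m) : ℝ) : ℂ))
  have hkder : ∀ m, HasDerivAt (k m) (k' m) 0 := by
    intro m
    have h1 := (hasDerivAt_genCoeff m).mul (hρder.pow (2 * m))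
    refine h1.congr_deriv ?_
    rw [show Complex.exp (Complex.I * (0 : ℝ)) = 1 by simp, genCoeff_one]
    simp only [Pi.pow_apply, hρ0, k']
    rcases m with _ | m
    · simp
    · rw [show 2 * (m + 1) - 1 = 2 * m + 1 by omega, pow_succ _ (2 * m), pow_mul, pow_mul, pow_succ _ m]
      push_cast
      norm_num
      ring
  have hk'sum : ∑' m, k' m = Complex.I * (genDerSum - genSum * genMeanSum) := by
    have h1 : HasSum (fun m => ((genDer m * (1 / 16) ^ m : ℝ) : ℂ)) genDerSum :=
      Complex.hasSum_ofReal.2 summable_genDerSum.hasSum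
    have h2 : HasSum (fun m : ℕ => ((8 * m * (genVal m * (1 / 16) ^ m) : ℝ) : ℂ)) genMeanSum :=
      Complex.hasSum_ofReal.2 summable_genMeanSum.hasSum
    exact ((h1.sub (h2.mul_left (genSum : ℂ))).mul_left Complex.I).tsum_eq
  have hKder : Tendsto (fun τ : ℝ => (K τ - genSum) / (τ : ℂ)) (𝓝[≠] 0) (𝓝 (∑' m, k' m)) := by
    have h1 : Tendsto (fun τ : ℝ => ∑' m, slope (k m) 0 τ) (𝓝[≠] 0) (𝓝 (∑' m, k' m)) := by
      refine tendsto_tsum_of_dominated_convergence ((summable_aux 1).mul_left 70)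
        (fun m => hasDerivAt_iff_tendsto_slope.1 (hkder m)) ?_
      filter_upwards [hne, self_mem_nhdsWithin] with τ hτ hτ0 m
      have hτ0' : 0 < |τ| := abs_pos.2 hτ0
      have hn := norm_le_of_near hτ (hρ τ hτ).1
      rw [slope_def_module, sub_zero, norm_smul, norm_inv, Real.norm_eq_abs, inv_mul_le_iff₀ hτ0']
      rcases m with _ | m
      · simp [k, genCoeff, planeTrees]
      have e1 : k (m + 1) τ - k (m + 1) 0 =
          (genCoeff (u τ) (m + 1) - genCoeff 1 (m + 1)) * ρ τ ^ (2 * (m + 1)) +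
          genCoeff 1 (m + 1) * (ρ τ ^ (2 * m + 1 + 1) - (1 / 4) ^ (2 * m + 1 + 1)) := by
        simp only [k, hu0, hρ0]; ring
      rw [e1]
      calc _ ≤ (8 ^ (m + 1) * (2 * (m + 1 : ℕ)) * |τ|) * (3 / 10) ^ (2 * (m + 1)) +
            8 ^ (m + 1) * (((2 * m + 1 : ℕ) + 1) * (3 / 10) ^ (2 * m + 1) * (10 * |τ|)) := by
            refine (norm_add_le _ _).trans ?_
            rw [norm_mul, norm_mul, norm_pow]
            gcongr
            · refine (norm_genCoeff_sub_le (norm_exp_I τ).le _).trans ?_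
              gcongr
              exact norm_exp_I_sub_one_le τ
            · exact norm_genCoeff_le (by simp) _
            · refine (norm_pow_sub_pow_le hn (by norm_num) _).trans ?_
              gcongr
              exact (hρ τ hτ).1
        _ = |τ| * ((2 + 200 / 3) * ((m + 1 : ℕ) * (18 / 25 : ℝ) ^ (m + 1))) := by
            have e2 : (18 / 25 : ℝ) ^ (m + 1) = 8 ^ (m + 1) * ((3 / 10) ^ 2) ^ (m + 1) := by
              rw [← mul_pow]; norm_num
            rw [e2, ← pow_mul]
            push_cast
            ring
        _ ≤ _ := by
            rw [pow_one]
            gcongr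
            norm_num
    refine h1.congr' ?_
    filter_upwards [hne, self_mem_nhdsWithin] with τ hτ hτ0
    have hs1 : Summable fun m => k m τ := (rho_eq hτ (hρ τ hτ).1 (hρ τ hτ).2).1
    have hs2 : Summable fun m => k m 0 := by
      simp only [hk0]
      exact Complex.summable_ofReal.2 summable_genSum
    have e : (fun m => slope (k m) 0 τ) = fun m => (τ : ℂ)⁻¹ * (k m τ - k m 0) := by
      funext m
      rw [slope_def_module, sub_zero, Complex.real_smul, Complex.ofReal_inv]
    rw [e, tsum_mul_left, hs1.tsum_sub hs2, ← hK0]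
    simp only [K]
    ring
  set γ : ℝ := 4 * genSum with hγ
  have he0 : Tendsto (fun τ : ℝ => Complex.exp (Complex.I * (γ * τ))) (𝓝[≠] 0) (𝓝 1) := by
    have : Continuous fun τ : ℝ => Complex.exp (Complex.I * (γ * τ)) := by fun_prop
    have h := this.tendsto 0
    simp only [Complex.ofReal_zero, mul_zero, Complex.exp_zero] at h
    exact h.mono_left nhdsWithin_le_nhds
  have he1 := tendsto_exp_first_order γ
  have he2 := tendsto_exp_second_order γ
  have hmain := ((he2.sub ((hu2.mul he0).const_mul (γ : ℂ))).sub
    (he1.const_mul (Complex.I * γ))).sub (((hu1.mul hKder).mul he0).const_mul 4)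
  rw [hk'sum] at hmain
  have hval : -(γ : ℂ) ^ 2 / 2 - γ * (-1 / 2 * 1) - Complex.I * γ * (Complex.I * γ) -
      4 * (Complex.I * (Complex.I * (genDerSum - genSum * genMeanSum)) * 1) =
      ((γ ^ 2 / 2 + γ / 2 + 4 * genDerSum - γ * genMeanSum : ℝ) : ℂ) := by
    rw [hγ]
    push_cast
    ring_nf
    rw [Complex.I_sq]
    ring
  rw [hval] at hmain
  refine hmain.congr' ?_
  filter_upwards [hne, self_mem_nhdsWithin] with τ hτ hτ0
  have : (τ : ℂ) ≠ 0 := by simpa using hτ0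
  rw [hρeq τ hτ]
  simp only [hγ]
  push_cast
  field_simp
  ring

lemma gens_variance_pos : 0 < (4 * genSum) ^ 2 / 2 + (4 * genSum) / 2 + 4 * genDerSum
        - (4 * genSum) * genMeanSum := by
  have h1 := genSum_ge
  have h2 := genDerSum_pos
  have h3 := genMeanSum_le
  nlinarith

end PTree

namespace PTree
open Finset PowerSeries Filter Topology

lemma coeff_zero_gf {R : Type*} [CommRing R] (f : PTree → R) : coeff 0 (gf f) = 0 := by
  rw [coeff_gf]; simp [planeTrees]

lemma tendsto_one_of_exists_rho {ρ : ℝ → ℂ}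
    (hρ : ∀ τ : ℝ, |τ| ≤ 1 / 600 → ‖ρ τ - 1 / 4‖ ≤ 10 * |τ| ∧
      HasSum (fun j => ((Complex.exp (Complex.I * τ) - 1) *
        if Even j then genCoeff (Complex.exp (Complex.I * τ)) (j / 2) else 0) * ρ τ ^ j)
        (1 / 4 - ρ τ)) {τ : ℕ → ℝ} (hτ : Tendsto τ atTop (𝓝 0)) :
    Tendsto (fun n => (∑ T ∈ planeTrees n, Complex.exp (Complex.I * τ n) ^ gens T) *
      (4 * ρ (τ n)) ^ n / ((planeTrees n).card : ℂ)) atTop (𝓝 1) := by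
  obtain ⟨K, hK1, hK⟩ := exists_coeff_bound
  have habs : Tendsto (fun n => |τ n|) atTop (𝓝 0) := by simpa using hτ.abs
  rw [tendsto_iff_norm_sub_tendsto_zero]
  refine squeeze_zero' (.of_forall fun _ => norm_nonneg _) ?_ (by simpa using habs.const_mul K)
  filter_upwards [habs.eventually (Iic_mem_nhds (show (0 : ℝ) < 1 / 600 by norm_num)),
    habs.eventually (Iic_mem_nhds (show (0 : ℝ) < 1 / K by positivity)),
    eventually_ge_atTop 1] with n h1 h2 hn
  have := hK (fun j => (Complex.exp (Complex.I * τ n) - 1) *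
        if Even j then genCoeff (Complex.exp (Complex.I * τ n)) (j / 2) else 0) |τ n| (ρ (τ n))
        (gf fun T => Complex.exp (Complex.I * τ n) ^ gens T) h1 ?_ ?_ (hρ _ h1).1 (hρ _ h1).2
        (coeff_zero_gf _) (gf_gens_eq _) ?_ n hn
  · rwa [coeff_gf] at this
  · intro j
    rw [norm_mul]
    gcongr
    · exact norm_exp_I_sub_one_le _
    · split_ifs with h
      · refine (norm_genCoeff_le (norm_exp_I _).le _).trans ?_
        obtain ⟨m, rfl⟩ := h
        rw [show (m + m) / 2 = m by omega, ← two_mul, pow_mul]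
        gcongr; norm_num
      · simp
  · simp [genCoeff, planeTrees]
  · have h3 := (le_div_iff₀ (show 0 < K by positivity)).mp h2; linarith

/-- Pointwise convergence of the characteristic functions of the number of generators of a random
plane tree. -/
lemma exists_tendsto_char : ∃ γ : ℝ, 0 < γ ∧ ∃ σ : ℝ, 0 < σ ∧ ∀ θ : ℝ,
    Tendsto (fun n : ℕ => (∑ T ∈ planeTrees n,
      Complex.exp (((θ * (((gens T : ℝ) - γ * n) / (σ * Real.sqrt n)) : ℝ) : ℂ) * Complex.I)) /
        ((planeTrees n).card : ℂ)) atTop (𝓝 (Complex.exp (-(θ : ℂ) ^ 2 / 2))) := by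
  obtain ⟨ρ, hρ0, hρ⟩ := exists_rho
  have hs := gens_variance_pos
  have hlim := tendsto_rho hρ0 hρ
  set s : ℝ := (4 * genSum) ^ 2 / 2 + (4 * genSum) / 2 + 4 * genDerSum
        - (4 * genSum) * genMeanSum with hs_def
  have hγ : 0 < 4 * genSum := by linarith [genSum_ge]
  set γ := 4 * genSum
  refine ⟨γ, hγ, Real.sqrt (2 * s), by positivity, fun θ => ?_⟩
  set σ := Real.sqrt (2 * s)
  have hσ : 0 < σ := by positivity
  have hσ2 : σ ^ 2 = 2 * s := Real.sq_sqrt (by positivity)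
  set τ : ℕ → ℝ := fun n => θ / (σ * Real.sqrt n) with hτ_def
  have hτ : Tendsto τ atTop (𝓝 0) := by
    apply Tendsto.const_div_atTop
    exact (Real.tendsto_sqrt_atTop.comp tendsto_natCast_atTop_atTop).const_mul_atTop hσ
  have hone := tendsto_one_of_exists_rho hρ hτ
  have hpow : Tendsto (fun n : ℕ => (4 * ρ (τ n) * Complex.exp (Complex.I * ((γ : ℝ) * τ n))) ^ n)
      atTop (𝓝 (Complex.exp ((θ : ℂ) ^ 2 / 2))) := by
    by_cases hθ : θ = 0
    · simp only [hτ_def, hθ, zero_div, hρ0]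
      norm_num
    · have hτne : ∀ᶠ n in atTop, τ n ≠ 0 := by
        filter_upwards [eventually_gt_atTop 0] with n hn
        have : (0 : ℝ) < n := by exact_mod_cast hn
        positivity
      have h1 : Tendsto τ atTop (𝓝[≠] 0) :=
        tendsto_nhdsWithin_iff.mpr ⟨hτ, hτne⟩
      have h2 := hlim.comp h1
      have h3 : Tendsto (fun n : ℕ => (n : ℂ) *
          (4 * ρ (τ n) * Complex.exp (Complex.I * ((γ : ℝ) * τ n)) - 1)) atTop
          (𝓝 ((θ : ℂ) ^ 2 / 2)) := by
        have h4 := h2.const_mul ((θ : ℂ) ^ 2 / (σ : ℂ) ^ 2)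
        have e : (θ : ℂ) ^ 2 / (σ : ℂ) ^ 2 * (s : ℂ) = (θ : ℂ) ^ 2 / 2 := by
          have : (σ : ℂ) ^ 2 = 2 * s := by exact_mod_cast hσ2
          have hs' : (s : ℂ) ≠ 0 := by exact_mod_cast hs.ne'
          rw [this]; field_simp
        rw [e] at h4
        refine h4.congr' ?_
        filter_upwards [hτne, eventually_gt_atTop 0] with n hn hn0
        have hn' : (τ n : ℂ) ≠ 0 := by exact_mod_cast hn
        have hσ' : (σ : ℂ) ≠ 0 := by exact_mod_cast hσ.ne'
        have key : (n : ℂ) * (τ n : ℂ) ^ 2 = (θ : ℂ) ^ 2 / (σ : ℂ) ^ 2 := by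
          have : (n : ℝ) * (τ n) ^ 2 = θ ^ 2 / σ ^ 2 := by
            simp only [hτ_def]
            have hnr : (0 : ℝ) < n := by exact_mod_cast hn0
            rw [div_pow, mul_pow, Real.sq_sqrt hnr.le]
            field_simp
          exact_mod_cast this
        simp only [Function.comp]
        rw [← key]
        field_simp
      have := Complex.tendsto_one_add_pow_exp_of_tendsto h3
      simpa using this
  have hdiv := hone.div hpow (Complex.exp_ne_zero _)
  rw [one_div, ← Complex.exp_neg] at hdiv
  rw [show -(θ : ℂ) ^ 2 / 2 = -((θ : ℂ) ^ 2 / 2) by ring]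
  have hne : ∀ᶠ n in atTop, (4 * ρ (τ n) * Complex.exp (Complex.I * ((γ : ℝ) * τ n))) ^ n ≠ 0 :=
    hpow.eventually_ne (Complex.exp_ne_zero _)
  refine hdiv.congr' ?_
  filter_upwards [hne] with n hn
  rw [Pi.div_apply, mul_pow _ (Complex.exp _)] at *
  have hr : (4 * ρ (τ n)) ^ n ≠ 0 := left_ne_zero_of_mul hn
  rw [div_div, mul_comm ((planeTrees n).card : ℂ), mul_assoc, mul_comm (∑ T ∈ _, _),
    mul_div_mul_left _ _ hr, ← div_div]
  congr 1
  rw [← Complex.exp_nat_mul, div_eq_mul_inv, ← Complex.exp_neg, sum_mul]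
  refine sum_congr rfl fun T _ => ?_
  rw [← Complex.exp_nat_mul, ← Complex.exp_add]
  congr 1
  simp only [hτ_def]
  push_cast
  ring

open MeasureTheory ProbabilityTheory in
lemma tendsto_cdf_of_char {ι : Type*} (A : ℕ → Finset ι) (hA : ∀ᶠ n in atTop, (A n).Nonempty)
    (Z : ℕ → ι → ℝ)
    (h : ∀ θ : ℝ, Tendsto (fun n : ℕ => (∑ T ∈ A n, Complex.exp (((θ * Z n T : ℝ) : ℂ) * Complex.I)) /
        ((A n).card : ℂ)) atTop (𝓝 (Complex.exp (-(θ : ℂ) ^ 2 / 2)))) (x : ℝ) :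
    Tendsto (fun n => (((A n).filter fun T => Z n T ≤ x).card : ℝ) / (A n).card) atTop
      (𝓝 ((Real.sqrt (2 * Real.pi))⁻¹ * ∫ t in Set.Iic x, Real.exp (-t ^ 2 / 2))) := by
  let m : ℕ → Measure ℝ := fun n => if (A n).Nonempty then
    ((A n).card : ENNReal)⁻¹ • ∑ T ∈ A n, Measure.dirac (Z n T) else Measure.dirac 0
  have hm : ∀ n, IsProbabilityMeasure (m n) := by
    intro n
    simp only [m]
    split_ifs with hn
    · refine ⟨?_⟩
      simp only [Measure.smul_apply, Measure.coe_finsetSum, Finset.sum_apply, measure_univ,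
        Finset.sum_const, smul_eq_mul, nsmul_eq_mul, mul_one]
      exact ENNReal.inv_mul_cancel (by simpa using hn.ne_empty) (by simp)
    · infer_instance
  let P : ℕ → ProbabilityMeasure ℝ := fun n => ⟨m n, hm n⟩
  let N : ProbabilityMeasure ℝ := ⟨gaussianReal 0 1, inferInstance⟩
  have hconv : Tendsto P atTop (𝓝 N) := by
    rw [ProbabilityMeasure.tendsto_iff_tendsto_charFun]
    intro θ
    have e : charFun (N : Measure ℝ) θ = Complex.exp (-(θ : ℂ) ^ 2 / 2) := by
      simp only [N, ProbabilityMeasure.coe_mk, charFun_gaussianReal]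
      congr 1
      push_cast
      ring
    rw [e]
    refine (h θ).congr' ?_
    filter_upwards [hA] with n hn
    simp only [P, ProbabilityMeasure.coe_mk, m, if_pos hn, charFun_apply_real]
    rw [integral_smul_measure, integral_finsetSum_measure]
    · simp [div_eq_inv_mul]
    · intro i _
      exact integrable_dirac (by simp)
  have h1 := ProbabilityMeasure.tendsto_measure_of_null_frontier_of_tendsto hconv (E := Set.Iic x) (by
    rw [frontier_Iic]
    have := nullSingletonClass_gaussianReal (μ := 0) (v := 1) one_ne_zero
    simp [N])
  have h2 := (NNReal.continuous_coe.tendsto _).comp h1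
  have e2 : ((N (Set.Iic x) : NNReal) : ℝ) =
      (Real.sqrt (2 * Real.pi))⁻¹ * ∫ t in Set.Iic x, Real.exp (-t ^ 2 / 2) := by
    change (((gaussianReal 0 1 (Set.Iic x)).toNNReal : NNReal) : ℝ) = _
    rw [ENNReal.coe_toNNReal_eq_toReal, gaussianReal_apply_eq_integral _ one_ne_zero,
      ENNReal.toReal_ofReal (integral_nonneg fun _ => gaussianPDFReal_nonneg _ _ _)]
    simp [gaussianPDFReal_def, integral_const_mul]
  rw [e2] at h2
  refine h2.congr' ?_
  filter_upwards [hA] with n hn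
  change (((m n (Set.Iic x)).toNNReal : NNReal) : ℝ) = _
  simp only [m, if_pos hn]
  rw [ENNReal.coe_toNNReal_eq_toReal, Measure.smul_apply, Measure.coe_finsetSum, Finset.sum_apply]
  simp only [Measure.dirac_apply' _ measurableSet_Iic, Set.indicator_apply, Set.mem_Iic, Pi.one_apply,
    Finset.sum_boole, smul_eq_mul, ENNReal.toReal_mul, ENNReal.toReal_inv, ENNReal.toReal_natCast]
  rw [div_eq_inv_mul]

/-- The central limit theorem for the number of generators of a uniform random plane tree. -/
lemma exists_tendsto_planeTrees : ∃ γ : ℝ, 0 < γ ∧ ∃ σ : ℝ, 0 < σ ∧ ∀ x : ℝ,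
    Tendsto (fun n : ℕ => (((planeTrees n).filter fun T =>
        (gens T : ℝ) ≤ γ * n + x * σ * Real.sqrt n).card : ℝ) / (planeTrees n).card) atTop
      (𝓝 ((Real.sqrt (2 * Real.pi))⁻¹ * ∫ t in Set.Iic x, Real.exp (-t ^ 2 / 2))) := by
  obtain ⟨γ, hγ, σ, hσ, h⟩ := exists_tendsto_char
  refine ⟨γ, hγ, σ, hσ, fun x => ?_⟩
  refine (tendsto_cdf_of_char planeTrees ?_ _ h x).congr' ?_
  · filter_upwards [eventually_ge_atTop 1] with n hn
    exact Finset.card_pos.mp (card_planeTrees_pos hn)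
  · filter_upwards [eventually_ge_atTop 1] with n hn
    have hn' : (0 : ℝ) < n := by exact_mod_cast hn
    congr 3
    ext T
    rw [mem_filter, mem_filter, div_le_iff₀ (by positivity)]
    refine and_congr_right fun _ => ?_
    constructor <;> intro h <;> nlinarith

end PTree

namespace PTree
open Finset

/-- The type of leaves of a plane tree. -/
def Lf : PTree → Type
  | leaf => Unit
  | node l r => Lf l ⊕ Lf r

noncomputable instance instFintypeLf : ∀ T : PTree, Fintype (Lf T)
  | leaf => inferInstanceAs (Fintype Unit)
  | node l r =>
    have := instFintypeLf l
    have := instFintypeLf r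
    inferInstanceAs (Fintype (Lf l ⊕ Lf r))

lemma sum_lf_node {M : Type*} [AddCommMonoid M] {l r : PTree} (f : Lf (node l r) → M) :
    ∑ x, f x = ∑ x : Lf l, f (Sum.inl x) + ∑ x : Lf r, f (Sum.inr x) :=
  Fintype.sum_sum_type f

lemma card_lf : ∀ T : PTree, Fintype.card (Lf T) = size T
  | leaf => rfl
  | node l r => by
    have h := Fintype.card_sum (α := Lf l) (β := Lf r)
    rw [card_lf l, card_lf r] at h
    exact h

instance instNonemptyLf : ∀ T : PTree, Nonempty (Lf T) := fun T =>
  Fintype.card_pos_iff.mp (by rw [card_lf]; exact size_pos T)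

/-- The position of a leaf, counted from left to right. -/
def pos : ∀ T : PTree, Lf T → ℕ
  | leaf, _ => 0
  | node l _, .inl x => pos l x
  | node l r, .inr x => pos r x + size l

lemma pos_lt : ∀ (T : PTree) (x : Lf T), pos T x < size T
  | leaf, _ => Nat.one_pos
  | node l r, .inl x => (pos_lt l x).trans_le (Nat.le_add_right _ _)
  | node l r, .inr x => by
    have := pos_lt r x
    simp only [pos, size]
    omega

lemma pos_injective : ∀ T : PTree, Function.Injective (pos T)
  | leaf => fun _ _ _ => rfl
  | node l r => by
    rintro (x | x) (y | y) h
    · exact congrArg Sum.inl (pos_injective l h)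
    · have := pos_lt l x
      simp only [pos] at h
      omega
    · have := pos_lt l y
      simp only [pos] at h
      omega
    · simp only [pos, Nat.add_right_cancel_iff] at h
      exact congrArg Sum.inr (pos_injective r h)

/-- The equivalence between leaves and positions. -/
noncomputable def posEquiv (T : PTree) : Lf T ≃ Fin (size T) :=
  Equiv.ofBijective (fun x => ⟨pos T x, pos_lt T x⟩)
    ((Fintype.bijective_iff_injective_and_card _).mpr
      ⟨fun _ _ h => pos_injective T (Fin.mk.inj_iff.mp h), by rw [card_lf, Fintype.card_fin]⟩)

lemma posEquiv_val (T : PTree) (x : Lf T) : (posEquiv T x : ℕ) = pos T x := rfl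

/-- Two isomorphisms of branches, combined without swapping the branches. -/
def glue {l r l' r' : PTree} (p : (Lf l ≃ Lf l') × (Lf r ≃ Lf r')) :
    Lf (node l r) ≃ Lf (node l' r') := Equiv.sumCongr p.1 p.2

/-- Two isomorphisms of branches, combined with a swap of the branches. -/
def glueSwap {l r l' r' : PTree} (p : (Lf l ≃ Lf r') × (Lf r ≃ Lf l')) :
    Lf (node l r) ≃ Lf (node l' r') := (Equiv.sumCongr p.1 p.2).trans (Equiv.sumComm _ _)

lemma glue_injective {l r l' r' : PTree} : Function.Injective (@glue l r l' r') := by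
  rintro ⟨φ, ψ⟩ ⟨φ', ψ'⟩ h
  have h := fun x => DFunLike.congr_fun h x
  refine Prod.ext (Equiv.ext fun x => ?_) (Equiv.ext fun x => ?_)
  · exact Sum.inl_injective (h (Sum.inl x))
  · exact Sum.inr_injective (h (Sum.inr x))

lemma glueSwap_injective {l r l' r' : PTree} : Function.Injective (@glueSwap l r l' r') := by
  rintro ⟨φ, ψ⟩ ⟨φ', ψ'⟩ h
  have h := fun x => DFunLike.congr_fun h x
  refine Prod.ext (Equiv.ext fun x => ?_) (Equiv.ext fun x => ?_)
  · exact Sum.inr_injective (h (Sum.inl x))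
  · exact Sum.inl_injective (h (Sum.inr x))

lemma glue_ne_glueSwap {l r l' r' : PTree} (p : (Lf l ≃ Lf l') × (Lf r ≃ Lf r'))
    (q : (Lf l ≃ Lf r') × (Lf r ≃ Lf l')) : glue p ≠ glueSwap q := by
  intro h
  obtain ⟨x⟩ := instNonemptyLf l
  exact Sum.inl_ne_inr (DFunLike.congr_fun h (Sum.inl x))

/-- The root preserving isomorphisms between two plane trees, as bijections between leaves. -/
noncomputable def isos : ∀ T T' : PTree, Finset (Lf T ≃ Lf T')
  | leaf, leaf => {Equiv.refl _}
  | node l r, node l' r' =>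
    (isos l l' ×ˢ isos r r').image glue ∪ (isos l r' ×ˢ isos r l').image glueSwap
  | leaf, node _ _ => ∅
  | node _ _, leaf => ∅

lemma sum_isos_node {M : Type*} [AddCommMonoid M] {l r l' r' : PTree}
    (f : (Lf (node l r) ≃ Lf (node l' r')) → M) :
    ∑ e ∈ isos (node l r) (node l' r'), f e =
      ∑ p ∈ isos l l' ×ˢ isos r r', f (glue p) + ∑ p ∈ isos l r' ×ˢ isos r l', f (glueSwap p) := by
  rw [isos, sum_union, sum_image glue_injective.injOn, sum_image glueSwap_injective.injOn]
  rw [disjoint_left]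
  intro e h1 h2
  obtain ⟨p, -, rfl⟩ := mem_image.mp h1
  obtain ⟨q, -, h⟩ := mem_image.mp h2
  exact glue_ne_glueSwap p q h.symm

lemma card_isos : ∀ T T' : PTree, (isos T T').card = cnt T T'
  | leaf, leaf => rfl
  | leaf, node _ _ => rfl
  | node _ _, leaf => rfl
  | node l r, node l' r' => by
    rw [card_eq_sum_ones, sum_isos_node]
    simp only [sum_const, smul_eq_mul, mul_one, card_product, card_isos, cnt]

lemma mem_isos_node {l r l' r' : PTree} {e : Lf (node l r) ≃ Lf (node l' r')} :
    e ∈ isos (node l r) (node l' r') ↔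
      (∃ φ ∈ isos l l', ∃ ψ ∈ isos r r', glue (φ, ψ) = e) ∨
      (∃ φ ∈ isos l r', ∃ ψ ∈ isos r l', glueSwap (φ, ψ) = e) := by
  simp only [isos, mem_union, mem_image, mem_product, Prod.exists]
  refine or_congr ⟨?_, ?_⟩ ⟨?_, ?_⟩ <;> grind

lemma isos_refl : ∀ T : PTree, Equiv.refl (Lf T) ∈ isos T T
  | leaf => mem_singleton_self _
  | node l r => mem_isos_node.mpr (.inl ⟨_, isos_refl l, _, isos_refl r,
      Equiv.ext (by rintro (x | x) <;> rfl)⟩)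

lemma isos_symm : ∀ {T T' : PTree} {e : Lf T ≃ Lf T'}, e ∈ isos T T' → e.symm ∈ isos T' T
  | leaf, leaf, _, _ => mem_singleton.mpr (Equiv.ext fun _ => rfl)
  | leaf, node _ _, _, h => absurd h (notMem_empty _)
  | node _ _, leaf, _, h => absurd h (notMem_empty _)
  | node l r, node l' r', e, h => by
    rcases mem_isos_node.mp h with ⟨φ, hφ, ψ, hψ, rfl⟩ | ⟨φ, hφ, ψ, hψ, rfl⟩
    · exact mem_isos_node.mpr (.inl ⟨_, isos_symm hφ, _, isos_symm hψ,
        Equiv.ext (by rintro (x | x) <;> rfl)⟩)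
    · exact mem_isos_node.mpr (.inr ⟨_, isos_symm hψ, _, isos_symm hφ,
        Equiv.ext (by rintro (x | x) <;> rfl)⟩)

lemma isos_trans : ∀ {T T' T'' : PTree} {e : Lf T ≃ Lf T'} {e' : Lf T' ≃ Lf T''},
    e ∈ isos T T' → e' ∈ isos T' T'' → e.trans e' ∈ isos T T''
  | leaf, leaf, leaf, _, _, _, _ => mem_singleton.mpr (Equiv.ext fun _ => rfl)
  | leaf, node _ _, _, _, _, h, _ => absurd h (notMem_empty _)
  | node _ _, leaf, _, _, _, h, _ => absurd h (notMem_empty _)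
  | leaf, leaf, node _ _, _, _, _, h => absurd h (notMem_empty _)
  | node _ _, node _ _, leaf, _, _, _, h => absurd h (notMem_empty _)
  | node l r, node l' r', node l'' r'', e, e', h, h' => by
    rcases mem_isos_node.mp h with ⟨φ, hφ, ψ, hψ, rfl⟩ | ⟨φ, hφ, ψ, hψ, rfl⟩ <;>
    rcases mem_isos_node.mp h' with ⟨φ', hφ', ψ', hψ', rfl⟩ | ⟨φ', hφ', ψ', hψ', rfl⟩
    · exact mem_isos_node.mpr (.inl ⟨_, isos_trans hφ hφ', _, isos_trans hψ hψ',
        Equiv.ext (by rintro (x | x) <;> rfl)⟩)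
    · exact mem_isos_node.mpr (.inr ⟨_, isos_trans hφ hφ', _, isos_trans hψ hψ',
        Equiv.ext (by rintro (x | x) <;> rfl)⟩)
    · exact mem_isos_node.mpr (.inr ⟨_, isos_trans hφ hψ', _, isos_trans hψ hφ',
        Equiv.ext (by rintro (x | x) <;> rfl)⟩)
    · exact mem_isos_node.mpr (.inl ⟨_, isos_trans hφ hψ', _, isos_trans hψ hφ',
        Equiv.ext (by rintro (x | x) <;> rfl)⟩)

lemma exists_iso_of_mem_isoFuns : ∀ {T T' : PTree} {φ : ℕ → ℕ}, φ ∈ isoFuns T T' →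
    ∃ e ∈ isos T T', ∀ x, φ (pos T x) = pos T' (e x)
  | leaf, leaf, φ, h => by
    rw [isoFuns, List.mem_singleton] at h
    subst h
    exact ⟨_, mem_singleton_self _, fun _ => rfl⟩
  | leaf, node _ _, _, h => by simp [isoFuns] at h
  | node _ _, leaf, _, h => by simp [isoFuns] at h
  | node l r, node l' r', φ, h => by
    simp only [isoFuns, List.mem_append, List.mem_flatMap, List.mem_map] at h
    rcases h with ⟨g, hg, k, hk, rfl⟩ | ⟨g, hg, k, hk, rfl⟩ <;>
    obtain ⟨e₁, he₁, h₁⟩ := exists_iso_of_mem_isoFuns hg <;>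
    obtain ⟨e₂, he₂, h₂⟩ := exists_iso_of_mem_isoFuns hk
    · refine ⟨_, mem_isos_node.mpr (.inl ⟨e₁, he₁, e₂, he₂, rfl⟩), ?_⟩
      rintro (x | x)
      · exact (if_pos (pos_lt l x)).trans (h₁ x)
      · change (if pos r x + size l < size l then _ else k (pos r x + size l - size l) + size l')
          = pos r' (e₂ x) + size l'
        rw [if_neg (by omega), Nat.add_sub_cancel, h₂]
    · refine ⟨_, mem_isos_node.mpr (.inr ⟨e₁, he₁, e₂, he₂, rfl⟩), ?_⟩
      rintro (x | x)
      · exact (if_pos (pos_lt l x)).trans (congrArg (· + size l') (h₁ x))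
      · change (if pos r x + size l < size l then _ else k (pos r x + size l - size l))
          = pos l' (e₂ x)
        rw [if_neg (by omega), Nat.add_sub_cancel, h₂]

lemma exists_mem_isoFuns_of_iso : ∀ {T T' : PTree} {e : Lf T ≃ Lf T'}, e ∈ isos T T' →
    ∃ φ ∈ isoFuns T T', ∀ x, φ (pos T x) = pos T' (e x)
  | leaf, leaf, _, _ => ⟨_, List.mem_singleton_self _, fun _ => rfl⟩
  | leaf, node _ _, _, h => absurd h (notMem_empty _)
  | node _ _, leaf, _, h => absurd h (notMem_empty _)
  | node l r, node l' r', e, h => by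
    rcases mem_isos_node.mp h with ⟨φ, hφ, ψ, hψ, rfl⟩ | ⟨φ, hφ, ψ, hψ, rfl⟩ <;>
    obtain ⟨g, hg, h₁⟩ := exists_mem_isoFuns_of_iso hφ <;>
    obtain ⟨k, hk, h₂⟩ := exists_mem_isoFuns_of_iso hψ
    · refine ⟨_, List.mem_append_left _ (List.mem_flatMap.mpr ⟨g, hg, List.mem_map.mpr
        ⟨k, hk, rfl⟩⟩), ?_⟩
      rintro (x | x)
      · exact (if_pos (pos_lt l x)).trans (h₁ x)
      · change (if pos r x + size l < size l then _ else k (pos r x + size l - size l) + size l')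
          = pos r' (ψ x) + size l'
        rw [if_neg (by omega), Nat.add_sub_cancel, h₂]
    · refine ⟨_, List.mem_append_right _ (List.mem_flatMap.mpr ⟨g, hg, List.mem_map.mpr
        ⟨k, hk, rfl⟩⟩), ?_⟩
      rintro (x | x)
      · exact (if_pos (pos_lt l x)).trans (congrArg (· + size l') (h₁ x))
      · change (if pos r x + size l < size l then _ else k (pos r x + size l - size l))
          = pos l' (ψ x)
        rw [if_neg (by omega), Nat.add_sub_cancel, h₂]

end PTree

namespace PTree
open Finset

/-- Pairs of plane trees with a matching of their leaves. -/
abbrev Matched := Σ T : PTree, Σ S : PTree, (Lf T ≃ Lf S)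

/-- The matched pairs of plane trees of size `n`. -/
noncomputable def matchedPairs (n : ℕ) : Finset Matched :=
  (planeTrees n).sigma fun _ => (planeTrees n).sigma fun _ => univ

lemma mem_matchedPairs {n : ℕ} {t : Matched} :
    t ∈ matchedPairs n ↔ size t.1 = n ∧ size t.2.1 = n := by
  simp [matchedPairs, mem_planeTrees]

/-- The list of values of a matching. -/
noncomputable def matchList {T S : PTree} (v : Lf T ≃ Lf S) : List ℕ :=
  List.ofFn fun i : Fin (size T) => pos S (v ((posEquiv T).symm i))

lemma getD_matchList {T S : PTree} (v : Lf T ≃ Lf S) (x : Lf T) :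
    (matchList v).getD (pos T x) 0 = pos S (v x) := by
  have h : pos T x < (matchList v).length := by simp [matchList, pos_lt]
  rw [List.getD_eq_getElem _ _ h]
  simp only [matchList, List.getElem_ofFn]
  congr 2
  rw [Equiv.symm_apply_eq]
  rfl

lemma matchList_injective {T S : PTree} : Function.Injective (@matchList T S) := by
  intro v v' h
  ext x
  apply pos_injective
  rw [← getD_matchList, ← getD_matchList, h]

lemma image_matchList {T S : PTree} {n : ℕ} (hT : size T = n) (hS : size S = n) :
    (univ : Finset (Lf T ≃ Lf S)).image matchList = (List.range n).permutations.toFinset := by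
  apply eq_of_subset_of_card_le
  · intro L hL
    obtain ⟨v, -, rfl⟩ := mem_image.mp hL
    rw [List.mem_toFinset, List.mem_permutations]
    refine (List.perm_ext_iff_of_nodup ?_ List.nodup_range).mpr fun a => ?_
    · refine List.nodup_ofFn.mpr fun i j h => ?_
      exact (posEquiv T).symm.injective (v.injective (pos_injective S h))
    · rw [matchList, List.mem_ofFn, List.mem_range]
      constructor
      · rintro ⟨i, rfl⟩
        exact hS ▸ pos_lt _ _
      · intro ha
        refine ⟨posEquiv T (v.symm ((posEquiv S).symm ⟨a, hS ▸ ha⟩)), ?_⟩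
        rw [Equiv.symm_apply_apply, Equiv.apply_symm_apply, ← posEquiv_val,
          Equiv.apply_symm_apply]
  · rw [card_image_of_injective _ matchList_injective, card_univ,
      List.toFinset_card_of_nodup (List.nodup_permutations _ List.nodup_range),
      List.length_permutations, List.length_range, Fintype.card_equiv
        (Fintype.equivOfCardEq (by rw [card_lf, card_lf, hT, hS])), card_lf, hT]

/-- The triple associated to a matched pair. -/
noncomputable def toTriple (t : Matched) : PTree × PTree × List ℕ := (t.1, t.2.1, matchList t.2.2)

lemma image_toTriple (n : ℕ) : (matchedPairs n).image toTriple = Triples n := by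
  ext ⟨T, S, L⟩
  simp only [mem_image, Triples, mem_product, toTriple, mem_matchedPairs, mem_planeTrees]
  constructor
  · rintro ⟨⟨T', S', v⟩, ⟨hT, hS⟩, h⟩
    obtain ⟨rfl, rfl, rfl⟩ : T' = T ∧ S' = S ∧ matchList v = L := by simpa using h
    exact ⟨hT, hS, image_matchList hT hS ▸ mem_image_of_mem _ (mem_univ v)⟩
  · rintro ⟨hT, hS, hL⟩
    rw [← image_matchList hT hS] at hL
    obtain ⟨v, -, rfl⟩ := mem_image.mp hL
    exact ⟨⟨T, S, v⟩, ⟨hT, hS⟩, rfl⟩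

/-- The isomorphisms between two matched pairs. -/
noncomputable def homs (t t' : Matched) : Finset ((Lf t.1 ≃ Lf t'.1) × (Lf t.2.1 ≃ Lf t'.2.1)) :=
  (isos t.1 t'.1 ×ˢ isos t.2.1 t'.2.1).filter fun p => p.1.trans t'.2.2 = t.2.2.trans p.2

lemma mem_homs {t t' : Matched} {p : (Lf t.1 ≃ Lf t'.1) × (Lf t.2.1 ≃ Lf t'.2.1)} :
    p ∈ homs t t' ↔ (p.1 ∈ isos t.1 t'.1 ∧ p.2 ∈ isos t.2.1 t'.2.1) ∧
      p.1.trans t'.2.2 = t.2.2.trans p.2 := by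
  rw [homs, mem_filter, mem_product]

lemma homs_refl (t : Matched) : (homs t t).Nonempty :=
  ⟨(Equiv.refl _, Equiv.refl _), mem_homs.mpr ⟨⟨isos_refl _, isos_refl _⟩, rfl⟩⟩

lemma mem_homs_symm {t t' : Matched} {p : (Lf t.1 ≃ Lf t'.1) × (Lf t.2.1 ≃ Lf t'.2.1)}
    (h : p ∈ homs t t') : (p.1.symm, p.2.symm) ∈ homs t' t := by
  obtain ⟨⟨h1, h2⟩, h3⟩ := mem_homs.mp h
  refine mem_homs.mpr ⟨⟨isos_symm h1, isos_symm h2⟩, ?_⟩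
  ext x
  have := DFunLike.congr_fun h3 (p.1.symm x)
  simp only [Equiv.trans_apply, Equiv.apply_symm_apply] at this
  simp [this]

lemma mem_homs_trans {t t' t'' : Matched} {p : (Lf t.1 ≃ Lf t'.1) × (Lf t.2.1 ≃ Lf t'.2.1)}
    {q : (Lf t'.1 ≃ Lf t''.1) × (Lf t'.2.1 ≃ Lf t''.2.1)} (h : p ∈ homs t t') (h' : q ∈ homs t' t'') :
    (p.1.trans q.1, p.2.trans q.2) ∈ homs t t'' := by
  obtain ⟨⟨h1, h2⟩, h3⟩ := mem_homs.mp h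
  obtain ⟨⟨h1', h2'⟩, h3'⟩ := mem_homs.mp h'
  refine mem_homs.mpr ⟨⟨isos_trans h1 h1', isos_trans h2 h2'⟩, ?_⟩
  rw [Equiv.trans_assoc, h3', ← Equiv.trans_assoc, h3, Equiv.trans_assoc]

lemma card_homs_eq {t t' : Matched} (h : (homs t t').Nonempty) :
    (homs t t').card = (homs t' t').card := by
  obtain ⟨p, hp⟩ := h
  refine card_nbij' (fun q => (p.1.symm.trans q.1, p.2.symm.trans q.2))
    (fun q => (p.1.trans q.1, p.2.trans q.2)) ?_ ?_ ?_ ?_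
  · exact fun q hq => mem_homs_trans (mem_homs_symm hp) hq
  · exact fun q hq => mem_homs_trans hp hq
  · rintro q -
    ext <;> simp
  · rintro q -
    ext <;> simp

lemma sum_card_homs {n : ℕ} {t : Matched} (ht : t ∈ matchedPairs n) :
    ∑ t' ∈ matchedPairs n, (homs t t').card = 4 ^ (n - 1) := by
  obtain ⟨h1, h2⟩ := mem_matchedPairs.mp ht
  simp only [matchedPairs, sum_sigma, homs, card_filter]
  have key : ∀ T S : PTree, ∑ v : Lf T ≃ Lf S, ∑ p ∈ isos t.1 T ×ˢ isos t.2.1 S,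
      (if p.1.trans v = t.2.2.trans p.2 then 1 else 0) = cnt t.1 T * cnt t.2.1 S := by
    intro T S
    rw [sum_comm, ← card_isos, ← card_isos, ← card_product, card_eq_sum_ones]
    refine sum_congr rfl fun p _ => ?_
    rw [sum_eq_single (p.1.symm.trans (t.2.2.trans p.2))]
    · rw [if_pos]
      ext x
      simp
    · intro v _ hv
      rw [if_neg]
      intro h
      apply hv
      rw [← h]
      ext x
      simp
    · simp
  simp only [key, ← sum_mul_sum, sum_cnt, h1, h2, if_true]
  rw [← mul_pow]
  norm_num

lemma equivTriple_iff {n : ℕ} {t t' : Matched} (ht : t ∈ matchedPairs n) :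
    equivTriple n (toTriple t) (toTriple t') = true ↔ (homs t t').Nonempty := by
  obtain ⟨h1, h2⟩ := mem_matchedPairs.mp ht
  simp only [equivTriple, List.any_eq_true, List.all_eq_true, List.mem_range, beq_iff_eq, toTriple]
  constructor
  · rintro ⟨φ, hφ, ψ, hψ, h⟩
    obtain ⟨α, hα, h3⟩ := exists_iso_of_mem_isoFuns hφ
    obtain ⟨β, hβ, h4⟩ := exists_iso_of_mem_isoFuns hψ
    refine ⟨(α, β), mem_homs.mpr ⟨⟨hα, hβ⟩, ?_⟩⟩
    ext x
    have := h (pos t.1 x) (h1 ▸ pos_lt _ _)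
    rw [h3, getD_matchList, getD_matchList, h4] at this
    exact pos_injective _ this
  · rintro ⟨p, hp⟩
    obtain ⟨⟨hα, hβ⟩, h⟩ := mem_homs.mp hp
    obtain ⟨φ, hφ, h3⟩ := exists_mem_isoFuns_of_iso hα
    obtain ⟨ψ, hψ, h4⟩ := exists_mem_isoFuns_of_iso hβ
    refine ⟨φ, hφ, ψ, hψ, fun i hi => ?_⟩
    obtain ⟨x, rfl⟩ : ∃ x, pos t.1 x = i :=
      ⟨(posEquiv t.1).symm ⟨i, h1 ▸ hi⟩, by rw [← posEquiv_val, Equiv.apply_symm_apply]⟩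
    rw [h3, getD_matchList, getD_matchList, h4]
    exact congrArg (pos _) (DFunLike.congr_fun h x)

/-- The class of the tanglegram represented by a matched pair. -/
noncomputable def tangleClass (n : ℕ) (t : Matched) : Finset (PTree × PTree × List ℕ) :=
  (Triples n).filter fun t' => equivTriple n (toTriple t) t' = true

lemma mem_tangleClass {n : ℕ} {t t' : Matched} (ht : t ∈ matchedPairs n)
    (ht' : t' ∈ matchedPairs n) : toTriple t' ∈ tangleClass n t ↔ (homs t t').Nonempty := by
  rw [tangleClass, mem_filter, equivTriple_iff ht, ← image_toTriple]
  exact and_iff_right (mem_image_of_mem _ ht')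

lemma exists_of_mem_tangleClass {n : ℕ} {t : Matched} {x : PTree × PTree × List ℕ}
    (h : x ∈ tangleClass n t) : ∃ t' ∈ matchedPairs n, toTriple t' = x := by
  rw [tangleClass, mem_filter, ← image_toTriple, mem_image] at h
  exact h.1

lemma tangleClass_eq_iff {n : ℕ} {t t' : Matched} (ht : t ∈ matchedPairs n)
    (ht' : t' ∈ matchedPairs n) : tangleClass n t = tangleClass n t' ↔ (homs t t').Nonempty := by
  constructor
  · intro h
    rw [← mem_tangleClass ht ht', h, mem_tangleClass ht' ht']
    exact homs_refl t'
  · rintro ⟨p, hp⟩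
    ext x
    constructor
    · intro hx
      obtain ⟨s, hs, rfl⟩ := exists_of_mem_tangleClass hx
      rw [mem_tangleClass ht hs] at hx
      obtain ⟨q, hq⟩ := hx
      exact (mem_tangleClass ht' hs).mpr ⟨_, mem_homs_trans (mem_homs_symm hp) hq⟩
    · intro hx
      obtain ⟨s, hs, rfl⟩ := exists_of_mem_tangleClass hx
      rw [mem_tangleClass ht' hs] at hx
      obtain ⟨q, hq⟩ := hx
      exact (mem_tangleClass ht hs).mpr ⟨_, mem_homs_trans hp hq⟩

lemma filter_tangleClasses {n : ℕ} {P : PTree → Prop} :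
    (tangleClasses n).filter (fun c => ∃ t ∈ c, P t.1) =
      ((matchedPairs n).filter fun t => P t.1).image (tangleClass n) := by
  ext c
  rw [mem_filter, tangleClasses, ← image_toTriple, image_image, mem_image, mem_image]
  constructor
  · rintro ⟨⟨t, ht, hc⟩, x, hx, hPx⟩
    have hc : tangleClass n t = c := by rw [← hc, tangleClass, ← image_toTriple]; rfl
    subst hc
    obtain ⟨s, hs, rfl⟩ := exists_of_mem_tangleClass hx
    obtain ⟨p, hp⟩ := (mem_tangleClass ht hs).mp hx
    exact ⟨s, mem_filter.mpr ⟨hs, hPx⟩, ((tangleClass_eq_iff ht hs).mpr ⟨p, hp⟩).symm⟩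
  · rintro ⟨t, ht, rfl⟩
    rw [mem_filter] at ht
    exact ⟨⟨t, ht.1, by rw [tangleClass, ← image_toTriple]; rfl⟩, toTriple t,
      (mem_tangleClass ht.1 ht.1).mpr (homs_refl t), ht.2⟩

lemma card_filter_tangleClasses {n : ℕ} {P : PTree → Prop}
    (hP : ∀ T T', (isos T T').Nonempty → P T → P T') :
    ((tangleClasses n).filter fun c => ∃ t ∈ c, P t.1).card * 4 ^ (n - 1) =
      ∑ t ∈ (matchedPairs n).filter fun t => P t.1, (homs t t).card := by
  rw [filter_tangleClasses, ← sum_fiberwise_of_maps_to (g := tangleClass n)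
    (t := ((matchedPairs n).filter fun t => P t.1).image (tangleClass n))
    (fun t ht => mem_image_of_mem _ ht), ← smul_eq_mul, ← sum_const]
  refine sum_congr rfl fun c hc => ?_
  obtain ⟨t, ht, rfl⟩ := mem_image.mp hc
  rw [mem_filter] at ht
  rw [← sum_card_homs ht.1, filter_filter, sum_filter]
  refine sum_congr rfl fun t' ht' => ?_
  split_ifs with h
  · exact card_homs_eq ((tangleClass_eq_iff ht.1 ht').mp h.2.symm)
  · rw [card_eq_zero, ← not_nonempty_iff_eq_empty]
    rintro ⟨p, hp⟩
    exact h ⟨hP _ _ ⟨p.1, (mem_homs.mp hp).1.1⟩ ht.2,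
      ((tangleClass_eq_iff ht.1 ht').mpr ⟨p, hp⟩).symm⟩

/-- The number of matched pairs with left tree `T`, weighted by their automorphisms. -/
noncomputable def weight (n : ℕ) (T : PTree) : ℕ :=
  ∑ S ∈ planeTrees n, ∑ p ∈ isos T T ×ˢ isos S S,
    (univ.filter fun v : Lf T ≃ Lf S => p.1.trans v = v.trans p.2).card

lemma sum_weight (n : ℕ) (P : PTree → Prop) :
    ∑ t ∈ (matchedPairs n).filter (fun t => P t.1), (homs t t).card =
      ∑ T ∈ (planeTrees n).filter P, weight n T := by
  rw [sum_filter, sum_filter, matchedPairs, sum_sigma]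
  refine sum_congr rfl fun T _ => ?_
  split_ifs with h
  · rw [sum_sigma, weight]
    refine sum_congr rfl fun S _ => ?_
    simp only [homs, card_filter]
    rw [sum_comm]
  · simp

lemma tangleProb_eq (n : ℕ) {P : PTree → Prop}
    (hP : ∀ T T', (isos T T').Nonempty → P T → P T') :
    tangleProb n (fun t => P t.1) =
      (∑ T ∈ (planeTrees n).filter P, (weight n T : ℝ)) / ∑ T ∈ planeTrees n, (weight n T : ℝ) := by
  have h1 := (card_filter_tangleClasses (n := n) hP).trans (sum_weight n P)
  obtain ⟨Q, hQ⟩ : ∃ Q : PTree → Prop, ∀ T, Q T := ⟨fun _ => True, fun _ => trivial⟩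
  have h2 := (card_filter_tangleClasses (n := n) (P := Q) fun _ T _ _ => hQ T).trans
    (sum_weight n Q)
  rw [filter_true_of_mem, filter_true_of_mem] at h2
  · rw [tangleProb, numTanglegrams, ← Nat.cast_sum, ← Nat.cast_sum, ← h1, ← h2]
    push_cast
    rw [mul_div_mul_right _ _ (by positivity)]
  · exact fun T _ => hQ T
  · intro c hc
    obtain ⟨x, hx, rfl⟩ := mem_image.mp hc
    rw [← image_toTriple, mem_image] at hx
    obtain ⟨t, ht, rfl⟩ := hx
    exact ⟨toTriple t, (mem_tangleClass ht ht).mpr (homs_refl t), hQ _⟩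

end PTree

namespace PTree
open Finset Nat

lemma doubleFactorial_monotone : Monotone Nat.doubleFactorial := by
  have h : ∀ n : ℕ, n‼ ≤ (n + 1)‼ ∧ (n + 1)‼ ≤ (n + 2)‼ := by
    intro n
    induction n with
    | zero => decide
    | succ n ih =>
      refine ⟨ih.2, ?_⟩
      rw [show n + 1 + 2 = (n + 1) + 2 by rfl, Nat.doubleFactorial_add_two,
        show n + 1 + 1 = n + 2 by rfl, Nat.doubleFactorial_add_two]
      exact Nat.mul_le_mul (by omega) ih.1
  exact monotone_nat_of_le_succ fun n => (h n).1

lemma eq_conj {α β : Type*} {v : α ≃ β} {a : Equiv.Perm α} {b : Equiv.Perm β} (h : a.trans v = v.trans b) :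
    b = (v.symm.trans a).trans v := by
  rw [Equiv.trans_assoc, h]
  ext x
  simp

section Perm
variable {α β : Type*} [Fintype α] [Fintype β]

/-- The number of points moved by a permutation. -/
noncomputable def moved (a : Equiv.Perm α) : ℕ := ∑ x, if a x = x then 0 else 1

lemma moved_eq_card_support (a : Equiv.Perm α) : moved a = a.support.card := by
  rw [moved, Equiv.Perm.support, card_filter]
  exact sum_congr rfl fun x _ => by simp only [ne_eq, ite_not]

lemma moved_le (a : Equiv.Perm α) : moved a ≤ Fintype.card α := by
  rw [moved_eq_card_support]
  exact card_le_univ _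

lemma moved_conj (v : α ≃ β) (a : Equiv.Perm α) : moved ((v.symm.trans a).trans v) = moved a := by
  rw [moved, moved, ← Equiv.sum_comp v]
  simp

lemma card_intertwiners_eq {a : Equiv.Perm α} {b : Equiv.Perm β} {v₀ : α ≃ β}
    (h₀ : a.trans v₀ = v₀.trans b) :
    (univ.filter fun v : α ≃ β => a.trans v = v.trans b).card =
      Nat.card (Subgroup.centralizer {a}) := by
  rw [Nat.card_eq_fintype_card, Fintype.card_subtype]
  refine card_nbij' (fun v => v.trans v₀.symm) (fun c => c.trans v₀) ?_ ?_ ?_ ?_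
  · intro v hv
    simp only [coe_filter, mem_univ, true_and, Set.mem_ofPred_eq,
      Subgroup.mem_centralizer_singleton_iff] at hv ⊢
    ext x
    have h1 := DFunLike.congr_fun hv x
    have h2 := DFunLike.congr_fun h₀ (v₀.symm (v x))
    simp only [Equiv.trans_apply, Equiv.apply_symm_apply] at h1 h2
    simp only [Equiv.Perm.coe_mul, Function.comp_apply, Equiv.trans_apply]
    rw [h1, ← h2, Equiv.symm_apply_apply]
  · intro c hc
    simp only [coe_filter, mem_univ, true_and, Set.mem_ofPred_eq,
      Subgroup.mem_centralizer_singleton_iff] at hc ⊢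
    ext x
    have h1 := DFunLike.congr_fun hc x
    have h2 := DFunLike.congr_fun h₀ (c x)
    simp only [Equiv.trans_apply] at h1 h2
    simp only [Equiv.Perm.coe_mul, Function.comp_apply] at h1
    simp only [Equiv.trans_apply]
    rw [h1, h2]
  · intro v _
    ext x
    simp
  · intro c _
    ext x
    simp

lemma prod_mul_prod_factorial_le (m : Multiset ℕ) (h : ∀ a ∈ m, 2 ≤ a) :
    m.prod * ∏ a ∈ m.toFinset, (m.count a)! ≤ m.sum‼ := by
  induction m using Multiset.induction_on with
  | empty => simp
  | cons a m ih =>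
    have ha := h a (Multiset.mem_cons_self _ _)
    have ih := ih fun b hb => h b (Multiset.mem_cons_of_mem hb)
    have hcount : m.count a * a ≤ m.sum := by
      have h1 : Multiset.replicate (m.count a) a ≤ m := Multiset.le_count_iff_replicate_le.mp le_rfl
      obtain ⟨m', hm'⟩ := Multiset.le_iff_exists_add.mp h1
      have := congrArg Multiset.sum hm'
      rw [Multiset.sum_add, Multiset.sum_replicate, smul_eq_mul] at this
      omega
    have hprod : ∏ b ∈ (a ::ₘ m).toFinset, ((a ::ₘ m).count b)! =
        (m.count a + 1) * ∏ b ∈ m.toFinset, (m.count b)! := by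
      rw [Multiset.toFinset_cons]
      have e : ∏ b ∈ m.toFinset, (m.count b)! = ∏ b ∈ insert a m.toFinset, (m.count b)! := by
        by_cases hm : a ∈ m.toFinset
        · rw [insert_eq_of_mem hm]
        · rw [prod_insert hm, Multiset.count_eq_zero_of_notMem (by simpa using hm)]
          simp
      rw [e, ← mul_prod_erase _ _ (mem_insert_self a _), ← mul_prod_erase _ (fun b => (m.count b)!)
        (mem_insert_self a _), Multiset.count_cons_self, Nat.factorial_succ, mul_assoc]
      congr 2
      refine prod_congr rfl fun b hb => ?_
      rw [Multiset.count_cons_of_ne (ne_of_mem_erase hb)]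
    rw [hprod, Multiset.prod_cons, Multiset.sum_cons]
    obtain ⟨c, rfl⟩ : ∃ c, a = c + 2 := ⟨a - 2, by omega⟩
    calc (c + 2) * m.prod * ((m.count (c + 2) + 1) * ∏ b ∈ m.toFinset, (m.count b)!)
        = (m.count (c + 2) * (c + 2) + (c + 2)) * (m.prod * ∏ b ∈ m.toFinset, (m.count b)!) := by
          ring
      _ ≤ (m.sum + (c + 2)) * (m.sum + c)‼ := by
          gcongr
          exact ih.trans (doubleFactorial_monotone (Nat.le_add_right _ _))
      _ = (c + 2 + m.sum)‼ := by
          rw [show c + 2 + m.sum = (m.sum + c) + 2 by ring, Nat.doubleFactorial_add_two]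
          ring

/-- The number of bijections conjugating `a` to `b` vanishes or is bounded in terms of the number
of moved points. -/
lemma card_intertwiners_le (a : Equiv.Perm α) (b : Equiv.Perm β) :
    (univ.filter fun v : α ≃ β => a.trans v = v.trans b).card ≤
      if moved a = moved b then (Fintype.card α - moved a)! * (moved a)‼ else 0 := by
  by_cases h : ∃ v₀ : α ≃ β, a.trans v₀ = v₀.trans b
  · obtain ⟨v₀, h₀⟩ := h
    rw [if_pos (by rw [eq_conj h₀, moved_conj]), card_intertwiners_eq h₀,
      Equiv.Perm.nat_card_centralizer, moved_eq_card_support, ← Equiv.Perm.sum_cycleType, mul_assoc]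
    exact Nat.mul_le_mul_left _ (prod_mul_prod_factorial_le _ fun _ =>
      Equiv.Perm.two_le_of_mem_cycleType)
  · rw [filter_false_of_mem fun v _ hv => h ⟨v, hv⟩, card_empty]
    exact Nat.zero_le _

lemma cycleType_of_involutive {a : Equiv.Perm α} (h : ∀ x, a (a x) = x) {s : ℕ}
    (hs : moved a = 2 * s) : a.cycleType = Multiset.replicate s 2 := by
  have h2 : a ^ 2 = 1 := by
    ext x
    simp [pow_two, h]
  have : Fact (Nat.Prime 2) := ⟨Nat.prime_two⟩
  have h3 := Equiv.Perm.cycleType_of_pow_prime_eq_one h2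
  have h4 := a.sum_cycleType
  rw [← moved_eq_card_support, hs, h3, Multiset.sum_replicate, smul_eq_mul] at h4
  rw [h3]
  congr 1
  omega

lemma card_intertwiners_involutive {a : Equiv.Perm α} {b : Equiv.Perm β}
    (hcard : Fintype.card α = Fintype.card β) (ha : ∀ x, a (a x) = x) (hb : ∀ x, b (b x) = x)
    {s : ℕ} (has : moved a = 2 * s) (hbs : moved b = 2 * s) :
    (univ.filter fun v : α ≃ β => a.trans v = v.trans b).card =
      (Fintype.card α - 2 * s)! * (2 * s)‼ := by
  have v₀ : α ≃ β := Fintype.equivOfCardEq hcard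
  set b' : Equiv.Perm α := (v₀.trans b).trans v₀.symm with hb'
  have h1 : moved b' = 2 * s := by
    have := moved_conj v₀.symm b
    rw [hbs] at this
    exact this
  have h2 : ∀ x, b' (b' x) = x := by
    intro x
    simp [hb', hb]
  have h3 : IsConj a b' := by
    rw [Equiv.Perm.isConj_iff_cycleType_eq, cycleType_of_involutive ha has,
      cycleType_of_involutive h2 h1]
  obtain ⟨c, hc⟩ := isConj_iff.mp h3
  have h4 : a.trans (c.trans v₀) = (c.trans v₀).trans b := by
    ext x
    have := DFunLike.congr_fun hc (c x)
    simp only [Equiv.Perm.coe_mul, Function.comp_apply, Equiv.Perm.inv_def, Equiv.symm_apply_apply, hb',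
      Equiv.trans_apply] at this
    simp only [Equiv.trans_apply, this, Equiv.apply_symm_apply]
  rw [Nat.doubleFactorial_two_mul, card_intertwiners_eq h4, Equiv.Perm.nat_card_centralizer, cycleType_of_involutive ha has,
    Multiset.sum_replicate, Multiset.prod_replicate, smul_eq_mul, mul_comm s 2, mul_assoc]
  congr 2
  rcases Nat.eq_zero_or_pos s with rfl | hs
  · simp
  · rw [Multiset.toFinset_replicate, if_neg hs.ne', prod_singleton, Multiset.count_replicate_self]

end Perm
end PTree

namespace PTree
open Finset Nat

lemma moved_glue {l r : PTree} (p : (Lf l ≃ Lf l) × (Lf r ≃ Lf r)) :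
    moved (glue p) = moved p.1 + moved p.2 := by
  rw [moved, sum_lf_node]
  congr 1
  · refine sum_congr rfl fun x _ => ?_
    exact if_congr Sum.inl_injective.eq_iff rfl rfl
  · refine sum_congr rfl fun x _ => ?_
    exact if_congr Sum.inr_injective.eq_iff rfl rfl

lemma moved_glueSwap {l r : PTree} (p : (Lf l ≃ Lf r) × (Lf r ≃ Lf l)) :
    moved (glueSwap p : Lf (node l r) ≃ Lf (node l r)) = size l + size r := by
  rw [moved, sum_lf_node, ← card_lf l, ← card_lf r, Fintype.card_eq_sum_ones,
    Fintype.card_eq_sum_ones]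
  congr 1
  · exact sum_congr rfl fun x _ => if_neg Sum.inr_ne_inl
  · exact sum_congr rfl fun x _ => if_neg Sum.inl_ne_inr

/-- The number of automorphisms of a plane tree moving exactly `k` leaves. -/
noncomputable def autMoved (T : PTree) (k : ℕ) : ℕ := ((isos T T).filter fun e => moved e = k).card

lemma autMoved_eq_sum (T : PTree) (k : ℕ) :
    autMoved T k = ∑ e ∈ isos T T, if moved e = k then 1 else 0 := card_filter _ _

/-- The generating polynomial of the automorphisms of a plane tree by moved leaves. -/
noncomputable def autPoly {R : Type*} [CommSemiring R] (q : R) (T : PTree) : R :=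
  ∑ e ∈ isos T T, q ^ moved e

lemma autPoly_eq_sum {R : Type*} [CommSemiring R] (q : R) {n : ℕ} {T : PTree} (hT : size T = n) :
    autPoly q T = ∑ k ∈ Finset.range (n + 1), (autMoved T k : R) * q ^ k := by
  have hm : ∀ e ∈ isos T T, moved e ∈ Finset.range (n + 1) := by
    intro e _
    have := moved_le e
    rw [card_lf, hT] at this
    exact Finset.mem_range.mpr (by omega)
  rw [autPoly, ← sum_fiberwise_of_maps_to hm]
  refine sum_congr rfl fun k _ => ?_
  rw [autMoved, ← nsmul_eq_mul, ← sum_const]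
  exact sum_congr rfl fun e he => by rw [(mem_filter.mp he).2]

lemma autPoly_leaf {R : Type*} [CommSemiring R] (q : R) : autPoly q leaf = 1 := by
  rw [autPoly, isos, sum_singleton, moved]
  simp

lemma autPoly_node {R : Type*} [CommSemiring R] (q : R) (l r : PTree) :
    autPoly q (node l r) = autPoly q l * autPoly q r +
      if normalize l = normalize r then 4 ^ gens l * q ^ (2 * size l) else 0 := by
  rw [autPoly, sum_isos_node]
  congr 1
  · simp only [moved_glue, pow_add]
    rw [sum_product, autPoly, autPoly, sum_mul_sum]
  · simp only [moved_glueSwap, sum_const, card_product, card_isos, cnt_eq, nsmul_eq_mul]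
    split_ifs with h1 h2 h2
    · rw [gens_eq_of_normalize_eq h1, size_eq_of_normalize_eq h1, ← two_mul,
        show (4 : R) = 2 * 2 by norm_num, mul_pow]
      push_cast
      ring
    · exact absurd h1.symm h2
    · simp
    · simp

/-- The number of involutive automorphisms of a plane tree moving exactly `2 * s` leaves. -/
noncomputable def invMoved (T : PTree) (s : ℕ) : ℕ :=
  ((isos T T).filter fun e => (∀ x, e (e x) = x) ∧ moved e = 2 * s).card

lemma invMoved_eq_sum (T : PTree) (s : ℕ) : invMoved T s =
    ∑ e ∈ isos T T, if (∀ x, e (e x) = x) ∧ moved e = 2 * s then 1 else 0 := card_filter _ _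

lemma invMoved_le_autMoved (T : PTree) (s : ℕ) : invMoved T s ≤ autMoved T (2 * s) :=
  card_le_card fun e he => by
    rw [mem_filter] at he ⊢
    exact ⟨he.1, he.2.2⟩

lemma one_le_invMoved_zero (T : PTree) : 1 ≤ invMoved T 0 :=
  card_pos.mpr ⟨Equiv.refl _, mem_filter.mpr ⟨isos_refl T, fun _ => rfl, by simp [moved]⟩⟩

lemma sum_invMoved_le (l r : PTree) (s : ℕ) :
    ∑ p ∈ antidiagonal s, invMoved l p.1 * invMoved r p.2 ≤ invMoved (node l r) s := by
  simp only [invMoved, ← card_product]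
  rw [← card_sigma]
  refine card_le_card_of_injOn (fun x => glue x.2) ?_ ?_
  · rintro ⟨⟨i, j⟩, u, w⟩ h
    simp only [coe_sigma, Set.mem_sigma_iff, mem_coe, HasAntidiagonal.mem_antidiagonal, mem_product,
      mem_filter] at h
    obtain ⟨hij, ⟨h1, h2, h3⟩, h4, h5, h6⟩ := h
    rw [mem_coe, mem_filter]
    refine ⟨mem_isos_node.mpr (.inl ⟨u, h1, w, h4, rfl⟩), ?_, ?_⟩
    · rintro (x | x)
      · exact congrArg Sum.inl (h2 x)
      · exact congrArg Sum.inr (h5 x)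
    · rw [moved_glue, h3, h6, ← mul_add, hij]
  · rintro ⟨⟨i, j⟩, p⟩ h ⟨⟨i', j'⟩, p'⟩ h' heq
    obtain rfl : p = p' := glue_injective heq
    simp only [coe_sigma, Set.mem_sigma_iff, mem_coe, mem_product, mem_filter] at h h'
    have e1 : i = i' := by have := h.2.1.2.2.symm.trans h'.2.1.2.2; omega
    have e2 : j = j' := by have := h.2.2.2.2.symm.trans h'.2.2.2.2; omega
    rw [e1, e2]

lemma choose_cherries_le : ∀ (T : PTree) (s : ℕ), (cherries T).choose s ≤ invMoved T s
  | leaf, 0 => one_le_invMoved_zero _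
  | leaf, s + 1 => Nat.zero_le _
  | node leaf leaf, 0 => one_le_invMoved_zero _
  | node leaf leaf, 1 => card_pos.mpr ⟨glueSwap (Equiv.refl _, Equiv.refl _), mem_filter.mpr
      ⟨mem_isos_node.mpr (.inr ⟨_, isos_refl _, _, isos_refl _, rfl⟩),
        by rintro (x | x) <;> rfl, moved_glueSwap _⟩⟩
  | node leaf leaf, s + 2 => Nat.zero_le _
  | node (node a b) r, s => by
    refine le_trans ?_ (sum_invMoved_le _ _ s)
    rw [show cherries (node (node a b) r) = cherries (node a b) + cherries r by simp [cherries],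
      Nat.add_choose_eq]
    exact sum_le_sum fun p _ => Nat.mul_le_mul (choose_cherries_le _ _) (choose_cherries_le _ _)
  | node leaf (node a b), s => by
    refine le_trans ?_ (sum_invMoved_le _ _ s)
    rw [show cherries (node leaf (node a b)) = cherries leaf + cherries (node a b) by simp [cherries],
      Nat.add_choose_eq]
    exact sum_le_sum fun p _ => Nat.mul_le_mul (choose_cherries_le _ _) (choose_cherries_le _ _)

lemma weight_le {n : ℕ} {T : PTree} (hT : T ∈ planeTrees n) :
    weight n T ≤ ∑ k ∈ Finset.range (n + 1), (n - k)! * k‼ * autMoved T k *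
      ∑ S ∈ planeTrees n, autMoved S k := by
  have hn := mem_planeTrees.mp hT
  simp only [mul_sum]
  rw [sum_comm, weight]
  refine sum_le_sum fun S _ => ?_
  simp only [autMoved_eq_sum, mul_sum, sum_mul]
  rw [sum_comm, sum_product_right]
  refine sum_le_sum fun b _ => ?_
  rw [sum_comm]
  refine sum_le_sum fun a _ => (card_intertwiners_le a b).trans (le_of_eq ?_)
  have hm := moved_le a
  rw [card_lf, hn] at *
  rw [sum_eq_single_of_mem (moved a) (Finset.mem_range.mpr (by omega))]
  · simp only [if_true, mul_one, mul_ite, mul_zero]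
    exact if_congr eq_comm rfl rfl
  · intro k _ hk
    rw [if_neg hk.symm]
    simp

lemma le_weight {n : ℕ} {T : PTree} (hT : T ∈ planeTrees n) :
    ∑ s ∈ Finset.range (n + 1), (n - 2 * s)! * (2 * s)‼ * (cherries T).choose s *
      ∑ S ∈ planeTrees n, (cherries S).choose s ≤ weight n T := by
  have hn := mem_planeTrees.mp hT
  calc _ ≤ ∑ s ∈ Finset.range (n + 1), (n - 2 * s)! * (2 * s)‼ * invMoved T s *
      ∑ S ∈ planeTrees n, invMoved S s := by
        gcongr <;> exact choose_cherries_le _ _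
    _ ≤ _ := by
      simp only [mul_sum]
      rw [sum_comm, weight]
      refine sum_le_sum fun S hS => ?_
      simp only [invMoved_eq_sum, mul_sum, sum_mul]
      rw [sum_comm, sum_product_right]
      refine sum_le_sum fun b _ => ?_
      rw [sum_comm]
      refine sum_le_sum fun a _ => ?_
      by_cases h : ∃ s, ((∀ x, a (a x) = x) ∧ moved a = 2 * s) ∧ (∀ x, b (b x) = x) ∧ moved b = 2 * s
      · obtain ⟨s, ⟨h1, h2⟩, h3, h4⟩ := h
        rw [card_intertwiners_involutive (by rw [card_lf, card_lf, hn, mem_planeTrees.mp hS])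
          h1 h3 h2 h4, card_lf, hn]
        have hm := moved_le a
        rw [card_lf, hn] at hm
        rw [sum_eq_single_of_mem s (Finset.mem_range.mpr (by omega)), if_pos ⟨h1, h2⟩,
          if_pos ⟨h3, h4⟩, mul_one, mul_one]
        intro k _ hk
        rw [if_neg (c := _ ∧ moved a = 2 * k) (by omega)]
        simp
      · rw [sum_eq_zero]
        · exact Nat.zero_le _
        · intro s _
          by_cases h1 : (∀ x, a (a x) = x) ∧ moved a = 2 * s
          · rw [if_neg fun h2 => h ⟨s, h1, h2⟩]
            simp
          · rw [if_neg h1]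
            simp

end PTree

namespace PTree
open Finset PowerSeries Filter Topology

/-- The average of a statistic over the plane trees with `n` leaves. -/
noncomputable def avg (n : ℕ) (f : PTree → ℝ) : ℝ := (∑ T ∈ planeTrees n, f T) / (planeTrees n).card

/-- The weight of a symmetric vertex with branch `l` in `autPoly q`. -/
noncomputable def swapWeight (q : ℂ) (l : PTree) : ℂ := 4 ^ gens l * q ^ (2 * size l)

lemma gf_autPoly (q : ℂ) : gf (autPoly q) =
    X + gf (autPoly q) ^ 2 + PowerSeries.mk (symCoeff (swapWeight q)) :=
  gf_eq_symCoeff _ _ (autPoly_leaf q) (autPoly_node q)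

lemma norm_symCoeff_swapWeight_le (q : ℂ) (m : ℕ) :
    ‖symCoeff (swapWeight q) (2 * m)‖ ≤ 16 ^ (m - 1) * ‖q‖ ^ (2 * m) := by
  rw [symCoeff_two_mul]
  calc _ ≤ ∑ l ∈ planeTrees m, (2 : ℝ) ^ (m - 1) * 2 ^ (m - 1) * ‖q‖ ^ (2 * m) := by
        refine (norm_sum_le _ _).trans (sum_le_sum fun l hl => ?_)
        have hs := mem_planeTrees.1 hl
        have hg := gens_lt_size l
        have e : swapWeight q l * (2 ^ (m - 1) / 2 ^ gens l) =
            2 ^ gens l * 2 ^ (m - 1) * q ^ (2 * m) := by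
          have h2 : (2 : ℂ) ^ gens l ≠ 0 := pow_ne_zero _ two_ne_zero
          rw [swapWeight, hs, show (4 : ℂ) = 2 * 2 by norm_num, mul_pow]
          field_simp
        rw [e, norm_mul, norm_mul, norm_pow, norm_pow, norm_pow, Complex.norm_ofNat]
        gcongr
        · norm_num
        · omega
    _ = ((planeTrees m).card : ℝ) * ((2 : ℝ) ^ (m - 1) * 2 ^ (m - 1) * ‖q‖ ^ (2 * m)) := by
        rw [sum_const, nsmul_eq_mul]
    _ ≤ (4 : ℝ) ^ (m - 1) * ((2 : ℝ) ^ (m - 1) * 2 ^ (m - 1) * ‖q‖ ^ (2 * m)) := by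
        gcongr
        exact_mod_cast card_planeTrees_le_pow m
    _ = _ := by
        rw [show (16 : ℝ) = 4 * (2 * 2) by norm_num, mul_pow, mul_pow]
        ring

lemma symCoeff_of_odd (c : PTree → ℂ) {j : ℕ} (hj : ¬ Even j) : symCoeff c j = 0 := if_neg hj

lemma norm_symCoeff_swapWeight_le' {q : ℂ} (hq : ‖q‖ ^ 2 ≤ 1 / 2) (j : ℕ) :
    ‖symCoeff (swapWeight q) j‖ ≤ ‖q‖ ^ 2 * 3 ^ j := by
  by_cases hj : Even j
  swap
  · rw [symCoeff_of_odd _ hj, norm_zero]; positivity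
  obtain ⟨m, rfl⟩ := hj
  rw [← two_mul]
  rcases m with _ | m
  · rw [mul_zero, symCoeff_zero, norm_zero]; positivity
  refine (norm_symCoeff_swapWeight_le q _).trans ?_
  rw [pow_mul, pow_mul, pow_succ (‖q‖ ^ 2), Nat.add_sub_cancel]
  calc (16 : ℝ) ^ m * ((‖q‖ ^ 2) ^ m * ‖q‖ ^ 2) ≤ 16 ^ m * ((1 / 2) ^ m * ‖q‖ ^ 2) := by gcongr
    _ = ‖q‖ ^ 2 * 8 ^ m := by rw [← mul_assoc, ← mul_pow]; norm_num [mul_comm]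
    _ ≤ ‖q‖ ^ 2 * 9 ^ (m + 1) := by
        gcongr
        calc (8 : ℝ) ^ m ≤ 9 ^ m := by gcongr; norm_num
          _ ≤ 9 ^ (m + 1) := by gcongr <;> norm_num
    _ = _ := by norm_num

lemma norm_symCoeff_swapWeight_le_of_ne {q : ℂ} (hq : ‖q‖ ≤ 1) {j : ℕ} (hj2 : j ≠ 2) :
    ‖symCoeff (swapWeight q) j‖ ≤ ‖q‖ ^ 4 * 16 ^ j := by
  by_cases hj : Even j
  swap
  · rw [symCoeff_of_odd _ hj, norm_zero]; positivity
  obtain ⟨m, rfl⟩ := hj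
  rw [← two_mul]
  rcases m with _ | m
  · rw [mul_zero, symCoeff_zero, norm_zero]; positivity
  refine (norm_symCoeff_swapWeight_le q _).trans ?_
  rw [mul_comm]
  gcongr ?_ * ?_
  · exact pow_le_pow_of_le_one (norm_nonneg _) hq (by omega)
  · exact pow_le_pow_right₀ (by norm_num) (by omega)

lemma symCoeff_swapWeight_two (q : ℂ) : symCoeff (swapWeight q) 2 = q ^ 2 := by
  have h1 : planeTrees 1 = {leaf} := by simp [planeTrees]
  have := symCoeff_two_mul (swapWeight q) 1
  rw [mul_one] at this
  rw [this, h1, sum_singleton]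
  simp [swapWeight, gens, size]

lemma ofReal_avg (n : ℕ) (f : PTree → ℝ) :
    ((avg n f : ℝ) : ℂ) = coeff n (gf fun T => (f T : ℂ)) / ((planeTrees n).card : ℂ) := by
  rw [avg, coeff_gf]
  push_cast
  rfl

lemma ofReal_autPoly (q : ℝ) (T : PTree) : ((autPoly q T : ℝ) : ℂ) = autPoly (q : ℂ) T := by
  simp [autPoly]

lemma exists_avg_autPoly_le : ∃ δ : ℝ, 0 < δ ∧ ∀ (n : ℕ) (q : ℝ), 1 ≤ n → q ^ 2 ≤ δ →
    avg n (autPoly q) ≤ 2 * Real.exp (80 * q ^ 2 * n) := by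
  obtain ⟨ε₀, hε₀, h⟩ := exists_norm_coeff_le
  refine ⟨min ε₀ (1 / 2), by positivity, fun n q hn hq => ?_⟩
  have hq1 := hq.trans (min_le_left _ _)
  have hq2 := hq.trans (min_le_right _ _)
  have hnorm : ‖(q : ℂ)‖ ^ 2 = q ^ 2 := by rw [Complex.norm_real, Real.norm_eq_abs, sq_abs]
  have hC : (0 : ℝ) < (planeTrees n).card := by exact_mod_cast card_planeTrees_pos hn
  have := h (symCoeff (swapWeight q)) (q ^ 2) (gf (autPoly (q : ℂ))) hq1 (fun j => by
    have := norm_symCoeff_swapWeight_le' (q := (q : ℂ)) (hnorm ▸ hq2) j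
    rwa [hnorm] at this) (symCoeff_zero _) (coeff_zero_gf _) (gf_autPoly _) n hn
  have e : ‖((avg n (autPoly q) : ℝ) : ℂ)‖ ≤ 2 * Real.exp (80 * q ^ 2 * n) := by
    rw [ofReal_avg, norm_div, Complex.norm_natCast, div_le_iff₀ hC]
    simp only [ofReal_autPoly]
    refine this.trans (le_of_eq ?_)
    ring
  rw [Complex.norm_real] at e
  exact (le_abs_self _).trans e

lemma tendsto_avg_autPoly (t : ℝ) : Tendsto (fun n : ℕ => avg n (autPoly (t / Real.sqrt n))) atTop
    (𝓝 (Real.exp (t ^ 2 / 4))) := by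
  have hnorm : ∀ n : ℕ, ‖((t / Real.sqrt n : ℝ) : ℂ)‖ ^ 2 = t ^ 2 / n := fun n => by
    rw [Complex.norm_real, Real.norm_eq_abs, sq_abs, div_pow, Real.sq_sqrt (Nat.cast_nonneg n)]
  have hlim0 : Tendsto (fun n : ℕ => t ^ 2 / n) atTop (𝓝 0) :=
    tendsto_const_div_atTop_nhds_zero_nat _
  have hsmall : ∀ᶠ n : ℕ in atTop, t ^ 2 / n ≤ 1 / 2 :=
    hlim0.eventually (Iic_mem_nhds (by norm_num))
  have key := tendsto_coeff_div_card
    (φ := fun n => symCoeff (swapWeight ((t / Real.sqrt n : ℝ) : ℂ)))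
    (G := fun n => gf (autPoly ((t / Real.sqrt n : ℝ) : ℂ))) (c := t ^ 2) (a := (t : ℂ) ^ 2)
    (by
      filter_upwards [hsmall] with n hn j
      rw [← hnorm] at hn ⊢
      exact norm_symCoeff_swapWeight_le' hn j)
    (.of_forall fun n => symCoeff_zero _) (.of_forall fun n => coeff_zero_gf _)
    (.of_forall fun n => gf_autPoly _) ?_
  · have e : Complex.exp ((t : ℂ) ^ 2 / 4) = ((Real.exp (t ^ 2 / 4) : ℝ) : ℂ) := by push_cast; rfl
    rw [e] at key
    have := (Complex.continuous_re.tendsto _).comp key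
    rw [Complex.ofReal_re] at this
    refine this.congr fun n => ?_
    have := ofReal_avg n (autPoly (t / Real.sqrt n))
    simp only [ofReal_autPoly] at this
    simp only [Function.comp]
    rw [← this, Complex.ofReal_re]
  · intro j
    split_ifs with hj
    · subst hj
      refine tendsto_const_nhds.congr' ?_
      filter_upwards [eventually_ge_atTop 1] with n hn
      have hn' : (n : ℝ) ≠ 0 := by positivity
      have : (t : ℝ) ^ 2 = n * (t / Real.sqrt n) ^ 2 := by
        rw [div_pow, Real.sq_sqrt (Nat.cast_nonneg n)]
        field_simp
      rw [symCoeff_swapWeight_two]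
      exact_mod_cast this
    · have h0 : Tendsto (fun n : ℕ => t ^ 2 * (t ^ 2 / n) * 16 ^ j) atTop (𝓝 0) := by
        simpa using (hlim0.const_mul (t ^ 2)).mul_const (16 ^ j)
      refine squeeze_zero_norm' ?_ h0
      filter_upwards [hsmall, eventually_ge_atTop 1] with n hn h1
      have hn' : (0 : ℝ) < n := by exact_mod_cast h1
      have hq1 : ‖((t / Real.sqrt n : ℝ) : ℂ)‖ ≤ 1 := by
        rw [← hnorm] at hn
        nlinarith [norm_nonneg ((t / Real.sqrt n : ℝ) : ℂ)]
      rw [norm_mul, Complex.norm_natCast]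
      calc _ ≤ n * (‖((t / Real.sqrt n : ℝ) : ℂ)‖ ^ 4 * 16 ^ j) := by
            gcongr
            exact norm_symCoeff_swapWeight_le_of_ne hq1 hj
        _ = n * ((t ^ 2 / n) ^ 2 * 16 ^ j) := by rw [← hnorm]; ring
        _ = _ := by field_simp

lemma gf_pow_cherries (y : ℂ) : gf (fun T => (1 + y) ^ cherries T) =
    X + gf (fun T => (1 + y) ^ cherries T) ^ 2 + PowerSeries.mk fun j => if j = 2 then y else 0 := by
  refine (gf_eq (fun T => (1 + y) ^ cherries T)
    (fun l r => if l = leaf ∧ r = leaf then y else 0) (by simp [cherries]) ?_).trans ?_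
  · intro l r
    rcases l with _ | ⟨l₁, l₂⟩ <;> rcases r with _ | ⟨r₁, r₂⟩ <;> simp [cherries, pow_add]
  · congr 2
    funext n
    have h1 : planeTrees 1 = {leaf} := by simp [planeTrees]
    have hz : ∀ p ∈ antidiagonal n, p ≠ (1, 1) → (∑ l ∈ planeTrees p.1, ∑ r ∈ planeTrees p.2,
        if l = leaf ∧ r = leaf then y else 0) = 0 := by
      intro p _ hp
      refine sum_eq_zero fun l hl => sum_eq_zero fun r hr => if_neg ?_
      rintro ⟨rfl, rfl⟩
      rw [mem_planeTrees] at hl hr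
      exact hp (Prod.ext hl.symm hr.symm)
    split_ifs with hn
    · subst hn
      rw [sum_eq_single (1, 1) hz (fun h => absurd (by simp) h)]
      simp [h1]
    · refine sum_eq_zero fun p hp => hz p hp ?_
      rintro rfl
      rw [HasAntidiagonal.mem_antidiagonal] at hp
      omega

lemma tendsto_avg_cherries {y : ℕ → ℝ} {a : ℝ} (hy : Tendsto (fun n : ℕ => n * y n) atTop (𝓝 a)) :
    Tendsto (fun n : ℕ => avg n fun T => (1 + y n) ^ cherries T) atTop (𝓝 (Real.exp (a / 4))) := by
  have hb : ∀ᶠ n : ℕ in atTop, |n * y n| ≤ |a| + 1 :=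
    hy.abs.eventually (Iic_mem_nhds (by linarith))
  have key := tendsto_coeff_div_card (φ := fun n j => if j = 2 then (y n : ℂ) else 0)
    (G := fun n => gf fun T => (1 + (y n : ℂ)) ^ cherries T) (c := |a| + 1) (a := (a : ℂ))
    (by
      filter_upwards [hb, eventually_ge_atTop 1] with n hn h1 j
      have hn' : (0 : ℝ) < n := by exact_mod_cast h1
      split_ifs with hj
      · subst hj
        rw [abs_mul, Nat.abs_cast] at hn
        have h2 : |y n| ≤ (|a| + 1) / n := by
          rw [le_div_iff₀ hn']; linarith
        rw [Complex.norm_real, Real.norm_eq_abs]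
        nlinarith [abs_nonneg (y n)]
      · rw [norm_zero]; positivity)
    (.of_forall fun n => by simp) (.of_forall fun n => coeff_zero_gf _)
    (.of_forall fun n => gf_pow_cherries _) ?_
  · have e : Complex.exp ((a : ℂ) / 4) = ((Real.exp (a / 4) : ℝ) : ℂ) := by push_cast; rfl
    rw [e] at key
    have := (Complex.continuous_re.tendsto _).comp key
    rw [Complex.ofReal_re] at this
    refine this.congr fun n => ?_
    have := ofReal_avg n (fun T => (1 + y n) ^ cherries T)
    push_cast at this
    simp only [Function.comp]
    rw [← this, Complex.ofReal_re]
  · intro j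
    split_ifs with hj
    · have := (Complex.continuous_ofReal.tendsto _).comp hy
      refine this.congr fun n => ?_
      simp
    · simp

end PTree

namespace PTree
open Finset PowerSeries Filter Topology

/-- The ratio `(n - k)! k‼ / n!`. -/
noncomputable def ratio (n k : ℕ) : ℝ := ((n - k).factorial * k.doubleFactorial : ℕ) / n.factorial

lemma ratio_nonneg (n k : ℕ) : 0 ≤ ratio n k := by unfold ratio; positivity

lemma ratio_zero (n : ℕ) : ratio n 0 = 1 := by
  rw [ratio]
  simp [Nat.factorial_ne_zero]

lemma pow_mul_factorial_le {n k : ℕ} (h : k ≤ n) :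
    n ^ k * k.factorial ≤ k ^ k * n.descFactorial k := by
  have e : ∀ a : ℕ, a ^ k = ∏ _i ∈ Finset.range k, a := fun a => by simp
  rw [← Nat.descFactorial_self k, Nat.descFactorial_eq_prod_range k, Nat.descFactorial_eq_prod_range n,
    e n, e k, ← prod_mul_distrib, ← prod_mul_distrib]
  refine prod_le_prod' fun i hi => ?_
  have hi := Finset.mem_range.mp hi
  obtain ⟨d, rfl⟩ := Nat.exists_eq_add_of_le h
  obtain ⟨j, rfl⟩ := Nat.exists_eq_add_of_lt hi
  rw [show i + j + 1 - i = j + 1 by omega, show i + j + 1 + d - i = j + 1 + d by omega]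
  nlinarith [Nat.zero_le (i * d)]

lemma ratio_mul_pow_le {n k : ℕ} (h : k ≤ n) :
    ratio n k * (n : ℝ) ^ k ≤ Real.exp k * k.doubleFactorial := by
  have h1 : ((n - k).factorial : ℝ) * n.descFactorial k = n.factorial := by
    exact_mod_cast Nat.factorial_mul_descFactorial h
  have h2 : (n : ℝ) ^ k * k.factorial ≤ (k : ℝ) ^ k * n.descFactorial k := by
    exact_mod_cast pow_mul_factorial_le h
  have h3 := Real.pow_div_factorial_le_exp (x := k) (Nat.cast_nonneg k) k
  rw [div_le_iff₀ (by positivity)] at h3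
  have hd : (0 : ℝ) < n.descFactorial k := by exact_mod_cast Nat.descFactorial_pos.mpr h
  have hf : (0 : ℝ) < (n - k).factorial := by positivity
  have hk : (0 : ℝ) < k.factorial := by positivity
  have h4 : (n : ℝ) ^ k ≤ Real.exp k * n.descFactorial k := by
    refine le_of_mul_le_mul_right ?_ hk
    calc _ ≤ (k : ℝ) ^ k * n.descFactorial k := h2
      _ ≤ (Real.exp k * k.factorial) * n.descFactorial k := by gcongr
      _ = _ := by ring
  rw [ratio, ← h1]
  push_cast
  rw [div_mul_eq_mul_div, div_le_iff₀ (by positivity)]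
  calc _ ≤ ((n - k).factorial : ℝ) * k.doubleFactorial * (Real.exp k * n.descFactorial k) := by gcongr
    _ = _ := by ring

lemma factorial_succ_le_pow (k : ℕ) : (k + 1).factorial ≤ (k + 1) ^ k := by
  induction k with
  | zero => simp
  | succ k ih =>
    rw [Nat.factorial_succ, pow_succ, mul_comm]
    gcongr
    exact ih.trans (Nat.pow_le_pow_left (by omega) _)

lemma doubleFactorial_le_pow (k : ℕ) : (k.doubleFactorial : ℝ) ≤ Real.sqrt (2 * k) ^ k := by
  rcases Nat.eq_zero_or_pos k with rfl | hk
  · simp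
  have h1 : k.doubleFactorial ^ 2 ≤ (2 * k) ^ k := by
    calc _ = k.doubleFactorial * k.doubleFactorial := sq _
      _ ≤ (k + 1).doubleFactorial * k.doubleFactorial := by
        gcongr
        exact doubleFactorial_monotone (Nat.le_succ k)
      _ = (k + 1).factorial := (Nat.factorial_eq_mul_doubleFactorial k).symm
      _ ≤ (k + 1) ^ k := factorial_succ_le_pow k
      _ ≤ _ := Nat.pow_le_pow_left (by omega) _
  refine (pow_le_pow_iff_left₀ (by positivity) (by positivity) two_ne_zero).mp ?_
  rw [← pow_mul, mul_comm k 2, pow_mul, Real.sq_sqrt (by positivity)]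
  exact_mod_cast h1

section avg

lemma avg_congr {n : ℕ} {f g : PTree → ℝ} (h : ∀ T ∈ planeTrees n, f T = g T) : avg n f = avg n g := by
  rw [avg, avg, sum_congr rfl h]

lemma avg_mono {n : ℕ} {f g : PTree → ℝ} (h : ∀ T ∈ planeTrees n, f T ≤ g T) : avg n f ≤ avg n g := by
  rw [avg, avg]
  gcongr with T hT
  exact h T hT

lemma avg_nonneg {n : ℕ} {f : PTree → ℝ} (h : ∀ T ∈ planeTrees n, 0 ≤ f T) : 0 ≤ avg n f :=
  div_nonneg (sum_nonneg h) (Nat.cast_nonneg _)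

lemma avg_const {n : ℕ} (hn : 1 ≤ n) (a : ℝ) : avg n (fun _ => a) = a := by
  have hC : (0 : ℝ) < (planeTrees n).card := by exact_mod_cast card_planeTrees_pos hn
  rw [avg, sum_const, nsmul_eq_mul]
  field_simp

lemma avg_add (n : ℕ) (f g : PTree → ℝ) : avg n (fun T => f T + g T) = avg n f + avg n g := by
  rw [avg, avg, avg, sum_add_distrib, add_div]

lemma avg_sub (n : ℕ) (f g : PTree → ℝ) : avg n (fun T => f T - g T) = avg n f - avg n g := by
  rw [avg, avg, avg, sum_sub_distrib, sub_div]

lemma avg_const_mul (n : ℕ) (a : ℝ) (f : PTree → ℝ) : avg n (fun T => a * f T) = a * avg n f := by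
  rw [avg, avg, ← mul_sum, mul_div_assoc]

lemma avg_mul_const (n : ℕ) (a : ℝ) (f : PTree → ℝ) : avg n (fun T => f T * a) = avg n f * a := by
  rw [avg, avg, ← sum_mul, div_mul_eq_mul_div]

lemma avg_sum {ι : Type*} (n : ℕ) (s : Finset ι) (f : ι → PTree → ℝ) :
    avg n (fun T => ∑ i ∈ s, f i T) = ∑ i ∈ s, avg n (f i) := by
  simp only [avg]
  rw [sum_comm, sum_div]

lemma abs_avg_le (n : ℕ) (f : PTree → ℝ) : |avg n f| ≤ avg n fun T => |f T| := by
  rw [avg, avg, abs_div, Nat.abs_cast]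
  gcongr
  exact abs_sum_le_sum_abs _ _

lemma sq_avg_le (n : ℕ) (f : PTree → ℝ) : avg n f ^ 2 ≤ avg n fun T => f T ^ 2 := by
  rcases Nat.eq_zero_or_pos (planeTrees n).card with h0 | h0
  · simp [avg, h0]
  have hC : (0 : ℝ) < (planeTrees n).card := by exact_mod_cast h0
  rw [avg, avg, div_pow, div_le_div_iff₀ (by positivity) hC]
  have := sq_sum_le_card_mul_sum_sq (s := planeTrees n) (f := f)
  nlinarith

end avg

/-- Average number of automorphisms moving `k` leaves. -/
noncomputable def avgMoved (n k : ℕ) : ℝ := avg n fun T => autMoved T k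

/-- Average of a binomial moment of the number of cherries. -/
noncomputable def avgChoose (n s : ℕ) : ℝ := avg n fun T => (cherries T).choose s

lemma avgMoved_nonneg (n k : ℕ) : 0 ≤ avgMoved n k := avg_nonneg fun _ _ => Nat.cast_nonneg _

lemma avgChoose_nonneg (n s : ℕ) : 0 ≤ avgChoose n s := avg_nonneg fun _ _ => Nat.cast_nonneg _

lemma avgChoose_le_avgMoved (n s : ℕ) : avgChoose n s ≤ avgMoved n (2 * s) :=
  avg_mono fun T _ => by
    exact_mod_cast (choose_cherries_le T s).trans (invMoved_le_autMoved T s)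

lemma two_mul_cherries_le (T : PTree) : 2 * cherries T ≤ size T := by
  have h := (choose_cherries_le T (cherries T)).trans (invMoved_le_autMoved T _)
  rw [Nat.choose_self] at h
  obtain ⟨e, he⟩ := card_pos.mp h
  rw [← (mem_filter.mp he).2, ← card_lf T]
  exact moved_le e

lemma cherries_le {n : ℕ} {T : PTree} (hT : T ∈ planeTrees n) : cherries T ≤ n / 2 := by
  have := two_mul_cherries_le T
  rw [mem_planeTrees.1 hT] at this
  omega

lemma avg_autPoly_eq (n : ℕ) (q : ℝ) :
    avg n (autPoly q) = ∑ k ∈ Finset.range (n + 1), avgMoved n k * q ^ k := by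
  rw [avg_congr fun T hT => autPoly_eq_sum q (mem_planeTrees.1 hT), avg_sum]
  simp only [avg_mul_const, avgMoved]

lemma avg_pow_cherries_eq (n : ℕ) (y : ℝ) : avg n (fun T => (1 + y) ^ cherries T) =
    ∑ s ∈ Finset.range (n / 2 + 1), avgChoose n s * y ^ s := by
  have h : ∀ T ∈ planeTrees n, (1 + y) ^ cherries T =
      ∑ s ∈ Finset.range (n / 2 + 1), ((cherries T).choose s : ℝ) * y ^ s := by
    intro T hT
    have hc := cherries_le hT
    rw [add_comm, add_pow]
    simp only [one_pow, mul_one]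
    rw [← sum_subset (Finset.range_mono (show cherries T + 1 ≤ n / 2 + 1 by omega))]
    · exact sum_congr rfl fun s _ => mul_comm _ _
    · intro s _ hs
      rw [Finset.mem_range, not_lt] at hs
      rw [Nat.choose_eq_zero_of_lt (by omega), Nat.cast_zero, zero_mul]
  rw [avg_congr h, avg_sum]
  simp only [avg_mul_const, avgChoose]

lemma sum_even {M : Type*} [AddCommMonoid M] (n : ℕ) (f : ℕ → M) :
    ∑ k ∈ Finset.range (n + 1), (if Even k then f k else 0) =
      ∑ s ∈ Finset.range (n / 2 + 1), f (2 * s) := by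
  rw [← sum_filter]
  symm
  refine sum_nbij (fun s => 2 * s) ?_ ?_ ?_ fun _ _ => rfl
  · intro s hs
    rw [Finset.mem_range] at hs
    rw [mem_filter, Finset.mem_range]
    exact ⟨by omega, even_two_mul s⟩
  · intro a _ b _ h
    simpa using h
  · intro k hk
    rw [mem_coe, mem_filter, Finset.mem_range] at hk
    obtain ⟨hk, m, rfl⟩ := hk
    refine ⟨m, ?_, (two_mul m)⟩
    rw [mem_coe, Finset.mem_range]
    omega

lemma exists_ratio_mul_avgMoved_le : ∃ M : ℝ, 0 < M ∧ ∀ n k : ℕ, 1 ≤ n → k ≤ n →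
    ratio n k * avgMoved n k ≤ 2 * (M / Real.sqrt n) ^ k := by
  obtain ⟨δ, hδ, h⟩ := exists_avg_autPoly_le
  refine ⟨Real.exp (1 + 80 * δ) * Real.sqrt (2 / δ), by positivity, fun n k hn hk => ?_⟩
  have hn' : (0 : ℝ) < n := by exact_mod_cast hn
  set r := Real.sqrt n with hr
  have hr0 : 0 < r := Real.sqrt_pos.mpr hn'
  have hrr : r * r = n := Real.mul_self_sqrt hn'.le
  have hkn : (k : ℝ) ≤ n := by exact_mod_cast hk
  set q := Real.sqrt (δ * k / n) with hq
  have hq0 : 0 ≤ q := Real.sqrt_nonneg _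
  have hq2 : q ^ 2 = δ * k / n := Real.sq_sqrt (by positivity)
  have hb : avgMoved n k * q ^ k ≤ 2 * Real.exp (80 * δ) ^ k := by
    calc _ ≤ ∑ k ∈ Finset.range (n + 1), avgMoved n k * q ^ k :=
          single_le_sum (f := fun k => avgMoved n k * q ^ k)
            (fun i _ => mul_nonneg (avgMoved_nonneg n i) (pow_nonneg hq0 i))
            (Finset.mem_range.mpr (by omega))
      _ = avg n (autPoly q) := (avg_autPoly_eq n q).symm
      _ ≤ 2 * Real.exp (80 * q ^ 2 * n) := by
          refine h n q hn ?_
          rw [hq2, div_le_iff₀ hn']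
          gcongr
      _ = _ := by
          rw [← Real.exp_nat_mul, hq2]
          congr 2
          field_simp
  have hs : Real.sqrt (2 * k) = Real.sqrt (2 / δ) * (r * q) := by
    rw [hr, hq, ← Real.sqrt_mul hn'.le, ← Real.sqrt_mul (by positivity)]
    congr 1
    field_simp
  have h1 := ratio_mul_pow_le hk
  have h2 := doubleFactorial_le_pow k
  rw [hs] at h2
  have h3 : ratio n k * r ^ k ≤ Real.exp k * (Real.sqrt (2 / δ) * q) ^ k := by
    have hrk : 0 < r ^ k := pow_pos hr0 k
    refine le_of_mul_le_mul_right ?_ hrk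
    calc ratio n k * r ^ k * r ^ k = ratio n k * (n : ℝ) ^ k := by rw [← hrr, mul_pow]; ring
      _ ≤ Real.exp k * (Real.sqrt (2 / δ) * (r * q)) ^ k := h1.trans (by gcongr)
      _ = _ := by rw [← mul_assoc, mul_right_comm, mul_pow _ r]; ring
  have hrk : 0 < r ^ k := pow_pos hr0 k
  rw [div_pow, mul_div_assoc', le_div_iff₀ hrk]
  calc ratio n k * avgMoved n k * r ^ k = ratio n k * r ^ k * avgMoved n k := by ring
    _ ≤ Real.exp k * (Real.sqrt (2 / δ) * q) ^ k * avgMoved n k := by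
        gcongr
        exact avgMoved_nonneg n k
    _ = Real.exp k * Real.sqrt (2 / δ) ^ k * (avgMoved n k * q ^ k) := by rw [mul_pow]; ring
    _ ≤ Real.exp k * Real.sqrt (2 / δ) ^ k * (2 * Real.exp (80 * δ) ^ k) := by gcongr
    _ = _ := by
        rw [Real.exp_add, mul_pow, mul_pow, ← Real.exp_nat_mul 1 k, mul_one]
        ring

/-- A lower approximation of the normalized weight of a plane tree with `c` cherries. -/
noncomputable def lowWeight (n c : ℕ) : ℝ :=
  ∑ s ∈ Finset.range (n / 2 + 1), ratio n (2 * s) * c.choose s * avgChoose n s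

/-- The normalized weight of a plane tree. -/
noncomputable def normWeight (n : ℕ) (T : PTree) : ℝ :=
  weight n T / (n.factorial * (planeTrees n).card)

lemma sum_eq_card_mul_avg {n : ℕ} (hn : 1 ≤ n) (f : PTree → ℝ) :
    ∑ T ∈ planeTrees n, f T = (planeTrees n).card * avg n f := by
  have hC : (0 : ℝ) < (planeTrees n).card := by exact_mod_cast card_planeTrees_pos hn
  rw [avg]
  field_simp

lemma lowWeight_le_normWeight {n : ℕ} (hn : 1 ≤ n) {T : PTree} (hT : T ∈ planeTrees n) :
    lowWeight n (cherries T) ≤ normWeight n T := by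
  have hC : (0 : ℝ) < (planeTrees n).card := by exact_mod_cast card_planeTrees_pos hn
  have hf : (0 : ℝ) < n.factorial := by positivity
  have h : ∑ s ∈ Finset.range (n + 1), ((n - 2 * s).factorial : ℝ) * (2 * s).doubleFactorial *
      (cherries T).choose s * ∑ S ∈ planeTrees n, ((cherries S).choose s : ℝ) ≤ weight n T := by
    exact_mod_cast le_weight hT
  rw [normWeight, le_div_iff₀ (by positivity)]
  refine le_trans ?_ h
  rw [lowWeight, sum_mul]
  refine (le_of_eq (sum_congr rfl fun s _ => ?_)).trans
    (sum_le_sum_of_subset_of_nonneg (Finset.range_mono (by omega)) fun s _ _ => by positivity)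
  rw [sum_eq_card_mul_avg hn, ratio, avgChoose]
  push_cast
  field_simp

lemma normWeight_le {n : ℕ} (hn : 1 ≤ n) {T : PTree} (hT : T ∈ planeTrees n) :
    normWeight n T ≤ ∑ k ∈ Finset.range (n + 1), ratio n k * autMoved T k * avgMoved n k := by
  have hC : (0 : ℝ) < (planeTrees n).card := by exact_mod_cast card_planeTrees_pos hn
  have hf : (0 : ℝ) < n.factorial := by positivity
  have h : (weight n T : ℝ) ≤ ∑ k ∈ Finset.range (n + 1), ((n - k).factorial : ℝ) *
      k.doubleFactorial * autMoved T k * ∑ S ∈ planeTrees n, (autMoved S k : ℝ) := by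
    exact_mod_cast weight_le hT
  rw [normWeight, div_le_iff₀ (by positivity)]
  refine h.trans (le_of_eq ?_)
  rw [sum_mul]
  refine sum_congr rfl fun s _ => ?_
  rw [sum_eq_card_mul_avg hn, ratio, avgMoved]
  push_cast
  field_simp

lemma avg_lowWeight (n : ℕ) : avg n (fun T => lowWeight n (cherries T)) =
    ∑ s ∈ Finset.range (n / 2 + 1), ratio n (2 * s) * avgChoose n s ^ 2 := by
  simp only [lowWeight]
  rw [avg_sum]
  refine sum_congr rfl fun s _ => ?_
  rw [avg_mul_const, avg_const_mul, sq, ← mul_assoc]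
  rfl

lemma avg_normWeight_le {n : ℕ} (hn : 1 ≤ n) : avg n (normWeight n) ≤
    ∑ k ∈ Finset.range (n + 1), ratio n k * avgMoved n k ^ 2 := by
  refine (avg_mono fun T hT => normWeight_le hn hT).trans (le_of_eq ?_)
  rw [avg_sum]
  refine sum_congr rfl fun s _ => ?_
  rw [avg_mul_const, avg_const_mul, sq, ← mul_assoc]
  rfl

lemma one_le_avg_normWeight {n : ℕ} (hn : 1 ≤ n) : 1 ≤ avg n (normWeight n) := by
  have h : ∀ T ∈ planeTrees n, 1 ≤ normWeight n T := fun T hT => by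
    refine le_trans ?_ (lowWeight_le_normWeight hn hT)
    have h0 : ratio n (2 * 0) * (cherries T).choose 0 * avgChoose n 0 = 1 := by
      simp [ratio_zero, avgChoose, avg_const hn]
    rw [← h0, lowWeight]
    exact single_le_sum (f := fun s => ratio n (2 * s) * (cherries T).choose s * avgChoose n s)
      (fun s _ => mul_nonneg (mul_nonneg (ratio_nonneg _ _) (Nat.cast_nonneg _)) (avgChoose_nonneg _ _))
      (Finset.mem_range.mpr (by omega))
  have := avg_mono h
  rwa [avg_const hn] at this

lemma avg_normWeight_sub_le {M : ℝ} {n : ℕ} (hn : 1 ≤ n)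
    (hM : ∀ k ≤ n, ratio n k * avgMoved n k ≤ 2 * (M / Real.sqrt n) ^ k) :
    avg n (normWeight n) - avg n (fun T => lowWeight n (cherries T)) ≤
      4 * (avg n (autPoly (M / Real.sqrt n)) - avg n fun T => (1 + M ^ 2 / n) ^ cherries T) := by
  have e1 := sum_even n fun k => ratio n k * avgChoose n (k / 2) ^ 2
  have e2 := sum_even n fun k => avgChoose n (k / 2) * (M / Real.sqrt n) ^ k
  simp only [Nat.mul_div_cancel_left _ two_pos] at e1 e2
  have hpow : ∀ s : ℕ, (M / Real.sqrt n) ^ (2 * s) = (M ^ 2 / n) ^ s := fun s => by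
    rw [pow_mul, div_pow, Real.sq_sqrt (Nat.cast_nonneg n)]
  simp only [hpow] at e2
  rw [avg_autPoly_eq, avg_pow_cherries_eq, ← e2, avg_lowWeight, ← e1, ← sum_sub_distrib, mul_sum]
  refine (sub_le_sub_right (avg_normWeight_le hn) _).trans ?_
  rw [← sum_sub_distrib]
  refine sum_le_sum fun k hk => ?_
  have hk := Finset.mem_range.mp hk
  have h := hM k (by omega)
  have hb := avgMoved_nonneg n k
  have hr := ratio_nonneg n k
  split_ifs with he
  · obtain ⟨m, rfl⟩ := he
    rw [← two_mul] at *
    rw [Nat.mul_div_cancel_left _ two_pos]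
    have hl := avgChoose_le_avgMoved n m
    have hl0 := avgChoose_nonneg n m
    set b := avgMoved n (2 * m)
    set l := avgChoose n m
    calc ratio n (2 * m) * b ^ 2 - ratio n (2 * m) * l ^ 2 = ratio n (2 * m) * (b + l) * (b - l) := by ring
      _ ≤ ratio n (2 * m) * (b + b) * (b - l) := by
        gcongr
      _ = 2 * (ratio n (2 * m) * b) * (b - l) := by ring
      _ ≤ 2 * (2 * (M / Real.sqrt n) ^ (2 * m)) * (b - l) := by
        gcongr
      _ = _ := by ring
  · nlinarith [mul_le_mul_of_nonneg_right h hb]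

end PTree

namespace PTree
open Finset PowerSeries Filter Topology

/-- The Lipschitz constant of the lower approximation of the normalized weight. -/
noncomputable def lipConst : ℝ := 2 * Real.exp 1 ^ 2 * Real.exp (2 * Real.exp 1 ^ 2)

lemma lipConst_pos : 0 < lipConst := by unfold lipConst; positivity

lemma lowWeight_succ_sub_term_le {n a s : ℕ} (hn : 1 ≤ n) (ha : a ≤ n) (hs : 2 * (s + 1) ≤ n) :
    ratio n (2 * (s + 1)) * a.choose s * avgChoose n (s + 1) ≤
      2 * Real.exp 1 ^ 2 / n * ((2 * Real.exp 1 ^ 2) ^ s / s.factorial) := by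
  have hn' : (0 : ℝ) < n := by exact_mod_cast hn
  have h1 : (a.choose s : ℝ) ≤ (n : ℝ) ^ s / s.factorial :=
    (Nat.choose_le_pow_div s a).trans (by gcongr)
  have h2 : avgChoose n (s + 1) ≤ (n : ℝ) ^ (s + 1) / (s + 1).factorial := by
    rw [← avg_const hn ((n : ℝ) ^ (s + 1) / (s + 1).factorial)]
    refine avg_mono fun T hT => (Nat.choose_le_pow_div _ _).trans ?_
    have := cherries_le hT
    gcongr
    omega
  have h3 := ratio_mul_pow_le hs
  rw [Nat.doubleFactorial_two_mul] at h3
  have h4 : Real.exp ((2 * (s + 1) : ℕ) : ℝ) = (Real.exp 1 ^ 2) ^ (s + 1) := by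
    rw [← pow_mul, ← Real.exp_nat_mul, mul_one]
  rw [h4] at h3
  push_cast at h3
  have hr := ratio_nonneg n (2 * (s + 1))
  calc _ ≤ ratio n (2 * (s + 1)) * ((n : ℝ) ^ s / s.factorial) *
        ((n : ℝ) ^ (s + 1) / (s + 1).factorial) := by
        gcongr
        exact avgChoose_nonneg _ _
    _ = (ratio n (2 * (s + 1)) * (n : ℝ) ^ (2 * (s + 1))) / (n * s.factorial * (s + 1).factorial) := by
        rw [show (n : ℝ) ^ (2 * (s + 1)) = n ^ s * n ^ (s + 1) * n by ring]
        field_simp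
    _ ≤ ((Real.exp 1 ^ 2) ^ (s + 1) * (2 ^ (s + 1) * (s + 1).factorial)) /
          (n * s.factorial * (s + 1).factorial) := by gcongr
    _ = _ := by
        rw [mul_pow, pow_succ (2 : ℝ), pow_succ (Real.exp 1 ^ 2)]
        field_simp

lemma lowWeight_succ (n a : ℕ) : lowWeight n (a + 1) = lowWeight n a +
    ∑ s ∈ Finset.range (n / 2), ratio n (2 * (s + 1)) * a.choose s * avgChoose n (s + 1) := by
  rw [lowWeight, lowWeight, sum_range_succ', sum_range_succ' _ (n / 2), add_right_comm,
    ← sum_add_distrib]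
  congr 1
  · refine sum_congr rfl fun s _ => ?_
    rw [Nat.choose_succ_succ]
    push_cast
    ring
  · simp

lemma lowWeight_mono_succ (n a : ℕ) : lowWeight n a ≤ lowWeight n (a + 1) := by
  rw [lowWeight_succ]
  exact le_add_of_nonneg_right (sum_nonneg fun s _ =>
    mul_nonneg (mul_nonneg (ratio_nonneg _ _) (Nat.cast_nonneg _)) (avgChoose_nonneg _ _))

lemma lowWeight_succ_le {n a : ℕ} (hn : 1 ≤ n) (ha : a ≤ n) :
    lowWeight n (a + 1) ≤ lowWeight n a + lipConst / n := by
  have hn' : (0 : ℝ) < n := by exact_mod_cast hn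
  rw [lowWeight_succ]
  gcongr
  calc _ ≤ ∑ s ∈ Finset.range (n / 2), 2 * Real.exp 1 ^ 2 / n *
        ((2 * Real.exp 1 ^ 2) ^ s / s.factorial) := by
        refine sum_le_sum fun s hs => lowWeight_succ_sub_term_le hn ha ?_
        have := Finset.mem_range.mp hs
        omega
    _ ≤ 2 * Real.exp 1 ^ 2 / n * Real.exp (2 * Real.exp 1 ^ 2) := by
        rw [← mul_sum]
        gcongr
        exact Real.sum_le_exp_of_nonneg (by positivity) _
    _ = _ := by rw [lipConst]; ring

lemma abs_lowWeight_sub_le_aux {n : ℕ} (hn : 1 ≤ n) (a d : ℕ) (h : a + d ≤ n) :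
    |lowWeight n (a + d) - lowWeight n a| ≤ lipConst / n * d := by
  induction d with
  | zero => simp
  | succ d ih =>
    have h1 := lowWeight_mono_succ n (a + d)
    have h2 := lowWeight_succ_le hn (show a + d ≤ n by omega)
    have h3 := ih (by omega)
    rw [abs_le] at h3 ⊢
    push_cast
    rw [← add_assoc]
    have : 0 ≤ lipConst / n := div_nonneg lipConst_pos.le (Nat.cast_nonneg n)
    constructor <;> linarith

lemma abs_lowWeight_sub_le {n a b : ℕ} (hn : 1 ≤ n) (ha : a ≤ n) (hb : b ≤ n) :
    |lowWeight n a - lowWeight n b| ≤ lipConst / n * |(a : ℝ) - b| := by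
  rcases le_total a b with h | h
  · obtain ⟨d, rfl⟩ := Nat.exists_eq_add_of_le h
    rw [abs_sub_comm]
    refine (abs_lowWeight_sub_le_aux hn a d hb).trans (le_of_eq ?_)
    push_cast
    rw [sub_add_cancel_left, abs_neg, Nat.abs_cast]
  · obtain ⟨d, rfl⟩ := Nat.exists_eq_add_of_le h
    refine (abs_lowWeight_sub_le_aux hn b d ha).trans (le_of_eq ?_)
    push_cast
    rw [add_sub_cancel_left, Nat.abs_cast]

/-- The proportion of cherries, centred. -/
noncomputable def cherryDev (n : ℕ) (T : PTree) : ℝ := (cherries T : ℝ) / n - 1 / 4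

lemma avg_abs_lowWeight_sub_le {n : ℕ} (hn : 1 ≤ n) :
    (avg n fun T => |lowWeight n (cherries T) - avg n fun S => lowWeight n (cherries S)|) ≤
      2 * lipConst * avg n fun T => |cherryDev n T| := by
  have hn' : (0 : ℝ) < n := by exact_mod_cast hn
  have hle : ∀ T ∈ planeTrees n, cherries T ≤ n := fun T hT => by
    have := cherries_le hT
    omega
  have h : ∀ T ∈ planeTrees n, |lowWeight n (cherries T) - avg n fun S => lowWeight n (cherries S)| ≤
      lipConst * (|cherryDev n T| + avg n fun S => |cherryDev n S|) := by
    intro T hT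
    have e : lowWeight n (cherries T) - (avg n fun S => lowWeight n (cherries S)) =
        avg n fun S => lowWeight n (cherries T) - lowWeight n (cherries S) := by
      rw [avg_sub, avg_const hn]
    rw [e]
    refine (abs_avg_le _ _).trans ?_
    have e2 : lipConst * (|cherryDev n T| + avg n fun S => |cherryDev n S|) =
        avg n fun S => lipConst * (|cherryDev n T| + |cherryDev n S|) := by
      rw [avg_const_mul, avg_add, avg_const hn]
    rw [e2]
    refine avg_mono fun S hS => ?_
    refine (abs_lowWeight_sub_le hn (hle T hT) (hle S hS)).trans ?_
    rw [div_mul_eq_mul_div, mul_div_assoc]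
    refine mul_le_mul_of_nonneg_left ?_ lipConst_pos.le
    have e3 : |(cherries T : ℝ) - cherries S| / n = |cherryDev n T - cherryDev n S| := by
      rw [cherryDev, cherryDev, sub_sub_sub_cancel_right, ← sub_div, abs_div, Nat.abs_cast]
    rw [e3]
    exact abs_sub _ _
  refine (avg_mono h).trans (le_of_eq ?_)
  rw [avg_const_mul, avg_add, avg_const hn]
  ring

lemma sq_le_exp_add_exp (z : ℝ) : z ^ 2 ≤ Real.exp z + Real.exp (-z) - 2 := by
  have h := sum_le_hasSum (Finset.range 2)
    (fun i _ => div_nonneg (by rw [pow_mul]; positivity) (Nat.cast_nonneg _)) (Real.hasSum_cosh z)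
  rw [Real.cosh_eq, sum_range_succ, sum_range_one] at h
  norm_num at h
  linarith

lemma tendsto_mul_exp_sub_one (a : ℝ) :
    Tendsto (fun n : ℕ => (n : ℝ) * (Real.exp (a / n) - 1)) atTop (𝓝 a) := by
  have h : HasDerivAt (fun x : ℝ => Real.exp (a * x)) a 0 := by
    simpa using ((hasDerivAt_id (0 : ℝ)).const_mul a).exp
  have h1 := h.tendsto_slope_zero
  have h2 : Tendsto (fun n : ℕ => ((n : ℝ))⁻¹) atTop (𝓝[≠] 0) := by
    refine tendsto_nhdsWithin_iff.mpr ⟨tendsto_inv_atTop_nhds_zero_nat, ?_⟩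
    filter_upwards [eventually_ge_atTop 1] with n hn
    have : (n : ℝ) ≠ 0 := by positivity
    simpa using this
  refine (h1.comp h2).congr fun n => ?_
  simp [div_eq_mul_inv]

lemma tendsto_avg_exp_cherries (a : ℝ) :
    Tendsto (fun n : ℕ => avg n fun T => Real.exp (a * cherryDev n T)) atTop (𝓝 1) := by
  have h := (tendsto_avg_cherries (tendsto_mul_exp_sub_one a)).const_mul (Real.exp (-(a / 4)))
  rw [← Real.exp_add, neg_add_cancel, Real.exp_zero] at h
  refine h.congr fun n => ?_
  rw [← avg_const_mul]
  refine avg_congr fun T _ => ?_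
  rw [add_sub_cancel, ← Real.exp_nat_mul, ← Real.exp_add, cherryDev]
  congr 1
  ring

lemma tendsto_avg_abs_cherryDev :
    Tendsto (fun n : ℕ => avg n fun T => |cherryDev n T|) atTop (𝓝 0) := by
  have h1 : Tendsto (fun n : ℕ => avg n fun T => cherryDev n T ^ 2) atTop (𝓝 0) := by
    have h := ((tendsto_avg_exp_cherries 1).add (tendsto_avg_exp_cherries (-1))).sub_const 2
    norm_num at h
    refine squeeze_zero' (.of_forall fun n => avg_nonneg fun _ _ => sq_nonneg _) ?_ h
    filter_upwards [eventually_ge_atTop 1] with n hn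
    refine (avg_mono fun T _ => sq_le_exp_add_exp (cherryDev n T)).trans (le_of_eq ?_)
    rw [avg_sub, avg_add, avg_const hn]
  have h2 := h1.sqrt
  rw [Real.sqrt_zero] at h2
  refine squeeze_zero (fun n => avg_nonneg fun _ _ => abs_nonneg _) (fun n => ?_) h2
  refine Real.le_sqrt_of_sq_le ((sq_avg_le _ _).trans (le_of_eq ?_))
  simp only [sq_abs]

lemma tendsto_avg_abs_normWeight_sub :
    Tendsto (fun n : ℕ => avg n fun T => |normWeight n T - avg n (normWeight n)|) atTop (𝓝 0) := by
  obtain ⟨M, hM, h⟩ := exists_ratio_mul_avgMoved_le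
  have h1 : Tendsto (fun n : ℕ => (n : ℝ) * (M ^ 2 / n)) atTop (𝓝 (M ^ 2)) := by
    refine tendsto_const_nhds.congr' ?_
    filter_upwards [eventually_ge_atTop 1] with n hn
    have : (n : ℝ) ≠ 0 := by positivity
    field_simp
  have h2 := (((tendsto_avg_autPoly M).sub (tendsto_avg_cherries h1)).const_mul 8).add
    (tendsto_avg_abs_cherryDev.const_mul (2 * lipConst))
  rw [sub_self, mul_zero, mul_zero, add_zero] at h2
  refine squeeze_zero' (.of_forall fun n => avg_nonneg fun _ _ => abs_nonneg _) ?_ h2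
  filter_upwards [eventually_ge_atTop 1] with n hn
  have h3 := avg_normWeight_sub_le hn fun k hk => h n k hn hk
  have h4 := avg_abs_lowWeight_sub_le hn
  set m := avg n (normWeight n)
  set g := avg n fun T => lowWeight n (cherries T)
  have hgm : g ≤ m := avg_mono fun T hT => lowWeight_le_normWeight hn hT
  have h5 : (avg n fun T => |normWeight n T - m|) ≤
      avg n fun T => (normWeight n T - lowWeight n (cherries T)) +
        |lowWeight n (cherries T) - g| + (m - g) := by
    refine avg_mono fun T hT => ?_
    have := lowWeight_le_normWeight hn hT
    rcases abs_cases (normWeight n T - m) with ⟨e, _⟩ | ⟨e, _⟩ <;>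
      rcases abs_cases (lowWeight n (cherries T) - g) with ⟨e', _⟩ | ⟨e', _⟩ <;> linarith
  rw [avg_add, avg_add, avg_sub, avg_const hn] at h5
  change _ ≤ m - g + _ + _ at h5
  linarith

lemma abs_ratio_sub_le {n : ℕ} (hn : 1 ≤ n) (P : PTree → Prop) :
    |(∑ T ∈ (planeTrees n).filter P, (weight n T : ℝ)) / ∑ T ∈ planeTrees n, (weight n T : ℝ) -
      ((planeTrees n).filter P).card / (planeTrees n).card| ≤
      avg n fun T => |normWeight n T - avg n (normWeight n)| := by
  have hC : (0 : ℝ) < (planeTrees n).card := by exact_mod_cast card_planeTrees_pos hn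
  have hf : (0 : ℝ) < n.factorial := by positivity
  have hm := one_le_avg_normWeight hn
  have hw : ∀ s : Finset PTree, ∑ T ∈ s, (weight n T : ℝ) =
      (n.factorial * (planeTrees n).card) * ∑ T ∈ s, normWeight n T := by
    intro s
    rw [mul_sum]
    refine sum_congr rfl fun T _ => ?_
    rw [normWeight]
    field_simp
  rw [hw, hw, sum_eq_card_mul_avg hn]
  change |_ * _ / (_ * (_ * avg n (normWeight n))) - _| ≤ _
  set m := avg n (normWeight n)
  have hm0 : 0 < m := by linarith
  have e : (n.factorial * (planeTrees n).card) * (∑ T ∈ (planeTrees n).filter P, normWeight n T) /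
      ((n.factorial * (planeTrees n).card) * ((planeTrees n).card * m)) -
      ((planeTrees n).filter P).card / (planeTrees n).card =
      (∑ T ∈ (planeTrees n).filter P, (normWeight n T - m)) / ((planeTrees n).card * m) := by
    rw [sum_sub_distrib, sum_const, nsmul_eq_mul]
    field_simp
  rw [e, abs_div, abs_of_pos (mul_pos hC hm0), avg]
  refine div_le_div₀ (sum_nonneg fun _ _ => abs_nonneg _) ?_ hC (by nlinarith)
  exact (abs_sum_le_sum_abs _ _).trans
    (sum_le_sum_of_subset_of_nonneg (filter_subset _ _) fun _ _ _ => abs_nonneg _)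

lemma gens_eq_of_isos_nonempty {T T' : PTree} (h : (isos T T').Nonempty) : gens T = gens T' := by
  have h1 := card_pos.mpr h
  rw [card_isos, cnt_eq] at h1
  split_ifs at h1 with h2
  · exact gens_eq_of_normalize_eq h2
  · omega

end PTree

open PTree in
/-- Corollary 7 (central limit theorem): the number of generators of the automorphism
group of the left tree of a random tanglegram of size `n` is asymptotically normally
distributed. -/
theorem clt_generators :
    ∃ γ : ℝ, 0 < γ ∧ ∃ σ : ℝ, 0 < σ ∧ ∀ x : ℝ,
      Filter.Tendsto
        (fun n : ℕ => tangleProb n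
          (fun t => (gens t.1 : ℝ) ≤ γ * n + x * σ * Real.sqrt n))
        Filter.atTop
        (nhds ((Real.sqrt (2 * Real.pi))⁻¹ * ∫ t in Set.Iic x, Real.exp (-t ^ 2 / 2))) := by
  obtain ⟨γ, hγ, σ, hσ, h⟩ := exists_tendsto_planeTrees
  refine ⟨γ, hγ, σ, hσ, fun x => ?_⟩
  refine ((h x).add (squeeze_zero_norm' ?_ tendsto_avg_abs_normWeight_sub)).congr
    (fun n => add_sub_cancel _ _) |>.trans (by rw [add_zero])
  filter_upwards [Filter.eventually_ge_atTop 1] with n hn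
  rw [tangleProb_eq n (P := fun T => (gens T : ℝ) ≤ γ * n + x * σ * Real.sqrt n)
    fun T T' hT hP => gens_eq_of_isos_nonempty hT ▸ hP]
  exact abs_ratio_sub_le hn _
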